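/- There exist a constant C > 0 and N₀ such that for every integer N ≥ N₀ the following holds: if a₁, …, a_d are positive integers, not necessarily distinct, such that every nonempty subset sum Σ_{i∈F} a_i (F a nonempty subset of {1,…,d}, where repeated values are summed with multiplicity, i.e., every element of the homogeneous Hilbert cube H(0; a₁, …, a_d)) is a pure power at most N, then d ≤ C · (log log N)⁴ / (log log log N)². -/

import Mathlib

/-- A pure power is a positive integer of the form `a ^ n` with `a ≥ 1`, `n ≥ 2`. -/
def IsPurePower (m : ℕ) : Prop := ∃ a n : ℕ, 1 ≤ a ∧ 2 ≤ n ∧ m = a ^ n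

lemma IsPurePower.exists_prime {m w : ℕ} (h : IsPurePower m) (hm : 2 ≤ m) (hw : m < 2 ^ w) :
    ∃ l, l.Prime ∧ l < w ∧ ∃ x, 2 ≤ x ∧ m = x ^ l := by
  obtain ⟨a, n, ha, hn, rfl⟩ := h
  have ha2 : 2 ≤ a := by
    rcases ha.lt_or_eq with h | h
    · exact h
    · subst h; simp at hm
  have hl := Nat.minFac_prime (show n ≠ 1 by omega)
  have e : a ^ n = (a ^ (n / n.minFac)) ^ n.minFac := by
    rw [← pow_mul, Nat.div_mul_cancel n.minFac_dvd]
  refine ⟨n.minFac, hl, ?_, a ^ (n / n.minFac), ?_, e⟩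
  · have : 2 ^ n < 2 ^ w := (Nat.pow_le_pow_left ha2 n).trans_lt hw
    exact (Nat.minFac_le (by omega)).trans_lt ((Nat.pow_lt_pow_iff_right (by norm_num)).1 this)
  · by_contra! h
    have : a ^ (n / n.minFac) = 1 := by
      have := Nat.one_le_pow (n / n.minFac) a (by omega)
      omega
    rw [e, this, one_pow] at hm
    omega

section

open Complex Metric Set

lemma norm_iteratedDeriv_logDeriv_le {f : ℂ → ℂ} {c : ℂ} {R A : ℝ} (hR : 0 < R) (hA : 0 < A)
    (hf : DifferentiableOn ℂ f (ball c R)) (h0 : ∀ z ∈ ball c R, f z ≠ 0)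
    (hle : ∀ z ∈ ball c R, ‖f z‖ ≤ Real.exp A * ‖f c‖) (k : ℕ) :
    ‖iteratedDeriv k (logDeriv f) c‖ ≤ (k + 1).factorial * (2 * A) / (R / 2) ^ (k + 1) := by
  have hc : c ∈ ball c R := mem_ball_self hR
  have hdf : DifferentiableOn ℂ (deriv f) (ball c R) := hf.deriv isOpen_ball
  have hld : DifferentiableOn ℂ (logDeriv f) (ball c R) := hdf.div hf h0
  obtain ⟨g, hgc, hg⟩ := (hld.isExactOn_ball).with_val_at c 0
  have hgd : DifferentiableOn ℂ g (ball c R) := fun z hz ↦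
    (hg z hz).differentiableAt.differentiableWithinAt
  have hfe : ∀ z ∈ ball c R, f z = f c * exp (g z) := by
    have hder : ∀ z ∈ ball c R, HasDerivAt (fun z ↦ f z * exp (-g z)) 0 z := by
      intro z hz
      have h1 := (hf.differentiableAt (isOpen_ball.mem_nhds hz)).hasDerivAt
      have h2 := (hg z hz).neg.cexp
      refine (h1.mul h2).congr_deriv ?_
      have e := h0 z hz
      simp only [logDeriv, Pi.div_apply]
      field_simp
      ring
    intro z hz
    have hconst := (convex_ball c R).isPreconnected
    have := isOpen_ball.is_const_of_deriv_eq_zero hconst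
      (fun z hz ↦ (hder z hz).differentiableAt.differentiableWithinAt)
      (fun z hz ↦ (hder z hz).deriv) hz hc
    simp only [hgc, neg_zero, exp_zero, mul_one] at this
    rw [← this, mul_assoc, ← exp_add]; simp
  have hre : ∀ z ∈ ball c R, (g z).re ≤ A := by
    intro z hz
    have h1 := hle z hz
    rw [hfe z hz, norm_mul, norm_exp, mul_comm] at h1
    exact Real.exp_le_exp.1 (le_of_mul_le_mul_right h1 (norm_pos_iff.2 (h0 c hc)))
  have hbound : ∀ z ∈ sphere c (R / 2), ‖g z‖ ≤ 2 * A := by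
    intro z hz
    have hmaps : MapsTo (fun w ↦ c + w) (ball 0 R) (ball c R) := by
      intro w hw; simpa [mem_ball, dist_eq_norm] using hw
    have hz' : ‖z - c‖ = R / 2 := by simpa [dist_eq_norm] using hz
    have := borelCaratheodory_zero (f := fun w ↦ g (c + w)) (M := A) (R := R) (z := z - c) hA
      (hgd.comp (by fun_prop) hmaps) (fun w hw ↦ hre _ (hmaps hw)) hR
      (by rw [mem_ball_zero_iff, hz']; linarith) (by simp [hgc])
    rw [hz'] at this
    simp only [add_sub_cancel] at this
    refine this.trans (le_of_eq ?_)
    field_simp; ring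
  have hdc : DiffContOnCl ℂ g (ball c (R / 2)) :=
    (hgd.mono (closedBall_subset_ball (by linarith))).diffContOnCl_ball subset_rfl
  have key := norm_iteratedDeriv_le_of_forall_mem_sphere_norm_le (k + 1) (by linarith) hdc hbound
  rw [iteratedDeriv_succ'] at key
  have : iteratedDeriv k (deriv g) c = iteratedDeriv k (logDeriv f) c := by
    apply Filter.EventuallyEq.iteratedDeriv_eq
    filter_upwards [isOpen_ball.mem_nhds hc] with z hz
    exact (hg z hz).deriv
  rwa [this] at key

end

section

open Complex Metric Set

lemma logDeriv_prod_sub_mul {h : ℂ → ℂ} {z₀ : ℂ} (hd : DifferentiableAt ℂ h z₀) (h0 : h z₀ ≠ 0)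
    (Z : Multiset ℂ) (hZ : ∀ ρ ∈ Z, z₀ ≠ ρ) :
    DifferentiableAt ℂ (fun s ↦ (Z.map (fun ρ ↦ s - ρ)).prod * h s) z₀ ∧
    (Z.map (fun ρ ↦ z₀ - ρ)).prod * h z₀ ≠ 0 ∧
    logDeriv (fun s ↦ (Z.map (fun ρ ↦ s - ρ)).prod * h s) z₀ =
      (Z.map (fun ρ ↦ (z₀ - ρ)⁻¹)).sum + logDeriv h z₀ := by
  induction Z using Multiset.induction_on with
  | empty => simpa using ⟨hd, h0⟩
  | cons ρ Z ih =>
    obtain ⟨i1, i2, i3⟩ := ih fun σ hσ ↦ hZ σ (Multiset.mem_cons_of_mem hσ)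
    have hρ : z₀ - ρ ≠ 0 := sub_ne_zero.2 (hZ ρ (Multiset.mem_cons_self _ _))
    have e : (fun s ↦ ((ρ ::ₘ Z).map (fun ρ ↦ s - ρ)).prod * h s) =
        fun s ↦ (s - ρ) * ((Z.map (fun ρ ↦ s - ρ)).prod * h s) := by
      ext s; simp [mul_assoc]
    have d1 : DifferentiableAt ℂ (fun s : ℂ ↦ s - ρ) z₀ := by fun_prop
    refine ⟨?_, ?_, ?_⟩
    · rw [e]; exact d1.mul i1
    · simpa [mul_assoc] using ⟨hρ, by simpa using i2⟩
    · rw [e, logDeriv_mul (f := fun s : ℂ ↦ s - ρ) z₀ hρ i2 d1 i1, i3]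
      simp [logDeriv_apply, add_assoc]

lemma exists_eq_sub_mul {h : ℂ → ℂ} (hd : Differentiable ℂ h) {ρ : ℂ} (h0 : h ρ = 0) :
    ∃ g : ℂ → ℂ, Differentiable ℂ g ∧ ∀ s, h s = (s - ρ) * g s := by
  refine ⟨dslope h ρ, ?_, fun s ↦ ?_⟩
  · rw [← differentiableOn_univ] at hd ⊢
    exact (differentiableOn_dslope Filter.univ_mem).2 hd
  · simpa [h0] using (sub_smul_dslope h ρ s).symm

/-- Removing zeros close to the centre preserves a relative growth bound on a disk. -/
lemma norm_le_of_prod_sub_mul {f h : ℂ → ℂ} {z₀ : ℂ} {r A : ℝ} (hr : 0 < r)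
    (hle : ∀ z ∈ closedBall z₀ r, ‖f z‖ ≤ Real.exp A * ‖f z₀‖) (hd : Differentiable ℂ h)
    (Z : Multiset ℂ) (hZ : ∀ ρ ∈ Z, ρ ∈ closedBall z₀ (r / 3))
    (hf : ∀ s, f s = (Z.map (fun ρ ↦ s - ρ)).prod * h s) :
    ∀ z ∈ closedBall z₀ r, 2 ^ Z.card * ‖h z‖ ≤ Real.exp A * ‖h z₀‖ := by
  have hlow : ∀ z ∈ sphere z₀ r, (2 * r / 3) ^ Z.card ≤ ‖(Z.map (fun ρ ↦ z - ρ)).prod‖ := by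
    intro z hz
    clear hf
    induction Z using Multiset.induction_on with
    | empty => simp
    | cons ρ Z ih =>
      simp only [Multiset.card_cons, Multiset.map_cons, Multiset.prod_cons, norm_mul, pow_succ']
      have hρ := hZ ρ (Multiset.mem_cons_self _ _)
      gcongr
      · rw [mem_sphere, dist_eq_norm] at hz
        rw [mem_closedBall, dist_comm, dist_eq_norm] at hρ
        have := norm_sub_norm_le (z - z₀) (ρ - z₀)
        rw [sub_sub_sub_cancel_right, norm_sub_rev ρ] at this
        linarith
      · exact ih fun σ hσ ↦ hZ σ (Multiset.mem_cons_of_mem hσ)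
  have hup : ‖(Z.map (fun ρ ↦ z₀ - ρ)).prod‖ ≤ (r / 3) ^ Z.card := by
    clear hf hlow
    induction Z using Multiset.induction_on with
    | empty => simp
    | cons ρ Z ih =>
      simp only [Multiset.card_cons, Multiset.map_cons, Multiset.prod_cons, norm_mul, pow_succ']
      have hρ := hZ ρ (Multiset.mem_cons_self _ _)
      rw [mem_closedBall, dist_comm, dist_eq_norm] at hρ
      gcongr
      exact ih fun σ hσ ↦ hZ σ (Multiset.mem_cons_of_mem hσ)
  have hsph : ∀ z ∈ sphere z₀ r, ‖h z‖ ≤ Real.exp A * ‖h z₀‖ / 2 ^ Z.card := by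
    intro z hz
    have h1 := hle z (sphere_subset_closedBall hz)
    rw [hf, hf, norm_mul, norm_mul] at h1
    rw [le_div_iff₀ (by positivity)]
    have h2 : (2 * r / 3) ^ Z.card * ‖h z‖ ≤ Real.exp A * ((r / 3) ^ Z.card * ‖h z₀‖) :=
      (mul_le_mul_of_nonneg_right (hlow z hz) (norm_nonneg _)).trans
        (h1.trans (by gcongr))
    have e : (2 * r / 3) ^ Z.card = 2 ^ Z.card * (r / 3) ^ Z.card := by rw [← mul_pow]; ring_nf
    rw [e] at h2
    have hp : 0 < (r / 3) ^ Z.card := by positivity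
    refine le_of_mul_le_mul_left ?_ hp
    linarith
  intro z hz
  have := norm_le_of_forall_mem_frontier_norm_le (U := ball z₀ r) isBounded_ball
    hd.diffContOnCl (by rw [frontier_ball _ hr.ne']; exact hsph)
    (by rwa [closure_ball _ hr.ne'])
  rw [le_div_iff₀ (by positivity)] at this
  linarith

lemma re_neg_logDeriv_le {f g : ℂ → ℂ} {z₀ : ℂ} {r A : ℝ} (hr : 0 < r) (hA : 0 < A)
    (hf0 : f z₀ ≠ 0)
    (hle : ∀ z ∈ closedBall z₀ r, ‖f z‖ ≤ Real.exp A * ‖f z₀‖) (hg : Differentiable ℂ g)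
    (Z : Multiset ℂ) (hZ : ∀ ρ ∈ Z, ρ ∈ closedBall z₀ (r / 3))
    (hf : ∀ s, f s = (Z.map (fun ρ ↦ s - ρ)).prod * g s)
    (hre : ∀ ρ, f ρ = 0 → ρ.re ≤ z₀.re) :
    -(logDeriv f z₀).re ≤ -(Z.map (fun ρ ↦ ((z₀ - ρ)⁻¹).re)).sum + 12 * A / r := by
  classical
  let P : ℕ → Prop := fun n ↦ ∃ W : Multiset ℂ, ∃ h : ℂ → ℂ, Differentiable ℂ h ∧ Z ≤ W ∧
    (∀ ρ ∈ W, ρ ∈ closedBall z₀ (r / 3)) ∧ (∀ s, f s = (W.map (fun ρ ↦ s - ρ)).prod * h s) ∧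
    W.card = n
  have hPZ : P Z.card := ⟨Z, g, hg, le_rfl, hZ, hf, rfl⟩
  obtain ⟨B, hB⟩ : ∃ B : ℕ, Real.exp A ≤ B := exists_nat_ge _
  have hPB : ∀ n, P n → n ≤ B := by
    rintro n ⟨W, h, hd, -, hW, hfW, rfl⟩
    have h1 := norm_le_of_prod_sub_mul hr hle hd W hW hfW z₀ (mem_closedBall_self hr.le)
    have h2 : h z₀ ≠ 0 := by
      intro h2; apply hf0; rw [hfW, h2, mul_zero]
    have h3 := le_of_mul_le_mul_right h1 (norm_pos_iff.2 h2)
    have h4 : W.card < 2 ^ W.card := Nat.lt_two_pow_self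
    have h5 : ((2 ^ W.card : ℕ) : ℝ) ≤ B := by push_cast; exact h3.trans hB
    exact h4.le.trans (by exact_mod_cast h5)
  have hmax := Nat.findGreatest_spec (P := P) (hPB _ hPZ) hPZ
  set n := Nat.findGreatest P B
  obtain ⟨W, h, hd, hZW, hW, hfW, hn⟩ := hmax
  have hz0 : h z₀ ≠ 0 := by
    intro h2; apply hf0; rw [hfW, h2, mul_zero]
  have hne : ∀ z ∈ ball z₀ (r / 3), h z ≠ 0 := by
    intro z hz hz1
    obtain ⟨h', hd', hh'⟩ := exists_eq_sub_mul hd hz1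
    have hP : P (n + 1) := ⟨z ::ₘ W, h', hd', hZW.trans (Multiset.le_cons_self _ _), by
      intro ρ hρ
      rcases Multiset.mem_cons.1 hρ with rfl | hρ
      · exact ball_subset_closedBall hz
      · exact hW ρ hρ, by
      intro s
      rw [hfW, hh', Multiset.map_cons, Multiset.prod_cons]; ring, by simp [hn]⟩
    have : n + 1 ≤ n := Nat.le_findGreatest (hPB _ hP) hP
    omega
  have hbd := norm_le_of_prod_sub_mul hr hle hd W hW hfW
  have hP := norm_iteratedDeriv_logDeriv_le (f := h) (c := z₀) (R := r / 3) (A := A) (by linarith)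
    hA hd.differentiableOn hne (fun z hz ↦ by
      refine le_trans ?_ (hbd z (closedBall_subset_closedBall (by linarith)
        (ball_subset_closedBall hz)))
      exact le_mul_of_one_le_left (norm_nonneg _) (one_le_pow₀ (by norm_num))) 0
  have hWz : ∀ ρ ∈ W, z₀ ≠ ρ := by
    rintro ρ hρ rfl
    apply hf0
    rw [hfW, Multiset.prod_eq_zero, zero_mul]
    exact Multiset.mem_map.2 ⟨z₀, hρ, sub_self _⟩
  have hlog := (logDeriv_prod_sub_mul hd.differentiableAt hz0 W hWz).2.2
  have hfe : f = fun s ↦ (W.map (fun ρ ↦ s - ρ)).prod * h s := funext hfW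
  rw [← hfe] at hlog
  rw [hlog]
  have hb : -(logDeriv h z₀).re ≤ 12 * A / r := by
    have h1 := (abs_le.1 (abs_re_le_norm (logDeriv h z₀))).1
    simp only [iteratedDeriv_zero, zero_add, Nat.factorial_one, Nat.cast_one, one_mul,
      pow_one] at hP
    have : 2 * A / (r / 3 / 2) = 12 * A / r := by field_simp; norm_num
    linarith
  have hsum : (W.map (fun ρ ↦ (z₀ - ρ)⁻¹)).sum.re = (W.map (fun ρ ↦ ((z₀ - ρ)⁻¹).re)).sum := by
    rw [← Complex.coe_reAddGroupHom, map_multiset_sum, Multiset.map_map]; rfl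
  have hsub : (Z.map (fun ρ ↦ ((z₀ - ρ)⁻¹).re)).sum ≤ (W.map (fun ρ ↦ ((z₀ - ρ)⁻¹).re)).sum := by
    obtain ⟨U, rfl⟩ := Multiset.le_iff_exists_add.1 hZW
    rw [Multiset.map_add, Multiset.sum_add]
    apply le_add_of_nonneg_right
    apply Multiset.sum_nonneg
    intro x hx
    obtain ⟨ρ, hρ, rfl⟩ := Multiset.mem_map.1 hx
    rw [inv_re]
    apply div_nonneg _ (normSq_nonneg _)
    have := hre ρ (by
      rw [hfW, Multiset.prod_eq_zero, zero_mul]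
      exact Multiset.mem_map.2 ⟨ρ, Multiset.mem_add.2 (Or.inr hρ), sub_self _⟩)
    simpa using this
  rw [add_re, hsum]
  linarith

end

section

open Complex Metric Set Filter Topology

section CharacterBounds

variable {l : ℕ} [NeZero l] {χ : DirichletCharacter ℂ l}

lemma sum_range_level_eq_zero (hχ : χ ≠ 1) : ∑ k ∈ Finset.range l, χ (k : ZMod l) = 0 := by
  rw [← MulChar.sum_eq_zero_of_ne_one hχ]
  symm
  refine Finset.sum_bij' (fun (a : ZMod l) _ ↦ a.val) (fun k _ ↦ (k : ZMod l)) ?_ ?_ ?_ ?_ ?_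
  · intro a _; exact Finset.mem_range.2 (ZMod.val_lt a)
  · simp
  · intro a _; simp
  · intro k hk; exact ZMod.val_cast_of_lt (Finset.mem_range.1 hk)
  · intro a _; simp

lemma norm_sum_range_char_le (hχ : χ ≠ 1) (n : ℕ) :
    ‖∑ k ∈ Finset.range n, χ (k : ZMod l)‖ ≤ l := by
  induction n using Nat.strong_induction_on with
  | _ n ih =>
    rcases lt_or_ge n l with h | h
    · calc _ ≤ ∑ k ∈ Finset.range n, ‖χ (k : ZMod l)‖ := norm_sum_le _ _
        _ ≤ ∑ k ∈ Finset.range n, (1 : ℝ) := Finset.sum_le_sum fun k _ ↦ χ.norm_le_one _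
        _ ≤ l := by simpa using h.le
    · obtain ⟨m, rfl⟩ := Nat.exists_eq_add_of_le h
      rw [Finset.sum_range_add, sum_range_level_eq_zero hχ, zero_add]
      simpa using ih m (by have := NeZero.pos l; omega)

lemma norm_sum_Icc_char_le (hχ : χ ≠ 1) (n : ℕ) :
    ‖∑ k ∈ Finset.Icc 1 n, χ (k : ZMod l)‖ ≤ l := by
  have h := norm_sum_range_char_le hχ (n + 1)
  have hl : l ≠ 1 := fun h ↦ hχ (DirichletCharacter.level_one' χ h)
  have h0 : χ ((0 : ℕ) : ZMod l) = 0 := by simpa using χ.map_zero' hl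
  rw [Finset.sum_range_succ', h0, add_zero] at h
  rwa [← Finset.Ico_add_one_right_eq_Icc, Finset.sum_Ico_eq_sum_range, Nat.add_sub_cancel,
    Finset.sum_congr rfl fun k _ ↦ by rw [add_comm 1 k]]

lemma norm_LFunction_le (hχ : χ ≠ 1) {s : ℂ} (hs : 1 / 2 ≤ s.re) :
    ‖DirichletCharacter.LFunction χ s‖ ≤ 2 * l * ‖s‖ := by
  let g : ℝ → ℂ := (Ioi (1 : ℝ)).indicator fun t ↦ ∑ k ∈ Finset.Icc 1 ⌊t⌋₊, χ (k : ZMod l)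
  have hgb : ∀ t, ‖g t‖ ≤ l := by
    intro t
    simp only [g, indicator]
    split_ifs
    · exact norm_sum_Icc_char_le hχ _
    · simp
  have hgm : Measurable g := by
    apply Measurable.indicator _ measurableSet_Ioi
    exact (measurable_from_nat (f := fun n : ℕ ↦ ∑ k ∈ Finset.Icc 1 n, χ (k : ZMod l))).comp
      Nat.measurable_floor
  have hgl : MeasureTheory.LocallyIntegrableOn g (Ioi 0) := by
    apply MeasureTheory.LocallyIntegrable.locallyIntegrableOn
    have : MeasureTheory.LocallyIntegrable (fun _ : ℝ ↦ (l : ℝ)) :=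
      MeasureTheory.locallyIntegrable_const _
    exact this.mono hgm.aestronglyMeasurable (Eventually.of_forall fun t ↦ by simpa using hgb t)
  have hmel : ∀ s : ℂ, mellin g (-s) =
      ∫ t in Ioi (1 : ℝ), (∑ k ∈ Finset.Icc 1 ⌊t⌋₊, χ (k : ZMod l)) * (t : ℂ) ^ (-(s + 1)) := by
    intro s
    rw [mellin, ← MeasureTheory.integral_indicator measurableSet_Ioi,
      ← MeasureTheory.integral_indicator measurableSet_Ioi]
    congr 1
    ext t
    simp only [g, indicator, mem_Ioi, smul_eq_mul]
    rcases lt_or_ge 1 t with h | h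
    · rw [if_pos h, if_pos h, if_pos (by linarith), neg_add', mul_comm]
    · simp [not_lt.2 h]
  have hana : ∀ s : ℂ, 0 < s.re → DifferentiableAt ℂ (fun s ↦ s * mellin g (-s)) s := by
    intro s hs
    have h1 : DifferentiableAt ℂ (mellin g) (-s) := by
      apply mellin_differentiableAt_of_isBigO_rpow (a := 0) (b := (-s).re - 1) hgl
      · simp only [neg_zero, Real.rpow_zero]
        exact Asymptotics.isBigO_of_le' (c := l) _ fun t ↦ by simpa using hgb t
      · simpa using hs
      · refine Asymptotics.IsBigO.of_bound 0 ?_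
        have : Iio (1 : ℝ) ∈ 𝓝[>] (0 : ℝ) := mem_nhdsWithin_of_mem_nhds (Iio_mem_nhds one_pos)
        filter_upwards [this] with t ht
        have : ¬ 1 < t := not_lt.2 (le_of_lt ht)
        simp [g, this]
      · linarith
    have h2 : DifferentiableAt ℂ (fun s ↦ mellin g (-s)) s :=
      DifferentiableAt.comp (g := mellin g) (f := fun s : ℂ ↦ -s) s h1 (by fun_prop)
    fun_prop
  have hU : IsOpen {s : ℂ | 0 < s.re} := isOpen_lt continuous_const continuous_re
  have hpre : IsPreconnected {s : ℂ | 0 < s.re} := (convex_halfSpace_re_gt 0).isPreconnected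
  have heq : EqOn (DirichletCharacter.LFunction χ) (fun s ↦ s * mellin g (-s))
      {s : ℂ | 0 < s.re} := by
    refine AnalyticOnNhd.eqOn_of_preconnected_of_eventuallyEq (𝕜 := ℂ) (z₀ := 2) ?_ ?_ hpre (by simp) ?_
    · exact (DirichletCharacter.differentiable_LFunction hχ).differentiableOn.analyticOnNhd hU
    · exact DifferentiableOn.analyticOnNhd (fun s hs ↦ (hana s hs).differentiableWithinAt) hU
    · have : {s : ℂ | 1 < s.re} ∈ 𝓝 (2 : ℂ) :=
        (isOpen_lt continuous_const continuous_re).mem_nhds (by simp)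
      filter_upwards [this] with s hs
      rw [DirichletCharacter.LFunction_eq_LSeries χ hs, hmel]
      refine LSeries_eq_mul_integral _ le_rfl (lt_trans one_pos hs)
        (DirichletCharacter.LSeriesSummable_of_one_lt_re χ hs) ?_
      simp only [Real.rpow_zero]
      exact Asymptotics.isBigO_of_le' (c := l) _ fun n ↦ by simpa using norm_sum_Icc_char_le hχ n
  have hs0 : 0 < s.re := by linarith
  rw [heq hs0, norm_mul, hmel]
  have hint : ‖∫ t in Ioi (1 : ℝ), (∑ k ∈ Finset.Icc 1 ⌊t⌋₊, χ (k : ZMod l)) *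
      (t : ℂ) ^ (-(s + 1))‖ ≤ ∫ t in Ioi (1 : ℝ), (l : ℝ) * t ^ (-(s.re + 1)) := by
    apply MeasureTheory.norm_integral_le_of_norm_le
    · exact (integrableOn_Ioi_rpow_of_lt (by linarith) one_pos).const_mul _
    · filter_upwards [MeasureTheory.ae_restrict_mem measurableSet_Ioi] with t ht
      have ht0 : (0 : ℝ) < t := lt_trans one_pos ht
      rw [norm_mul, norm_cpow_eq_rpow_re_of_pos ht0]
      simp only [neg_re, add_re, one_re]
      gcongr
      exact norm_sum_Icc_char_le hχ _
  rw [MeasureTheory.integral_const_mul, integral_Ioi_rpow_of_lt (by linarith) one_pos] at hint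
  have : (l : ℝ) * (-1 ^ (-(s.re + 1) + 1) / (-(s.re + 1) + 1)) ≤ 2 * l := by
    rw [Real.one_rpow]
    have e : -1 / (-(s.re + 1) + 1) = 1 / s.re := by
      rw [show -(s.re + 1) + 1 = -s.re by ring, neg_div_neg_eq]
    rw [e, mul_comm]
    gcongr
    rw [div_le_iff₀ hs0]; linarith
  calc _ ≤ ‖s‖ * (2 * l) := by gcongr; exact hint.trans this
    _ = _ := by ring

end CharacterBounds

end

section

open Complex Metric Set Filter Topology

lemma exists_norm_LFunctionTrivChar₁_bounds :
    ∃ η : ℝ, 0 < η ∧ η ≤ 1 / 2 ∧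
      (∀ s ∈ ball (1 : ℂ) η, s ≠ 1 → ‖(s - 1) * riemannZeta s‖ ≤ 2) ∧
      ∀ l : ℕ, (hl : l.Prime) → ∀ s ∈ ball (1 : ℂ) η,
        1 / 8 ≤ ‖@DirichletCharacter.LFunctionTrivChar₁ l ⟨hl.ne_zero⟩ s‖ ∧
        ‖@DirichletCharacter.LFunctionTrivChar₁ l ⟨hl.ne_zero⟩ s‖ ≤ 4 := by
  have h1 := (riemannZeta_residue_one).norm
  rw [norm_one] at h1
  have h2 : ∀ᶠ s in 𝓝[≠] (1 : ℂ), ‖(s - 1) * riemannZeta s‖ ∈ Ioo (1 / 2 : ℝ) 2 :=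
    h1.eventually_mem (Ioo_mem_nhds (by norm_num) (by norm_num))
  obtain ⟨ε, hε, h3⟩ := Metric.mem_nhdsWithin_iff.1 h2
  have h4 : ∀ s ∈ ball (1 : ℂ) (min ε (1 / 2)), s ≠ 1 →
      ‖(s - 1) * riemannZeta s‖ ∈ Ioo (1 / 2 : ℝ) 2 := fun s hs hs1 ↦
    h3 ⟨ball_subset_ball (min_le_left _ _) hs, hs1⟩
  refine ⟨min ε (1 / 2), by positivity, min_le_right _ _, fun s hs hs1 ↦ (h4 s hs hs1).2.le, ?_⟩
  intro l hl s hs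
  have : NeZero l := ⟨hl.ne_zero⟩
  have hre : 1 / 2 < s.re := by
    have h5 : ‖s - 1‖ < 1 / 2 := by
      have := ball_subset_ball (min_le_right ε (1 / 2)) hs
      rwa [mem_ball, dist_eq_norm] at this
    have := (abs_lt.1 ((abs_re_le_norm (s - 1)).trans_lt h5)).1
    simp at this
    linarith
  have hfac : ∀ s : ℂ, 1 / 2 < s.re →
      1 / 4 ≤ ‖1 - (l : ℂ) ^ (-s)‖ ∧ ‖1 - (l : ℂ) ^ (-s)‖ ≤ 2 := by
    intro s hre
    have hn : ‖(l : ℂ) ^ (-s)‖ ≤ 3 / 4 := by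
      rw [norm_natCast_cpow_of_pos hl.pos, neg_re]
      calc (l : ℝ) ^ (-s.re) ≤ (2 : ℝ) ^ (-s.re) :=
            Real.rpow_le_rpow_of_nonpos (by norm_num) (by exact_mod_cast hl.two_le) (by linarith)
        _ ≤ (2 : ℝ) ^ (-(1 / 2) : ℝ) := Real.rpow_le_rpow_of_exponent_le (by norm_num) (by linarith)
        _ ≤ 3 / 4 := by
          rw [Real.rpow_neg (by norm_num), ← Real.sqrt_eq_rpow]
          have : (4 / 3 : ℝ) ≤ √2 := Real.le_sqrt_of_sq_le (by norm_num)
          calc (√2)⁻¹ ≤ (4 / 3 : ℝ)⁻¹ := by gcongr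
            _ = 3 / 4 := by norm_num
    constructor
    · have := norm_sub_norm_le (1 : ℂ) ((l : ℂ) ^ (-s))
      rw [norm_one] at this; linarith
    · have := norm_sub_le (1 : ℂ) ((l : ℂ) ^ (-s))
      rw [norm_one] at this; linarith
  have hf := hfac s hre
  rcases eq_or_ne s 1 with rfl | hs1
  · simp only [DirichletCharacter.LFunctionTrivChar₁, Function.update_self,
      hl.primeFactors, Finset.prod_singleton]
    rw [cpow_neg_one] at hf
    constructor <;> linarith
  · simp only [DirichletCharacter.LFunctionTrivChar₁, Function.update_of_ne hs1]
    rw [DirichletCharacter.LFunctionTrivChar_eq_mul_riemannZeta hs1, hl.primeFactors,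
      Finset.prod_singleton, mul_left_comm, norm_mul]
    have h5 := h4 s hs hs1
    constructor
    · calc (1 / 8 : ℝ) = 1 / 4 * (1 / 2) := by norm_num
        _ ≤ _ := mul_le_mul hf.1 h5.1.le (by norm_num) (norm_nonneg _)
    · calc _ ≤ 2 * (2 : ℝ) := mul_le_mul hf.2 h5.2.le (norm_nonneg _) (by norm_num)
        _ = 4 := by norm_num

lemma norm_LSeries_le_norm_riemannZeta {f : ℕ → ℂ} (hf : ∀ n, ‖f n‖ ≤ 1) {x : ℝ} (hx : 1 < x) :
    ‖LSeries f x‖ ≤ ‖riemannZeta x‖ := by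
  have hs : (1 : ℝ) < (x : ℂ).re := by simpa
  have h1 : LSeriesSummable 1 (x : ℂ) := LSeriesSummable_one_iff.2 hs
  have hle : ∀ n, ‖LSeries.term f x n‖ ≤ ‖LSeries.term 1 x n‖ := fun n ↦
    LSeries.norm_term_le _ (by simpa using hf n)
  have hreal : ∀ n, LSeries.term 1 (x : ℂ) n = ((‖LSeries.term 1 (x : ℂ) n‖ : ℝ) : ℂ) := by
    intro n
    rcases eq_or_ne n 0 with rfl | hn
    · simp
    · have : (n : ℂ) ^ (x : ℂ) = ((n : ℝ) ^ x : ℝ) := by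
        rw [ofReal_cpow n.cast_nonneg]; simp
      rw [LSeries.term_of_ne_zero hn, this]
      simp only [Pi.one_apply, norm_div, norm_one, norm_real, Real.norm_eq_abs]
      rw [abs_of_nonneg (by positivity)]
      push_cast; rfl
  rw [← LSeries_one_eq_riemannZeta hs]
  calc ‖LSeries f x‖ ≤ ∑' n, ‖LSeries.term f x n‖ :=
        norm_tsum_le_tsum_norm (h1.norm.of_nonneg_of_le (fun _ ↦ norm_nonneg _) hle)
    _ ≤ ∑' n, ‖LSeries.term 1 x n‖ :=
        (h1.norm.of_nonneg_of_le (fun _ ↦ norm_nonneg _) hle).tsum_le_tsum hle h1.norm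
    _ = ‖LSeries 1 (x : ℂ)‖ := by
        rw [LSeries, tsum_congr hreal, ← ofReal_tsum, norm_real, Real.norm_eq_abs, abs_of_nonneg]
        · exact tsum_nonneg fun _ ↦ norm_nonneg _

lemma one_le_norm_LFunction_mul {l : ℕ} [NeZero l] (χ : DirichletCharacter ℂ l) {x : ℝ}
    (hx : 1 < x) : 1 ≤ ‖DirichletCharacter.LFunction χ x‖ * ‖riemannZeta x‖ := by
  have hs : (1 : ℝ) < (x : ℂ).re := by simpa
  have h1 := DirichletCharacter.LSeries.mul_mu_eq_one χ hs
  rw [DirichletCharacter.LFunction_eq_LSeries χ hs, ← norm_one (α := ℂ), ← h1, norm_mul]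
  gcongr
  apply norm_LSeries_le_norm_riemannZeta _ hx
  intro n
  simp only [Pi.mul_apply, norm_mul]
  refine mul_le_one₀ (χ.norm_le_one _) (norm_nonneg _) ?_
  simp only [norm_intCast]
  exact_mod_cast ArithmeticFunction.abs_moebius_le_one

end

section

open Complex Metric Set Filter Topology

lemma iteratedDeriv_inv_sub (k : ℕ) (c s : ℂ) :
    iteratedDeriv k (fun z ↦ (z - c)⁻¹) s = (-1) ^ k * k.factorial * ((s - c) ^ (k + 1))⁻¹ := by
  have h := congrFun (iteratedDeriv_comp_add_const k (fun z : ℂ ↦ z⁻¹) (-c)) s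
  simp only [← sub_eq_add_neg] at h
  rw [h, iteratedDeriv_eq_iterate, iter_deriv_inv, ← zpow_natCast (s - c), ← zpow_neg]
  congr 2
  push_cast; ring

lemma iteratedDeriv_logDeriv_zpow_mul {f h : ℂ → ℂ} {c s : ℂ} (m : ℤ) (hh : Differentiable ℂ h)
    (hs : s ≠ c) (h0 : h s ≠ 0) (hf : ∀ᶠ z in 𝓝 s, f z = (z - c) ^ m * h z) (k : ℕ) :
    iteratedDeriv k (logDeriv f) s =
      m * ((-1) ^ k * k.factorial * ((s - c) ^ (k + 1))⁻¹) + iteratedDeriv k (logDeriv h) s := by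
  have hev : ∀ᶠ z in 𝓝 s, h z ≠ 0 := hh.continuous.continuousAt.eventually_ne h0
  have hev' : ∀ᶠ z in 𝓝 s, z ≠ c := eventually_ne_nhds hs
  have e : logDeriv f =ᶠ[𝓝 s] (fun z ↦ m * (z - c)⁻¹) + logDeriv h := by
    filter_upwards [hev, hev', hf.eventually_nhds] with z h1 h2 h3
    have h4 : f =ᶠ[𝓝 z] fun w ↦ (w - c) ^ m * h w := h3
    have h5 : DifferentiableAt ℂ (fun w : ℂ ↦ w - c) z := by fun_prop
    rw [logDeriv_apply, h4.deriv_eq, h4.eq_of_nhds, ← logDeriv_apply (fun w ↦ (w - c) ^ m * h w),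
      logDeriv_mul (f := fun w : ℂ ↦ (w - c) ^ m) z (zpow_ne_zero _ (sub_ne_zero.2 h2)) h1
        (h5.zpow (Or.inl (sub_ne_zero.2 h2))) (hh z), logDeriv_fun_zpow h5]
    simp [logDeriv_apply]
  have hA : AnalyticAt ℂ (fun z ↦ (z - c)⁻¹) s :=
    ((analyticAt_id).sub analyticAt_const).inv (sub_ne_zero.2 hs)
  rw [e.iteratedDeriv_eq, iteratedDeriv_add, iteratedDeriv_const_mul_field, iteratedDeriv_inv_sub]
  · exact (analyticAt_const.mul hA).contDiffAt
  · apply AnalyticAt.contDiffAt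
    have ha := hh.analyticAt s
    exact ha.deriv.div ha h0

lemma re_LSeries_nonneg {f : ℕ → ℂ} (hf : ∀ n, 0 ≤ (f n).re) (x : ℝ) :
    0 ≤ (LSeries f x).re := by
  by_cases h : LSeriesSummable f x
  · rw [LSeries, re_tsum h]
    apply tsum_nonneg
    intro n
    rcases eq_or_ne n 0 with rfl | hn
    · simp
    · have : (n : ℂ) ^ (x : ℂ) = ((n : ℝ) ^ x : ℝ) := by
        rw [ofReal_cpow n.cast_nonneg]; simp
      rw [LSeries.term_of_ne_zero hn, this, div_ofReal_re]
      exact div_nonneg (hf n) (by positivity)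
  · rw [LSeries, tsum_eq_zero_of_not_summable h, zero_re]

section

variable {l : ℕ} [NeZero l] (χ : DirichletCharacter ℂ l) {x : ℝ}

lemma neg_logDeriv_LFunction_eq {s : ℂ} (hs : 1 < s.re) :
    -logDeriv (DirichletCharacter.LFunction χ) s =
      LSeries ((fun n : ℕ ↦ χ n) * (fun n : ℕ ↦ (ArithmeticFunction.vonMangoldt n : ℂ))) s := by
  rw [DirichletCharacter.LSeries_twist_vonMangoldt_eq χ hs, logDeriv_apply,
    DirichletCharacter.deriv_LFunction_eq_deriv_LSeries χ hs,
    DirichletCharacter.LFunction_eq_LSeries χ hs, neg_div]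

lemma re_neg_logDeriv_add_nonneg (hx : 1 < x) :
    0 ≤ -(logDeriv (DirichletCharacter.LFunction (1 : DirichletCharacter ℂ l)) x).re +
      -(logDeriv (DirichletCharacter.LFunction χ) x).re := by
  have hs : 1 < (x : ℂ).re := by simpa
  have s1 := DirichletCharacter.LSeriesSummable_twist_vonMangoldt (1 : DirichletCharacter ℂ l) hs
  have s2 := DirichletCharacter.LSeriesSummable_twist_vonMangoldt χ hs
  rw [← neg_re, ← neg_re, neg_logDeriv_LFunction_eq _ hs, neg_logDeriv_LFunction_eq _ hs, ← add_re,
    ← LSeries_add s1 s2]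
  apply re_LSeries_nonneg
  intro n
  simp only [Pi.add_apply, Pi.mul_apply, add_re, re_mul_ofReal]
  rw [← add_mul]
  refine mul_nonneg ?_ ArithmeticFunction.vonMangoldt_nonneg
  by_cases hu : IsUnit (n : ZMod l)
  · rw [MulChar.one_apply hu, one_re]
    have := (abs_le.1 ((abs_re_le_norm (χ n)).trans (χ.norm_le_one _))).1
    linarith
  · rw [MulChar.map_nonunit _ hu, MulChar.map_nonunit _ hu]; simp

lemma re_neg_logDeriv_three_four_one (hx : 1 < x) :
    0 ≤ 3 * -(logDeriv (DirichletCharacter.LFunction (1 : DirichletCharacter ℂ l)) x).re +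
      4 * -(logDeriv (DirichletCharacter.LFunction χ) x).re +
      -(logDeriv (DirichletCharacter.LFunction (χ ^ 2)) x).re := by
  have hs : 1 < (x : ℂ).re := by simpa
  have s1 := DirichletCharacter.LSeriesSummable_twist_vonMangoldt (1 : DirichletCharacter ℂ l) hs
  have s2 := DirichletCharacter.LSeriesSummable_twist_vonMangoldt χ hs
  have s3 := DirichletCharacter.LSeriesSummable_twist_vonMangoldt (χ ^ 2) hs
  rw [← neg_re, ← neg_re, ← neg_re, neg_logDeriv_LFunction_eq _ hs, neg_logDeriv_LFunction_eq _ hs,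
    neg_logDeriv_LFunction_eq _ hs]
  have e : ∀ a b c : ℂ, 3 * a.re + 4 * b.re + c.re = ((3 : ℂ) * a + (4 : ℂ) * b + c).re := by
    intro a b c; simp
  rw [e, ← LSeries_smul, ← LSeries_smul, ← LSeries_add (s1.smul 3) (s2.smul 4),
    ← LSeries_add ((s1.smul 3).add (s2.smul 4)) s3]
  apply re_LSeries_nonneg
  intro n
  simp only [Pi.add_apply, Pi.mul_apply, Pi.smul_apply, smul_eq_mul, ← mul_assoc]
  rw [← add_mul, ← add_mul, re_mul_ofReal]
  refine mul_nonneg ?_ ArithmeticFunction.vonMangoldt_nonneg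
  by_cases hu : IsUnit (n : ZMod l)
  · rw [MulChar.one_apply hu, MulChar.pow_apply' _ two_ne_zero]
    have h1 : ‖χ n‖ = 1 := by
      obtain ⟨u, hu⟩ := hu
      rw [← hu]; exact χ.unit_norm_eq_one u
    have h2 : (χ n).re ^ 2 + (χ n).im ^ 2 = 1 := by
      have := Complex.sq_norm (χ n)
      rw [h1, normSq_apply] at this; nlinarith
    simp only [add_re, mul_re, pow_two, re_ofNat, im_ofNat, one_re, one_im]
    nlinarith [sq_nonneg ((χ n).re + 1)]
  · rw [MulChar.map_nonunit _ hu, MulChar.map_nonunit _ hu, MulChar.map_nonunit _ hu]; simp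

lemma norm_LFunction_le_exp_mul {χ : DirichletCharacter ℂ l} (hχ : χ ≠ 1) {η t Q : ℝ}
    (hη : ∀ s ∈ ball (1 : ℂ) η, s ≠ 1 → ‖(s - 1) * riemannZeta s‖ ≤ 2)
    (ht : 0 < t) (htη : t < η) (ht2 : t ≤ 1 / 2) (hQ : (l : ℝ) ≤ Real.exp Q)
    (htQ : 8 / t ≤ Real.exp (2 * Q)) :
    ∀ z ∈ closedBall (1 + t : ℂ) (1 / 2), ‖DirichletCharacter.LFunction χ z‖ ≤
      Real.exp (3 * Q) * ‖DirichletCharacter.LFunction χ (1 + t : ℂ)‖ := by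
  intro z hz
  have hz1 : ‖z - (1 + t)‖ ≤ 1 / 2 := by simpa [dist_eq_norm] using hz
  have hre : 1 / 2 ≤ z.re := by
    have := (abs_le.1 ((abs_re_le_norm _).trans hz1)).1
    simp at this; linarith
  have hnz : ‖z‖ ≤ 2 := by
    calc ‖z‖ = ‖(z - (1 + t)) + (1 + t)‖ := by ring_nf
      _ ≤ 1 / 2 + ‖(1 + t : ℂ)‖ := (norm_add_le _ _).trans (by gcongr)
      _ ≤ 2 := by
        have : (1 + t : ℂ) = ((1 + t : ℝ) : ℂ) := by push_cast; rfl
        rw [this, norm_real, Real.norm_eq_abs, abs_of_pos (by linarith)]; linarith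
  have h1 := norm_LFunction_le hχ hre
  have h2 := one_le_norm_LFunction_mul χ (x := 1 + t) (by linarith)
  have h3 := hη ((1 + t : ℝ) : ℂ) (by
    rw [mem_ball, dist_eq_norm]
    have : ((1 + t : ℝ) : ℂ) - 1 = (t : ℂ) := by push_cast; ring
    rwa [this, norm_real, Real.norm_eq_abs, abs_of_pos ht]) (by
      norm_cast; linarith)
  have h4 : ‖riemannZeta ((1 + t : ℝ) : ℂ)‖ ≤ 2 / t := by
    rw [norm_mul] at h3
    have : ((1 + t : ℝ) : ℂ) - 1 = (t : ℂ) := by push_cast; ring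
    rw [this, norm_real, Real.norm_eq_abs, abs_of_pos ht] at h3
    rw [le_div_iff₀ ht]; linarith
  push_cast at h2 h4
  set a := ‖DirichletCharacter.LFunction χ (1 + t : ℂ)‖
  have h5 : 1 ≤ a * (2 / t) := h2.trans (by gcongr)
  calc ‖DirichletCharacter.LFunction χ z‖ ≤ 2 * l * ‖z‖ := h1
    _ ≤ 2 * Real.exp Q * 2 := by gcongr
    _ = 4 * Real.exp Q * 1 := by ring
    _ ≤ 4 * Real.exp Q * (a * (2 / t)) := by gcongr
    _ = 8 / t * Real.exp Q * a := by ring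
    _ ≤ Real.exp (2 * Q) * Real.exp Q * a := by gcongr
    _ = Real.exp (3 * Q) * a := by rw [← Real.exp_add]; ring_nf

end

end

section

open Complex Metric Set Filter Topology

lemma exists_logDeriv_trivial_bounds :
    ∃ η : ℝ, 0 < η ∧ η ≤ 1 / 2 ∧
      (∀ s ∈ ball (1 : ℂ) η, s ≠ 1 → ‖(s - 1) * riemannZeta s‖ ≤ 2) ∧
      ∀ (l : ℕ) [Fact l.Prime] (t R : ℝ), 0 < t → 0 < R → t + R ≤ η → ∀ k : ℕ,
        ‖iteratedDeriv k (logDeriv (DirichletCharacter.LFunction (1 : DirichletCharacter ℂ l)))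
            (1 + t) + (-1) ^ k * k.factorial * ((t : ℂ) ^ (k + 1))⁻¹‖ ≤
          (k + 1).factorial * 8 / (R / 2) ^ (k + 1) := by
  obtain ⟨η, hη, hη2, hz, hb⟩ := exists_norm_LFunctionTrivChar₁_bounds
  refine ⟨η, hη, hη2, hz, ?_⟩
  intro l hl t R ht hR htR k
  have hb := hb l hl.out
  set h := DirichletCharacter.LFunctionTrivChar₁ l with hh
  have hsub : ball (1 + t : ℂ) R ⊆ ball 1 η := by
    apply ball_subset_ball'
    rw [dist_eq_norm]
    have : (1 + t : ℂ) - 1 = t := by ring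
    rw [this, norm_real, Real.norm_eq_abs, abs_of_pos ht]; linarith
  have hd : Differentiable ℂ h := DirichletCharacter.differentiable_LFunctionTrivChar₁ l
  have hc : (1 + t : ℂ) ∈ ball (1 + t : ℂ) R := mem_ball_self hR
  have h0 : ∀ z ∈ ball (1 + t : ℂ) R, h z ≠ 0 := by
    intro z hz' h0
    have := (hb z (hsub hz')).1
    rw [h0, norm_zero] at this; norm_num at this
  have h1 := norm_iteratedDeriv_logDeriv_le (f := h) (c := 1 + t) hR (A := 4) (by norm_num)
    hd.differentiableOn h0 (by
      intro z hz'
      have a1 := (hb z (hsub hz')).2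
      have a2 := (hb _ (hsub hc)).1
      have a3 : (32 : ℝ) ≤ Real.exp 4 := by
        have : (2.7 : ℝ) ≤ Real.exp 1 := by have := Real.exp_one_gt_d9; linarith
        calc (32 : ℝ) ≤ 2.7 ^ 4 := by norm_num
          _ ≤ Real.exp 1 ^ 4 := by gcongr
          _ = Real.exp 4 := by rw [← Real.exp_nat_mul]; norm_num
      nlinarith [norm_nonneg (h (1 + t))]) k
  have hne : (1 + t : ℂ) ≠ 1 := by
    intro h; have : (t : ℂ) = 0 := by linear_combination h
    exact ht.ne' (by exact_mod_cast this)
  have h2 := iteratedDeriv_logDeriv_zpow_mul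
    (f := DirichletCharacter.LFunction (1 : DirichletCharacter ℂ l)) (-1) hd hne (h0 _ hc) (by
      filter_upwards [eventually_ne_nhds hne] with z hz1
      have : z - 1 ≠ 0 := sub_ne_zero.2 hz1
      rw [hh, DirichletCharacter.LFunctionTrivChar₁, Function.update_of_ne hz1, zpow_neg, zpow_one,
        ← mul_assoc, inv_mul_cancel₀ this, one_mul]) k
  rw [h2]
  have e : (1 + t : ℂ) - 1 = t := by ring
  rw [e]
  convert h1 using 2
  · push_cast; ring
  · norm_num

end

section

open Complex Metric Set Filter Topology

/-- Parameters of a zero-free region for the Dirichlet `L`-functions modulo `l`: `Q` bounds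
`log l`, and `σ` is a small multiple of `Q⁻¹`. -/
structure IsAdmissible (l : ℕ) [NeZero l] (η σ Q : ℝ) : Prop where
  zeta_le : ∀ s ∈ ball (1 : ℂ) η, s ≠ 1 → ‖(s - 1) * riemannZeta s‖ ≤ 2
  trivial_le : ∀ t R : ℝ, 0 < t → 0 < R → t + R ≤ η → ∀ k : ℕ,
    ‖iteratedDeriv k (logDeriv (DirichletCharacter.LFunction (1 : DirichletCharacter ℂ l)))
        (1 + t) + (-1) ^ k * k.factorial * ((t : ℂ) ^ (k + 1))⁻¹‖ ≤
      (k + 1).factorial * 8 / (R / 2) ^ (k + 1)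
  σ_pos : 0 < σ
  σ_small : 600 * σ ≤ η
  η_le : η ≤ 1 / 2
  level_le : (l : ℝ) ≤ Real.exp Q
  inv_le : 8 / σ ≤ Real.exp (2 * Q)
  mul_eq : 80000 * Q * σ = 1
  le_Q : 32 / η ≤ Q

section

variable {l : ℕ} [NeZero l] {η σ Q : ℝ} (H : IsAdmissible l η σ Q)
  {χ : DirichletCharacter ℂ l}
include H

lemma IsAdmissible.Q_pos : 0 < Q := by
  have h1 := H.mul_eq
  have h2 := H.σ_pos
  by_contra! h
  nlinarith [mul_nonneg_of_nonpos_of_nonpos h (neg_nonpos.2 h2.le)]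

lemma IsAdmissible.re_trivial_le :
    -(logDeriv (DirichletCharacter.LFunction (1 : DirichletCharacter ℂ l)) (1 + 80 * σ)).re ≤
      1 / (80 * σ) + Q := by
  have hσ := H.σ_pos
  have hs := H.σ_small
  have hη : 0 < η := by linarith
  have h := H.trivial_le (80 * σ) (η / 2) (by linarith) (by linarith) (by linarith) 0
  simp only [iteratedDeriv_zero, pow_zero, Nat.factorial, Nat.cast_one, mul_one, one_mul, zero_add,
    pow_one] at h
  have h2 := (abs_le.1 ((abs_re_le_norm _).trans h)).1
  push_cast at h2
  have e : ((80 * (σ : ℂ))⁻¹).re = 1 / (80 * σ) := by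
    have : (80 * (σ : ℂ))⁻¹ = ((1 / (80 * σ) : ℝ) : ℂ) := by push_cast; rw [one_div]
    rw [this, ofReal_re]
  rw [add_re, e] at h2
  have h3 : 8 / (η / 2 / 2) = 32 / η := by field_simp; norm_num
  have := H.le_Q
  linarith

lemma IsAdmissible.growth (hχ : χ ≠ 1) : ∀ z ∈ closedBall (1 + 80 * σ : ℂ) (1 / 2),
    ‖DirichletCharacter.LFunction χ z‖ ≤
      Real.exp (3 * Q) * ‖DirichletCharacter.LFunction χ (1 + 80 * σ : ℂ)‖ := by
  have hσ := H.σ_pos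
  have hs := H.σ_small
  have hη := H.η_le
  have := norm_LFunction_le_exp_mul hχ (t := 80 * σ) H.zeta_le (by linarith) (by linarith)
    (by linarith) H.level_le (le_trans (by gcongr; linarith) H.inv_le)
  push_cast at this
  exact this

lemma IsAdmissible.growth' (hχ : χ ≠ 1) : ∀ z ∈ closedBall (1 + σ : ℂ) (1 / 2),
    ‖DirichletCharacter.LFunction χ z‖ ≤
      Real.exp (3 * Q) * ‖DirichletCharacter.LFunction χ (1 + σ : ℂ)‖ := by
  have hσ := H.σ_pos
  have hs := H.σ_small
  have hη := H.η_le
  exact norm_LFunction_le_exp_mul hχ (t := σ) H.zeta_le (by linarith) (by linarith)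
    (by linarith) H.level_le H.inv_le

omit H in
lemma re_lt_one_of_zero (hχ : χ ≠ 1) {ρ : ℂ} (h : DirichletCharacter.LFunction χ ρ = 0) :
    ρ.re < 1 := by
  by_contra! hc
  exact DirichletCharacter.LFunction_ne_zero_of_one_le_re χ (Or.inl hχ) hc h

lemma IsAdmissible.zero_estimates (hχ : χ ≠ 1) {ρ : ℂ}
    (h : DirichletCharacter.LFunction χ ρ = 0) (hρ : ρ ∈ ball (1 + σ : ℂ) (8 * σ)) :
    1 / (88 * σ) ≤ ((1 + 80 * σ - ρ)⁻¹).re ∧ ρ ∈ closedBall (1 + 80 * σ : ℂ) (1 / 2 / 3) := by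
  have hσ := H.σ_pos
  have hs := H.σ_small
  have hη := H.η_le
  have h1 : ‖ρ - (1 + σ)‖ < 8 * σ := by rwa [mem_ball, dist_eq_norm] at hρ
  have hre : ρ.re < 1 := re_lt_one_of_zero hχ h
  have h2 := (abs_lt.1 ((abs_re_le_norm _).trans_lt h1)).1
  have h3 := abs_lt.1 ((abs_im_le_norm _).trans_lt h1)
  simp at h2 h3
  constructor
  · rw [inv_re, normSq_apply]
    simp only [sub_re, add_re, one_re, mul_re, re_ofNat, ofReal_re, im_ofNat, ofReal_im, mul_zero,
      sub_im, add_im, one_im, mul_im, zero_mul, add_zero, zero_sub, sub_zero]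
    set x := 1 + 80 * σ - ρ.re with hx
    have x1 : 80 * σ < x := by linarith
    have x2 : x < 87 * σ := by linarith
    have hy : ρ.im ^ 2 ≤ 64 * σ ^ 2 := by nlinarith
    rw [div_le_div_iff₀ (by positivity) (by nlinarith [sq_nonneg ρ.im])]
    nlinarith [mul_pos (sub_pos.2 x1) (sub_pos.2 x2)]
  · rw [mem_closedBall, dist_eq_norm]
    calc ‖ρ - (1 + 80 * σ)‖ = ‖(ρ - (1 + σ)) - 79 * σ‖ := by ring_nf
      _ ≤ 8 * σ + 79 * σ := by
        refine (norm_sub_le _ _).trans (add_le_add h1.le ?_)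
        rw [norm_mul, norm_real, Real.norm_eq_abs, abs_of_pos hσ]; simp
      _ ≤ 1 / 2 / 3 := by linarith

lemma IsAdmissible.re_le_of_prod (hχ : χ ≠ 1) {g : ℂ → ℂ} (hg : Differentiable ℂ g)
    (Z : Multiset ℂ) (hZ : ∀ ρ ∈ Z, DirichletCharacter.LFunction χ ρ = 0 ∧
      ρ ∈ ball (1 + σ : ℂ) (8 * σ))
    (hf : ∀ s, DirichletCharacter.LFunction χ s = (Z.map (fun ρ ↦ s - ρ)).prod * g s) :
    -(logDeriv (DirichletCharacter.LFunction χ) (1 + 80 * σ)).re ≤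
      -(Z.card * (1 / (88 * σ))) + 72 * Q := by
  have hσ := H.σ_pos
  have h := re_neg_logDeriv_le (f := DirichletCharacter.LFunction χ) (z₀ := 1 + 80 * σ)
    (r := 1 / 2) (A := 3 * Q) (by norm_num) (by linarith [H.Q_pos])
    (DirichletCharacter.LFunction_ne_zero_of_one_le_re χ (Or.inl hχ) (by simp; linarith))
    (H.growth hχ) hg Z (fun ρ hρ ↦ (H.zero_estimates hχ (hZ ρ hρ).1 (hZ ρ hρ).2).2) hf
    (fun ρ hρ ↦ by have := re_lt_one_of_zero hχ hρ; simp; linarith)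
  have h2 : Z.card • (1 / (88 * σ)) ≤ (Z.map (fun ρ : ℂ ↦ ((1 + 80 * σ - ρ)⁻¹).re)).sum := by
    rw [← Multiset.card_map (fun ρ : ℂ ↦ ((1 + 80 * σ - ρ)⁻¹).re) Z]
    apply Multiset.card_nsmul_le_sum
    intro x hx
    obtain ⟨ρ, hρ, rfl⟩ := Multiset.mem_map.1 hx
    exact (H.zero_estimates hχ (hZ ρ hρ).1 (hZ ρ hρ).2).1
  rw [nsmul_eq_mul] at h2
  have e : 12 * (3 * Q) / (1 / 2) = 72 * Q := by ring
  rw [e] at h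
  linarith

lemma IsAdmissible.inv_σ : 1 / σ = 80000 * Q := by
  have := H.σ_pos
  rw [div_eq_iff this.ne']; exact H.mul_eq.symm

lemma IsAdmissible.ne_zero_of_sq_ne_one (hχ2 : χ ^ 2 ≠ 1) {ρ : ℂ}
    (hρ : ρ ∈ ball (1 + σ : ℂ) (8 * σ)) : DirichletCharacter.LFunction χ ρ ≠ 0 := by
  intro h0
  have hχ : χ ≠ 1 := by rintro rfl; simp at hχ2
  have hσ := H.σ_pos
  have hQ := H.Q_pos
  obtain ⟨g, hg, hgf⟩ := exists_eq_sub_mul (DirichletCharacter.differentiable_LFunction hχ) h0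
  have h1 := H.re_le_of_prod hχ hg {ρ} (by simpa using ⟨h0, by simpa using hρ⟩) (by simpa using hgf)
  have h2 := H.re_le_of_prod hχ2 (DirichletCharacter.differentiable_LFunction hχ2) 0 (by simp)
    (by simp)
  have h3 := H.re_trivial_le
  have h4 := re_neg_logDeriv_three_four_one χ (x := 1 + 80 * σ) (by linarith)
  push_cast at h4
  have e : ∀ c : ℝ, 1 / (c * σ) = 80000 * Q / c := by
    intro c; rw [← H.inv_σ]; field_simp
  rw [e] at h1 h3
  simp only [Multiset.card_singleton, Multiset.card_zero, Nat.cast_one, Nat.cast_zero, one_mul,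
    zero_mul] at h1 h2
  linarith

lemma IsAdmissible.ne_zero_of_factor (hχ : χ ≠ 1) {ρ : ℂ} {g : ℂ → ℂ}
    (h0 : DirichletCharacter.LFunction χ ρ = 0)
    (hρ : ρ ∈ ball (1 + σ : ℂ) (8 * σ)) (hg : Differentiable ℂ g)
    (hgf : ∀ s, DirichletCharacter.LFunction χ s = (s - ρ) * g s) {ρ' : ℂ}
    (hρ' : ρ' ∈ ball (1 + σ : ℂ) (8 * σ)) : g ρ' ≠ 0 := by
  intro h0'
  have hσ := H.σ_pos
  have hQ := H.Q_pos
  obtain ⟨g', hg', hgf'⟩ := exists_eq_sub_mul hg h0'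
  have h1 := H.re_le_of_prod hχ hg' {ρ, ρ'} (by
      have : DirichletCharacter.LFunction χ ρ' = 0 := by rw [hgf, h0', mul_zero]
      intro x hx
      simp only [Multiset.insert_eq_cons, Multiset.mem_cons, Multiset.mem_singleton] at hx
      rcases hx with rfl | rfl
      · exact ⟨h0, hρ⟩
      · exact ⟨this, hρ'⟩) (by
      intro s; simp [hgf s, hgf' s, mul_assoc])
  have h3 := H.re_trivial_le
  have h4 := re_neg_logDeriv_add_nonneg χ (x := 1 + 80 * σ) (by linarith)
  push_cast at h4
  have e : ∀ c : ℝ, 1 / (c * σ) = 80000 * Q / c := by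
    intro c; rw [← H.inv_σ]; field_simp
  rw [e] at h1 h3
  simp only [Multiset.insert_eq_cons, Multiset.card_cons, Multiset.card_singleton] at h1
  push_cast at h1
  linarith

lemma IsAdmissible.iteratedDeriv_le_of_zero_free (hχ : χ ≠ 1)
    (h0 : ∀ ρ ∈ ball (1 + σ : ℂ) (8 * σ), DirichletCharacter.LFunction χ ρ ≠ 0) (k : ℕ) :
    ‖iteratedDeriv k (logDeriv (DirichletCharacter.LFunction χ)) (1 + σ)‖ ≤
      (k + 1).factorial * (6 * Q) / (4 * σ) ^ (k + 1) := by
  have hσ := H.σ_pos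
  have hs := H.σ_small
  have hη := H.η_le
  have h := norm_iteratedDeriv_logDeriv_le (f := DirichletCharacter.LFunction χ) (c := 1 + σ)
    (R := 8 * σ) (A := 3 * Q) (by linarith) (by linarith [H.Q_pos])
    (DirichletCharacter.differentiable_LFunction hχ).differentiableOn h0
    (fun z hz ↦ H.growth' hχ z (ball_subset_closedBall
      (ball_subset_ball (by linarith) hz))) k
  convert h using 2 <;> ring

lemma IsAdmissible.iteratedDeriv_le_of_zero (hχ : χ ≠ 1) {ρ : ℂ}
    (h0 : DirichletCharacter.LFunction χ ρ = 0)
    (hρ : ρ ∈ ball (1 + σ : ℂ) (8 * σ)) (k : ℕ) :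
    ‖iteratedDeriv k (logDeriv (DirichletCharacter.LFunction χ)) (1 + σ) -
      (-1) ^ k * k.factorial * ((1 + σ - ρ) ^ (k + 1))⁻¹‖ ≤
      (k + 1).factorial * (6 * Q) / (4 * σ) ^ (k + 1) := by
  have hσ := H.σ_pos
  have hs := H.σ_small
  have hη := H.η_le
  obtain ⟨g, hg, hgf⟩ := exists_eq_sub_mul (DirichletCharacter.differentiable_LFunction hχ) h0
  have hgr := norm_le_of_prod_sub_mul (r := 1 / 2) (A := 3 * Q) (z₀ := 1 + σ) (by norm_num)
    (H.growth' hχ) hg {ρ} (by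
      intro x hx
      rw [Multiset.mem_singleton.1 hx]
      exact ball_subset_closedBall (ball_subset_ball (by linarith) hρ)) (by simpa using hgf)
  simp only [Multiset.card_singleton, pow_one] at hgr
  have h := norm_iteratedDeriv_logDeriv_le (f := g) (c := 1 + σ)
    (R := 8 * σ) (A := 3 * Q) (by linarith) (by linarith [H.Q_pos])
    hg.differentiableOn (fun z hz ↦ H.ne_zero_of_factor hχ h0 hρ hg hgf hz)
    (fun z hz ↦ by
      have := hgr z (ball_subset_closedBall (ball_subset_ball (by linarith) hz))
      linarith [norm_nonneg (g z)]) k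
  have hne : (1 + σ : ℂ) ≠ ρ := by
    rintro rfl
    have := re_lt_one_of_zero hχ h0
    simp at this; linarith
  have h2 := iteratedDeriv_logDeriv_zpow_mul (f := DirichletCharacter.LFunction χ) 1 hg hne
    (H.ne_zero_of_factor hχ h0 hρ hg hgf (mem_ball_self (by linarith)))
    (Eventually.of_forall (by simpa using hgf)) k
  rw [h2]
  convert h using 2
  · simp
  · ring
  · ring

end

end

section

open Complex Metric Set Filter Topology

lemma norm_sum_range_mul_le_of_antitone {g : ℕ → ℝ} {f : ℕ → ℂ} {B : ℝ} (hg : Antitone g)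
    (h0 : ∀ n, 0 ≤ g n) (hB : ∀ n, ‖∑ i ∈ Finset.range n, f i‖ ≤ B) (n : ℕ) :
    ‖∑ i ∈ Finset.range n, (g i : ℂ) * f i‖ ≤ g 0 * B := by
  have e : ∑ i ∈ Finset.range n, (g i : ℂ) * f i = g n * ∑ i ∈ Finset.range n, f i +
      ∑ i ∈ Finset.range n, ((g i - g (i + 1) : ℝ) : ℂ) * ∑ j ∈ Finset.range (i + 1), f j := by
    induction n with
    | zero => simp
    | succ n ih =>
      rw [Finset.sum_range_succ, ih, Finset.sum_range_succ (fun i ↦ _ * _), Finset.sum_range_succ f]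
      push_cast; ring
  have hB0 : 0 ≤ B := (norm_nonneg _).trans (hB 0)
  rw [e]
  calc _ ≤ g n * B + ∑ i ∈ Finset.range n, (g i - g (i + 1)) * B := by
        refine (norm_add_le _ _).trans (add_le_add ?_ ((norm_sum_le _ _).trans
          (Finset.sum_le_sum fun i _ ↦ ?_)))
        · rw [norm_mul, norm_real, Real.norm_eq_abs, abs_of_nonneg (h0 n)]
          exact mul_le_mul_of_nonneg_left (hB n) (h0 n)
        · have : 0 ≤ g i - g (i + 1) := sub_nonneg.2 (hg i.le_succ)
          rw [norm_mul, norm_real, Real.norm_eq_abs, abs_of_nonneg this]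
          exact mul_le_mul_of_nonneg_left (hB _) this
    _ = g 0 * B := by rw [← Finset.sum_mul, Finset.sum_range_sub']; ring

section

variable {l : ℕ} [NeZero l] {χ : DirichletCharacter ℂ l}

lemma norm_sum_range_char_add_le (hχ : χ ≠ 1) (a n : ℕ) :
    ‖∑ k ∈ Finset.range n, χ ((a + k : ℕ) : ZMod l)‖ ≤ 2 * l := by
  have h := Finset.sum_range_add (fun k : ℕ ↦ χ (k : ZMod l)) a n
  rw [← sub_eq_iff_eq_add'] at h
  rw [← h]
  refine (norm_sub_le _ _).trans ?_
  linarith [norm_sum_range_char_le hχ (a + n), norm_sum_range_char_le hχ a]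

lemma norm_LFunction_one_sub_sum_le (hχ : χ ≠ 1) (N : ℕ) (hN : 0 < N) :
    ‖DirichletCharacter.LFunction χ 1 -
      ∑ i ∈ Finset.range N, ((i + 1 : ℂ))⁻¹ * χ ((i + 1 : ℕ) : ZMod l)‖ ≤ 2 * l / N := by
  have key : ∀ s : ℝ, 1 < s → ‖DirichletCharacter.LFunction χ s -
      ∑ i ∈ Finset.range N, (((i + 1 : ℝ) ^ (-s) : ℝ) : ℂ) * χ ((i + 1 : ℕ) : ZMod l)‖ ≤
        2 * l / N := by
    intro s hs
    have hs' : 1 < (s : ℂ).re := by simpa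
    have h1 := (DirichletCharacter.LSeriesSummable_of_one_lt_re χ hs').hasSum
    have h2 : HasSum (fun i : ℕ ↦ (((i + 1 : ℝ) ^ (-s) : ℝ) : ℂ) * χ ((i + 1 : ℕ) : ZMod l))
        (DirichletCharacter.LFunction χ s) := by
      rw [DirichletCharacter.LFunction_eq_LSeries χ hs']
      have h3 := (hasSum_nat_add_iff' 1).2 h1
      simp only [Finset.range_one, Finset.sum_singleton, LSeries.term_zero, sub_zero] at h3
      have h7 : (fun i : ℕ ↦ (((i + 1 : ℝ) ^ (-s) : ℝ) : ℂ) * χ ((i + 1 : ℕ) : ZMod l)) =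
          fun i ↦ LSeries.term (fun n : ℕ ↦ χ n) s (i + 1) := by
        funext i
        rw [LSeries.term_of_ne_zero i.succ_ne_zero, Real.rpow_neg (by positivity)]
        push_cast
        rw [ofReal_cpow (by positivity)]
        push_cast
        rw [div_eq_mul_inv, mul_comm]
      rw [h7]
      exact h3
    have h4 : Tendsto (fun M ↦ ∑ i ∈ Finset.range (N + M),
        (((i + 1 : ℝ) ^ (-s) : ℝ) : ℂ) * χ ((i + 1 : ℕ) : ZMod l)) atTop
        (𝓝 (DirichletCharacter.LFunction χ s)) :=
      (h2.tendsto_sum_nat).comp (tendsto_atTop_mono (fun M ↦ by simp : ∀ M : ℕ, M ≤ N + M) tendsto_id)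
    refine le_of_tendsto ((h4.sub_const _).norm) (Eventually.of_forall fun M ↦ ?_)
    rw [Finset.sum_range_add, add_sub_cancel_left]
    have h5 := norm_sum_range_mul_le_of_antitone (g := fun i : ℕ ↦ (((N + i : ℕ) : ℝ) + 1) ^ (-s))
      (f := fun i ↦ χ ((N + i + 1 : ℕ) : ZMod l)) (B := 2 * l) (fun i j hij ↦ by
        apply Real.rpow_le_rpow_of_nonpos (by positivity) (by push_cast; gcongr) (by linarith))
      (fun i ↦ by positivity)
      (fun n ↦ by
        have := norm_sum_range_char_add_le hχ (N + 1) n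
        simpa [add_right_comm] using this) M
    refine h5.trans ?_
    have h6 : (((N + 0 : ℕ) : ℝ) + 1) ^ (-s) ≤ (N : ℝ)⁻¹ := by
      have hN1 : (1 : ℝ) ≤ N := by exact_mod_cast hN
      rw [← Real.rpow_neg_one]
      calc (((N + 0 : ℕ) : ℝ) + 1) ^ (-s) ≤ (N : ℝ) ^ (-s) :=
            Real.rpow_le_rpow_of_nonpos (by positivity) (by push_cast; linarith) (by linarith)
        _ ≤ (N : ℝ) ^ (-1 : ℝ) := Real.rpow_le_rpow_of_exponent_le hN1 (by linarith)
    calc _ ≤ (N : ℝ)⁻¹ * (2 * l) := by gcongr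
      _ = 2 * l / N := by ring
  have hc : Tendsto (fun s : ℝ ↦ ‖DirichletCharacter.LFunction χ s -
      ∑ i ∈ Finset.range N, (((i + 1 : ℝ) ^ (-s) : ℝ) : ℂ) * χ ((i + 1 : ℕ) : ZMod l)‖) (𝓝[>] 1)
      (𝓝 ‖DirichletCharacter.LFunction χ (1 : ℝ) -
      ∑ i ∈ Finset.range N, (((i + 1 : ℝ) ^ (-(1 : ℝ)) : ℝ) : ℂ) * χ ((i + 1 : ℕ) : ZMod l)‖) := by
    apply Tendsto.mono_left _ nhdsWithin_le_nhds
    apply Continuous.tendsto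
    refine (((DirichletCharacter.differentiable_LFunction hχ).continuous.comp
      continuous_ofReal).sub (continuous_finsetSum _ fun i _ ↦ ?_)).norm
    refine (continuous_ofReal.comp ?_).mul continuous_const
    exact Real.continuous_const_rpow (by positivity) |>.comp continuous_neg
  have h := le_of_tendsto hc (eventually_nhdsWithin_of_forall fun s hs ↦ key s hs)
  simpa [Real.rpow_neg_one] using h

omit [NeZero l] in
lemma zetaMul_apply (n : ℕ) : χ.zetaMul n = ∑ d ∈ n.divisors, χ (d : ZMod l) := by
  refine (ArithmeticFunction.coe_zeta_mul_apply (f := toArithmeticFunction (χ ·)) (x := n)).trans ?_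
  refine Finset.sum_congr rfl fun d hd ↦ ?_
  exact if_neg (Nat.pos_of_mem_divisors hd).ne'

omit [NeZero l] in
lemma one_le_re_zetaMul_sq (hχ : χ ^ 2 = 1) {m : ℕ} (hm : m ≠ 0) :
    1 ≤ (χ.zetaMul (m ^ 2)).re := by
  have key : ∀ (p : ℕ), p.Prime → ∀ e : ℕ, ∃ x : ℝ, 1 ≤ x ∧ χ.zetaMul (p ^ (2 * e)) = x := by
    intro p hp e
    have h1 : χ.zetaMul (p ^ (2 * e)) = ∑ i ∈ Finset.range (2 * e + 1), χ p ^ i := by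
      rw [zetaMul_apply, Nat.sum_divisors_prime_pow hp]
      simp
    rw [h1]
    rcases MulChar.isQuadratic_iff_sq_eq_one.mpr hχ p with h | h | h
    · refine ⟨1, le_rfl, ?_⟩
      rw [h, Finset.sum_range_succ']
      simp
    · refine ⟨2 * e + 1, by norm_cast; omega, ?_⟩
      rw [h]; simp
    · refine ⟨1, le_rfl, ?_⟩
      rw [h, neg_one_geom_sum]
      simp
  choose! x hx1 hx using key
  rw [χ.isMultiplicative_zetaMul.multiplicative_factorization _ (pow_ne_zero 2 hm),
    Nat.factorization_pow]
  have : ((2 • m.factorization).prod fun p k ↦ χ.zetaMul (p ^ k)) =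
      ((∏ p ∈ m.primeFactors, x p (m.factorization p) : ℝ) : ℂ) := by
    rw [← Nat.factorization_pow, Finsupp.prod, Nat.support_factorization,
      Nat.primeFactors_pow _ two_ne_zero, ofReal_prod]
    refine Finset.prod_congr rfl fun p hp ↦ ?_
    rw [← hx p (Nat.prime_of_mem_primeFactors hp), Nat.factorization_pow]
    rfl
  rw [this, ofReal_re]
  rw [← Finset.prod_const_one (s := m.primeFactors)]
  exact Finset.prod_le_prod (fun _ _ ↦ zero_le_one)
    fun p hp ↦ hx1 p (Nat.prime_of_mem_primeFactors hp) _

end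

end

section

open Complex Metric Set Filter Topology

lemma mul_pow_le_geom_sum (y : ℝ) (n : ℕ) :
    n * y ^ (n - 1) ≤ ∑ i ∈ Finset.range n, (y ^ 2) ^ i := by
  have h1 := Finset.sum_range_reflect (fun i ↦ (y ^ 2) ^ i) n
  have h2 : ∑ i ∈ Finset.range n, (2 * y ^ (n - 1)) ≤
      ∑ i ∈ Finset.range n, ((y ^ 2) ^ i + (y ^ 2) ^ (n - 1 - i)) := by
    refine Finset.sum_le_sum fun i hi ↦ ?_
    have hi := Finset.mem_range.1 hi
    have : y ^ (n - 1) = y ^ i * y ^ (n - 1 - i) := by rw [← pow_add]; congr 1; omega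
    rw [this, ← pow_mul, ← pow_mul, mul_comm 2 i, mul_comm 2 (n - 1 - i), pow_mul, pow_mul]
    nlinarith [sq_nonneg (y ^ i - y ^ (n - 1 - i))]
  rw [Finset.sum_add_distrib, h1, Finset.sum_const, Finset.card_range, nsmul_eq_mul] at h2
  linarith

lemma antitone_inv_sub_lambert {y : ℝ} (hy0 : 0 < y) (hy1 : y < 1) :
    Antitone fun n : ℕ ↦ (n + 1 : ℝ)⁻¹ / (1 - y ^ 2) -
      (y ^ 2) ^ (n + 1) / (1 - (y ^ 2) ^ (n + 1)) := by
  apply antitone_nat_of_succ_le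
  intro n
  set x := y ^ 2 with hx
  have hx0 : 0 < x := by positivity
  have hx1 : x < 1 := by rw [hx]; exact pow_lt_one₀ hy0.le hy1 two_ne_zero
  have h1 : 0 < 1 - x := by linarith
  have g : ∀ m : ℕ, 1 - x ^ m = (1 - x) * ∑ i ∈ Finset.range m, x ^ i := by
    intro m; rw [mul_comm, geom_sum_mul_neg]
  have a1 := mul_pow_le_geom_sum y (n + 1)
  have a2 := mul_pow_le_geom_sum y (n + 2)
  have p1 : 0 < y ^ n := by positivity
  simp only [Nat.add_sub_cancel, show n + 2 - 1 = n + 1 by omega, ← hx] at a1 a2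
  have hg1 : 0 < ∑ i ∈ Finset.range (n + 1), x ^ i := lt_of_lt_of_le (by positivity) a1
  have hg2 : 0 < ∑ i ∈ Finset.range (n + 2), x ^ i := lt_of_lt_of_le (by positivity) a2
  rw [show n + 1 + 1 = n + 2 by ring, g (n + 1), g (n + 2)]
  set S := ∑ i ∈ Finset.range (n + 1), x ^ i with hS
  have hS2 : ∑ i ∈ Finset.range (n + 2), x ^ i = S + x ^ (n + 1) := Finset.sum_range_succ _ _
  have hS3 : ∑ i ∈ Finset.range (n + 2), x ^ i = x * S + 1 := geom_sum_succ
  set T := ∑ i ∈ Finset.range (n + 2), x ^ i with hT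
  have hprod : (n + 1) * (n + 2) * x ^ (n + 1) ≤ S * T := by
    calc ((n : ℝ) + 1) * (n + 2) * x ^ (n + 1) ≤ (n + 1) * (n + 2) * (y ^ n * y ^ (n + 1)) := by
          gcongr
          rw [hx, ← pow_mul, ← pow_add]
          exact pow_le_pow_of_le_one hy0.le hy1.le (by omega)
      _ = ((n + 1 : ℕ) * y ^ n) * ((n + 2 : ℕ) * y ^ (n + 1)) := by push_cast; ring
      _ ≤ S * T := by gcongr
  have e : x ^ (n + 1) / ((1 - x) * S) - x ^ (n + 2) / ((1 - x) * T) =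
      (x ^ (n + 1) / (S * T)) / (1 - x) := by
    have : x ^ (n + 2) = x * x ^ (n + 1) := by ring
    rw [this]
    field_simp
    rw [hS3]; ring
  have e2 : ((n : ℝ) + 1)⁻¹ / (1 - x) - (((n + 1 : ℕ) : ℝ) + 1)⁻¹ / (1 - x) =
      (1 / ((n + 1) * (n + 2))) / (1 - x) := by
    push_cast
    field_simp
    ring
  have e3 : (x ^ (n + 1) / (S * T)) / (1 - x) ≤ (1 / ((n + 1) * (n + 2))) / (1 - x) := by
    refine div_le_div_of_nonneg_right ?_ h1.le
    rw [div_le_div_iff₀ (by positivity) (by positivity)]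
    linarith
  linarith

section

variable {l : ℕ} [NeZero l] {χ : DirichletCharacter ℂ l}

omit [NeZero l] in
lemma exists_lambert_limit (hχ : χ ^ 2 = 1) {x : ℝ} (hx0 : 0 < x) (hx1 : x < 1) (M : ℕ) :
    ∃ F : ℂ, Tendsto (fun N ↦ ∑ i ∈ Finset.range N,
        ((x ^ (i + 1) / (1 - x ^ (i + 1)) : ℝ) : ℂ) * χ ((i + 1 : ℕ) : ZMod l)) atTop (𝓝 F) ∧
      ∑ m ∈ Finset.range M, x ^ ((m + 1) ^ 2) ≤ F.re := by
  have hx : ‖(x : ℂ)‖ < 1 := by rw [norm_real, Real.norm_eq_abs, abs_of_pos hx0]; exact hx1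
  have hsum0 : Summable fun c : ℕ+ × ℕ+ ↦ χ ((c.1 : ℕ) : ZMod l) * (x : ℂ) ^ (c.1 * c.2 : ℕ) := by
    refine Summable.of_norm_bounded (summable_prod_mul_pow 0 hx).norm fun c ↦ ?_
    rw [norm_mul, pow_zero, one_mul]
    exact mul_le_of_le_one_left (norm_nonneg _) (χ.norm_le_one _)
  have hsig := sigmaAntidiagonalEquivProd.summable_iff.2 hsum0
  set F := ∑' c : ℕ+ × ℕ+, χ ((c.1 : ℕ) : ZMod l) * (x : ℂ) ^ (c.1 * c.2 : ℕ) with hF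
  have hr : HasSum (fun n : ℕ+ ↦ χ.zetaMul n * (x : ℂ) ^ (n : ℕ)) F := by
    rw [hF, ← sigmaAntidiagonalEquivProd.tsum_eq]
    have := hsig.hasSum.sigma (fun n ↦ hasSum_fintype _)
    convert this using 1
    swap
    · rfl
    funext n
    rw [zetaMul_apply, ← Nat.sum_divisorsAntidiagonal (f := fun d _ ↦ χ (d : ZMod l)), Finset.sum_mul,
      ← Finset.sum_coe_sort]
    refine Finset.sum_congr rfl fun c _ ↦ ?_
    have := (Nat.mem_divisorsAntidiagonal.1 c.2).1
    simp [sigmaAntidiagonalEquivProd, divisorsAntidiagonalFactors, this]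
  have hq : HasSum (fun n : ℕ+ ↦ ((x ^ (n : ℕ) / (1 - x ^ (n : ℕ)) : ℝ) : ℂ) * χ ((n : ℕ) : ZMod l))
      F := by
    refine hsum0.hasSum.prod_fiberwise fun n ↦ ?_
    have hn1 : x ^ (n : ℕ) < 1 := pow_lt_one₀ hx0.le hx1 n.ne_zero
    have h1 := (hasSum_geometric_of_lt_one (pow_nonneg hx0.le (n : ℕ)) hn1).mul_left (x ^ (n : ℕ))
    have h2 := (hasSum_ofReal.2 h1).mul_left (χ ((n : ℕ) : ZMod l))
    rw [← Equiv.pnatEquivNat.symm.hasSum_iff, div_eq_mul_inv, mul_comm]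
    have h7 : (fun b : ℕ+ ↦ χ ((n : ℕ) : ZMod l) * (x : ℂ) ^ (n * b : ℕ)) ∘ Equiv.pnatEquivNat.symm =
        fun i : ℕ ↦ χ ((n : ℕ) : ZMod l) * ((x ^ (n : ℕ) * (x ^ (n : ℕ)) ^ i : ℝ) : ℂ) := by
      funext i
      simp only [Function.comp, Equiv.pnatEquivNat_symm_apply, Nat.succPNat_coe, Nat.succ_eq_add_one]
      push_cast
      rw [mul_add, pow_add, pow_mul]; ring
    rw [h7]
    exact h2
  refine ⟨F, ?_, ?_⟩
  · have := (Equiv.pnatEquivNat.symm.hasSum_iff).2 hq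
    exact this.tendsto_sum_nat
  · have h1 := (Equiv.pnatEquivNat.symm.hasSum_iff).2 hr
    have h2 := hasSum_re h1
    have h3 : ∀ n : ℕ, ((χ.zetaMul n * (x : ℂ) ^ n).re) = (χ.zetaMul n).re * x ^ n := by
      intro n; rw [← ofReal_pow, re_mul_ofReal]
    let j : ℕ → ℕ := fun m ↦ (m + 1) ^ 2 - 1
    have hj : ∀ m, j m + 1 = (m + 1) ^ 2 := fun m ↦ Nat.sub_add_cancel (Nat.one_le_pow _ _ m.succ_pos)
    have hinj : Function.Injective j := by
      intro a b hab
      have : (a + 1) ^ 2 = (b + 1) ^ 2 := by rw [← hj, ← hj, hab]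
      simpa using Nat.pow_left_injective two_ne_zero this
    have h4 := sum_le_hasSum ((Finset.range M).image j) (fun n _ ↦ by
      simp only [Function.comp, Equiv.pnatEquivNat_symm_apply, Nat.succPNat_coe, h3]
      have := (Complex.le_def.1 (DirichletCharacter.zetaMul_nonneg hχ n.succ)).1
      exact mul_nonneg this (by positivity)) h2
    refine le_trans ?_ h4
    rw [Finset.sum_image hinj.injOn]
    refine Finset.sum_le_sum fun m _ ↦ ?_
    simp only [Function.comp, Equiv.pnatEquivNat_symm_apply, Nat.succPNat_coe, h3,
      Nat.succ_eq_add_one, hj]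
    exact le_mul_of_one_le_left (by positivity) (one_le_re_zetaMul_sq hχ m.succ_ne_zero)

lemma le_norm_LFunction_one (hχ : χ ≠ 1) (hχ2 : χ ^ 2 = 1) :
    1 / (128 * l) ≤ ‖DirichletCharacter.LFunction χ 1‖ := by
  have hl : (1 : ℝ) ≤ l := by exact_mod_cast NeZero.pos l
  set y : ℝ := 1 - 1 / (256 * l ^ 2) with hy
  have hy0 : 0 < y := by
    have : (1 : ℝ) / (256 * l ^ 2) ≤ 1 / 256 := by
      apply one_div_le_one_div_of_le (by norm_num); nlinarith
    linarith
  have hy1 : y < 1 := by have : (0 : ℝ) < 1 / (256 * l ^ 2) := by positivity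
                         linarith
  have hx0 : 0 < y ^ 2 := by positivity
  have hx1 : y ^ 2 < 1 := pow_lt_one₀ hy0.le hy1 two_ne_zero
  obtain ⟨F, hF, hFre⟩ := exists_lambert_limit hχ2 hx0 hx1 (8 * l)
  set b : ℕ → ℝ := fun n : ℕ ↦ (n + 1 : ℝ)⁻¹ / (1 - y ^ 2) -
      (y ^ 2) ^ (n + 1) / (1 - (y ^ 2) ^ (n + 1)) with hb
  have hba : Antitone b := antitone_inv_sub_lambert hy0 hy1
  have hT : Tendsto (fun N : ℕ ↦ ∑ i ∈ Finset.range N, ((i + 1 : ℂ))⁻¹ * χ ((i + 1 : ℕ) : ZMod l))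
      atTop (𝓝 (DirichletCharacter.LFunction χ 1)) := by
    rw [tendsto_iff_norm_sub_tendsto_zero]
    refine squeeze_zero' (Eventually.of_forall fun _ ↦ norm_nonneg _) ?_
      (tendsto_const_div_atTop_nhds_zero_nat (2 * l : ℝ))
    filter_upwards [eventually_gt_atTop 0] with N hN
    rw [norm_sub_rev]
    exact norm_LFunction_one_sub_sum_le hχ N hN
  have hb0 : Tendsto b atTop (𝓝 0) := by
    have h1 : Tendsto (fun n : ℕ ↦ (y ^ 2) ^ (n + 1)) atTop (𝓝 0) :=
      (tendsto_pow_atTop_nhds_zero_of_lt_one hx0.le hx1).comp (tendsto_add_atTop_nat 1)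
    have h2 : Tendsto (fun n : ℕ ↦ ((n : ℝ) + 1)⁻¹) atTop (𝓝 0) := by
      simpa using tendsto_one_div_add_atTop_nhds_zero_nat (𝕜 := ℝ)
    have h3 := (h2.div_const (1 - y ^ 2)).sub (h1.div ((tendsto_const_nhds (x := (1 : ℝ))).sub h1)
      (by norm_num))
    simpa using h3
  have hbnn : ∀ n, 0 ≤ b n := hba.le_of_tendsto hb0
  have h1 : ∀ N, ‖∑ i ∈ Finset.range N, (b i : ℂ) * χ ((i + 1 : ℕ) : ZMod l)‖ ≤ 2 * l := by
    intro N
    have := norm_sum_range_mul_le_of_antitone (f := fun i ↦ χ ((i + 1 : ℕ) : ZMod l)) hba hbnn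
      (B := 2 * l) (fun n ↦ by
        have := norm_sum_range_char_add_le hχ 1 n
        simpa [add_comm] using this) N
    have e : b 0 = 1 := by
      simp only [hb]
      have : 1 - y ^ 2 ≠ 0 := by linarith
      simp only [CharP.cast_eq_zero, zero_add, inv_one, pow_one, ← sub_div, div_self this]
    rwa [e, one_mul] at this
  have h2 : Tendsto (fun N ↦ ∑ i ∈ Finset.range N, (b i : ℂ) * χ ((i + 1 : ℕ) : ZMod l)) atTop
      (𝓝 (DirichletCharacter.LFunction χ 1 * ((1 - y ^ 2 : ℝ) : ℂ)⁻¹ - F)) := by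
    refine ((hT.mul_const _).sub hF).congr fun N ↦ ?_
    rw [Finset.sum_mul, ← Finset.sum_sub_distrib]
    refine Finset.sum_congr rfl fun i _ ↦ ?_
    simp only [hb]
    push_cast
    ring
  have h3 := le_of_tendsto h2.norm (Eventually.of_forall h1)
  have h4 : (4 * l : ℝ) ≤ F.re := by
    refine le_trans ?_ hFre
    have : ∀ m ∈ Finset.range (8 * l), (1 / 2 : ℝ) ≤ (y ^ 2) ^ ((m + 1) ^ 2) := by
      intro m hm
      have hm' : ((m : ℝ) + 1) ≤ 8 * l := by
        have := Finset.mem_range.1 hm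
        exact_mod_cast this
      rw [← pow_mul]
      have hB := one_add_mul_le_pow (a := -(1 / (256 * l ^ 2) : ℝ)) (by
        have : (1 : ℝ) / (256 * l ^ 2) ≤ 1 / 256 := by
          apply one_div_le_one_div_of_le (by norm_num); nlinarith
        linarith) (2 * (m + 1) ^ 2)
      rw [← sub_eq_add_neg, ← hy] at hB
      refine le_trans ?_ hB
      push_cast
      have h5 : ((m : ℝ) + 1) ^ 2 ≤ (8 * l) ^ 2 := by gcongr
      have h6 : 2 * ((m : ℝ) + 1) ^ 2 * (1 / (256 * l ^ 2)) ≤ 1 / 2 := by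
        rw [mul_one_div, div_le_iff₀ (by positivity)]
        nlinarith
      linarith
    have := Finset.card_nsmul_le_sum _ _ _ this
    rw [Finset.card_range, nsmul_eq_mul] at this
    push_cast at this
    linarith
  have h5 : F.re ≤ 2 * l + ‖DirichletCharacter.LFunction χ 1‖ * (1 - y ^ 2)⁻¹ := by
    set A := DirichletCharacter.LFunction χ 1 * ((1 - y ^ 2 : ℝ) : ℂ)⁻¹ with hA
    have hAn : ‖A‖ = ‖DirichletCharacter.LFunction χ 1‖ * (1 - y ^ 2)⁻¹ := by
      rw [hA, norm_mul, norm_inv, norm_real, Real.norm_eq_abs, abs_of_pos (by linarith)]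
    calc F.re ≤ ‖F‖ := re_le_norm F
      _ = ‖A - (A - F)‖ := by rw [sub_sub_cancel]
      _ ≤ ‖A‖ + ‖A - F‖ := norm_sub_le _ _
      _ ≤ _ := by rw [hAn]; linarith
  have h6 : 2 * l ≤ ‖DirichletCharacter.LFunction χ 1‖ * (1 - y ^ 2)⁻¹ := by linarith
  rw [← div_eq_mul_inv, le_div_iff₀ (by linarith)] at h6
  refine le_trans ?_ h6
  have h7 : 1 / (256 * l ^ 2) ≤ 1 - y ^ 2 := by
    have : 1 / (256 * l ^ 2) = 1 - y := by rw [hy]; ring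
    rw [this]; nlinarith
  calc 1 / (128 * l) = 2 * l * (1 / (256 * (l : ℝ) ^ 2)) := by field_simp; norm_num
    _ ≤ _ := by gcongr

end

end

section

open Complex Metric Set Filter Topology

section

variable {l : ℕ} [NeZero l] {χ : DirichletCharacter ℂ l}

lemma le_norm_one_sub_of_zero (hχ : χ ≠ 1) (hχ2 : χ ^ 2 = 1) {ρ : ℂ}
    (h : DirichletCharacter.LFunction χ ρ = 0) (hρ : ρ ∈ ball (1 : ℂ) (1 / 4)) :
    1 / (1536 * l ^ 2) ≤ ‖1 - ρ‖ := by
  have hd := DirichletCharacter.differentiable_LFunction hχ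
  have hl : (1 : ℝ) ≤ l := by exact_mod_cast NeZero.pos l
  have h1 : ∀ z ∈ ball (1 : ℂ) (1 / 4), ‖deriv (DirichletCharacter.LFunction χ) z‖ ≤ 12 * l := by
    intro z hz
    have h2 := norm_deriv_le_of_forall_mem_sphere_norm_le (c := z) (R := 1 / 4) (C := 3 * l)
      (f := DirichletCharacter.LFunction χ) (by norm_num) hd.diffContOnCl (by
        intro w hw
        have hz' : ‖z - 1‖ ≤ 1 / 4 := by rw [← dist_eq_norm]; exact (mem_ball.1 hz).le
        have hw' : ‖w - z‖ = 1 / 4 := by rw [← dist_eq_norm]; exact mem_sphere.1 hw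
        have hw1 : ‖w - 1‖ ≤ 1 / 2 := by
          calc ‖w - 1‖ = ‖(w - z) + (z - 1)‖ := by ring_nf
            _ ≤ 1 / 4 + 1 / 4 := (norm_add_le _ _).trans (add_le_add hw'.le hz')
            _ = 1 / 2 := by norm_num
        have hre : 1 / 2 ≤ w.re := by
          have := (abs_le.1 ((abs_re_le_norm _).trans hw1)).1
          simp at this; linarith
        have hn : ‖w‖ ≤ 3 / 2 := by
          calc ‖w‖ = ‖(w - 1) + 1‖ := by ring_nf
            _ ≤ 1 / 2 + 1 := (norm_add_le _ _).trans (by rw [norm_one]; gcongr)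
            _ = 3 / 2 := by norm_num
        calc _ ≤ 2 * l * ‖w‖ := norm_LFunction_le hχ hre
          _ ≤ 2 * l * (3 / 2) := by gcongr
          _ = 3 * l := by ring)
    linarith
  have h3 := (convex_ball (1 : ℂ) (1 / 4)).norm_image_sub_le_of_norm_deriv_le
    (fun z _ ↦ hd z) h1 hρ (mem_ball_self (by norm_num))
  rw [h, sub_zero] at h3
  have h4 := (le_norm_LFunction_one hχ hχ2).trans h3
  rw [div_le_iff₀ (by positivity)] at h4 ⊢
  nlinarith

end

lemma eq_of_sq_eq_one {l : ℕ} [Fact l.Prime] {χ ψ : DirichletCharacter ℂ l} (hχ : χ ≠ 1)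
    (hψ : ψ ≠ 1) (hχ2 : χ ^ 2 = 1) (hψ2 : ψ ^ 2 = 1) : χ = ψ := by
  obtain ⟨g, hg⟩ := IsCyclic.exists_generator (α := (ZMod l)ˣ)
  have key : ∀ {χ : DirichletCharacter ℂ l}, χ ≠ 1 → χ ^ 2 = 1 → χ g = -1 := by
    intro χ hχ hχ2
    have h1 : χ g ^ 2 = 1 := by
      rw [← MulChar.pow_apply' _ two_ne_zero, hχ2, MulChar.one_apply_coe]
    rcases sq_eq_sq_iff_eq_or_eq_neg.1 (h1.trans (one_pow 2).symm) with h | h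
    · refine absurd ((MulChar.eq_iff hg χ 1).2 ?_) hχ
      rw [h, MulChar.one_apply_coe]
    · exact h
  exact (MulChar.eq_iff hg χ ψ).2 ((key hχ hχ2).trans (key hψ hψ2).symm)

section

variable {l : ℕ} [NeZero l] {η σ Q : ℝ} (H : IsAdmissible l η σ Q)
  {χ : DirichletCharacter ℂ l}
include H

lemma IsAdmissible.norm_inv_pow_le (hχ : χ ≠ 1) (hχ2 : χ ^ 2 = 1) {ρ : ℂ}
    (h0 : DirichletCharacter.LFunction χ ρ = 0)
    (hρ : ρ ∈ ball (1 + σ : ℂ) (8 * σ)) (k : ℕ) :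
    ‖((1 + σ - ρ) ^ (k + 1))⁻¹‖ ≤ (1 - Real.exp (-(4 * Q)) / 4) / σ ^ (k + 1) := by
  have hσ := H.σ_pos
  have hs := H.σ_small
  have hη := H.η_le
  have hQ := H.Q_pos
  have hl : (1 : ℝ) ≤ l := by exact_mod_cast NeZero.pos l
  have h1 : ρ ∈ ball (1 : ℂ) (1 / 4) := by
    refine ball_subset_ball' ?_ hρ
    rw [dist_eq_norm]
    have : (1 + σ : ℂ) - 1 = σ := by ring
    rw [this, norm_real, Real.norm_eq_abs, abs_of_pos hσ]; linarith
  have h2 := le_norm_one_sub_of_zero hχ hχ2 h0 h1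
  have hre := re_lt_one_of_zero hχ h0
  set θ := Real.exp (-(4 * Q)) with hθ
  have hθ0 : 0 < θ := Real.exp_pos _
  have hθ1 : θ ≤ 1 := Real.exp_le_one_iff.2 (by linarith)
  have hQ64 : 64 ≤ Q := by
    refine le_trans ?_ H.le_Q
    rw [le_div_iff₀ (by linarith)]; linarith
  have h3 : σ * Real.exp (-(2 * Q)) ≤ ‖1 - ρ‖ := by
    refine le_trans ?_ h2
    have hl2 : (l : ℝ) ^ 2 ≤ Real.exp (2 * Q) := by
      calc (l : ℝ) ^ 2 ≤ Real.exp Q ^ 2 := by gcongr; exact H.level_le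
        _ = Real.exp (2 * Q) := by rw [← Real.exp_nat_mul]; norm_num
    have hσ' : σ ≤ 1 / 1536 := by
      rw [le_div_iff₀ (by norm_num)]
      have := H.mul_eq
      nlinarith
    rw [Real.exp_neg]
    calc σ * (Real.exp (2 * Q))⁻¹ ≤ 1 / 1536 * ((l : ℝ) ^ 2)⁻¹ := by gcongr
      _ = 1 / (1536 * l ^ 2) := by field_simp
  have h4 : σ ^ 2 * (1 + θ) ≤ ‖1 + σ - ρ‖ ^ 2 := by
    have e1 : ‖1 + σ - ρ‖ ^ 2 = (1 + σ - ρ.re) ^ 2 + ρ.im ^ 2 := by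
      rw [Complex.sq_norm, normSq_apply]; simp; ring
    have e2 : ‖1 - ρ‖ ^ 2 = (1 - ρ.re) ^ 2 + ρ.im ^ 2 := by
      rw [Complex.sq_norm, normSq_apply]; simp; ring
    have e3 : (σ * Real.exp (-(2 * Q))) ^ 2 = σ ^ 2 * θ := by
      rw [mul_pow, ← Real.exp_nat_mul, hθ]; congr 2; push_cast; ring
    have h5 : (σ * Real.exp (-(2 * Q))) ^ 2 ≤ ‖1 - ρ‖ ^ 2 := by gcongr
    rw [e3, e2] at h5
    rw [e1]
    nlinarith [mul_pos hσ (sub_pos.2 hre)]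
  set u := σ / ‖1 + σ - ρ‖ with hu
  have hpos : 0 < ‖1 + σ - ρ‖ := by
    by_contra! hc
    have : ‖1 + σ - ρ‖ = 0 := le_antisymm hc (norm_nonneg _)
    rw [this] at h4
    have : 0 < σ ^ 2 * (1 + θ) := by positivity
    linarith
  have hu0 : 0 < u := by positivity
  have hu2 : u ^ 2 * (1 + θ) ≤ 1 := by
    rw [hu, div_pow, div_mul_eq_mul_div, div_le_one (by positivity)]; exact h4
  have hu1 : u ≤ 1 - θ / 4 := by
    by_contra! hc
    have : (1 - θ / 4) ^ 2 < u ^ 2 := by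
      apply pow_lt_pow_left₀ hc (by linarith) two_ne_zero
    nlinarith [mul_pos hθ0 hθ0, mul_pos (mul_pos hθ0 hθ0) hθ0]
  have hup : u ^ (k + 1) ≤ 1 - θ / 4 := by
    refine le_trans ?_ hu1
    exact pow_le_of_le_one hu0.le (by linarith) k.succ_ne_zero
  rw [norm_inv, norm_pow, le_div_iff₀ (by positivity)]
  rw [hu, div_pow] at hup
  rwa [inv_mul_eq_div]

end

lemma IsAdmissible.residueClass_lower {l : ℕ} [Fact l.Prime] {η σ Q : ℝ}
    (H : IsAdmissible l η σ Q) {k : ℕ} (hk : 10 * Q ≤ k) :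
    k.factorial * (Real.exp (-(4 * Q)) / 8) / σ ^ (k + 1) ≤
      l * (LSeries (LSeries.logMul^[k]
        (fun n ↦ (ArithmeticFunction.vonMangoldt.residueClass (1 : ZMod l) n : ℂ))) (1 + σ)).re := by
  classical
  have hσ := H.σ_pos
  have hs := H.σ_small
  have hη := H.η_le
  have hQ := H.Q_pos
  have hQ64 : 64 ≤ Q := by
    refine le_trans ?_ H.le_Q
    rw [le_div_iff₀ (by linarith)]; linarith
  set θ := Real.exp (-(4 * Q)) with hθ
  have hθ0 : 0 < θ := Real.exp_pos _
  set f : DirichletCharacter ℂ l → ℂ := fun χ ↦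
    iteratedDeriv k (logDeriv (DirichletCharacter.LFunction χ)) (1 + σ) with hf
  set B : ℝ := (k + 1).factorial * (6 * Q) / (4 * σ) ^ (k + 1) with hB
  have hB0 : 0 ≤ B := by positivity
  set P : ℝ := k.factorial * ((1 - θ / 4) / σ ^ (k + 1)) with hP
  have hθ1 : θ ≤ 1 := Real.exp_le_one_iff.2 (by linarith)
  have hP0 : 0 ≤ P := by
    have : 0 ≤ 1 - θ / 4 := by linarith
    positivity
  have hnorm : ∀ χ : DirichletCharacter ℂ l, χ ≠ 1 → ‖f χ‖ ≤ (if χ ^ 2 = 1 then P else 0) + B := by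
    intro χ hχ
    split_ifs with hχ2
    · by_cases hz : ∃ ρ ∈ ball (1 + σ : ℂ) (8 * σ), DirichletCharacter.LFunction χ ρ = 0
      · obtain ⟨ρ, hρ, h0⟩ := hz
        have h1 := H.iteratedDeriv_le_of_zero hχ h0 hρ k
        have h2 := H.norm_inv_pow_le hχ hχ2 h0 hρ k
        have h3 : ‖(-1 : ℂ) ^ k * k.factorial * ((1 + σ - ρ) ^ (k + 1))⁻¹‖ ≤ P := by
          rw [norm_mul, norm_mul, norm_pow, norm_neg, norm_one, one_pow, one_mul, norm_natCast, hP]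
          gcongr
        calc ‖f χ‖ = ‖(-1 : ℂ) ^ k * k.factorial * ((1 + σ - ρ) ^ (k + 1))⁻¹ + (f χ -
              (-1 : ℂ) ^ k * k.factorial * ((1 + σ - ρ) ^ (k + 1))⁻¹)‖ := by ring_nf
          _ ≤ P + B := (norm_add_le _ _).trans (add_le_add h3 h1)
      · push Not at hz
        exact (H.iteratedDeriv_le_of_zero_free hχ hz k).trans (by linarith)
    · rw [zero_add]
      exact H.iteratedDeriv_le_of_zero_free hχ (fun ρ hρ ↦ H.ne_zero_of_sq_ne_one hχ2 hρ) k
  have hcard : Fintype.card (DirichletCharacter ℂ l) = l.totient :=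
    (Nat.card_eq_fintype_card).symm.trans
      (DirichletCharacter.card_eq_totient_of_hasEnoughRootsOfUnity ℂ l)
  have hlp : l.Prime := Fact.out
  have hφ : (l.totient : ℝ) ≤ l := by exact_mod_cast Nat.totient_le l
  have hφ0 : 0 < (l.totient : ℝ) := by exact_mod_cast Nat.totient_pos.2 hlp.pos
  have hsum : ‖∑ χ ∈ Finset.univ.erase (1 : DirichletCharacter ℂ l), f χ‖ ≤ P + (l - 1) * B := by
    refine (norm_sum_le_of_le _ (fun χ hχ ↦ hnorm χ (Finset.ne_of_mem_erase hχ))).trans ?_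
    rw [Finset.sum_add_distrib]
    refine add_le_add ?_ ?_
    · rw [← Finset.sum_filter, Finset.sum_const, nsmul_eq_mul]
      refine mul_le_of_le_one_left hP0 ?_
      norm_cast
      apply Finset.card_le_one.2
      intro a ha b hb
      simp only [Finset.mem_filter, Finset.mem_erase, Finset.mem_univ, and_true] at ha hb
      exact eq_of_sq_eq_one ha.1 hb.1 ha.2 hb.2
    · rw [Finset.sum_const, nsmul_eq_mul, Finset.card_erase_of_mem (Finset.mem_univ _),
        Finset.card_univ, hcard, Nat.cast_sub (Nat.totient_pos.2 hlp.pos)]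
      gcongr
      simp
  have htriv : ‖f 1 + (-1) ^ k * k.factorial * ((σ : ℂ) ^ (k + 1))⁻¹‖ ≤ B := by
    refine (H.trivial_le σ (8 * σ) hσ (by linarith) (by linarith) k).trans ?_
    rw [hB, show 8 * σ / 2 = 4 * σ by ring]
    gcongr
    linarith
  set S := LSeries (LSeries.logMul^[k]
        (fun n ↦ (ArithmeticFunction.vonMangoldt.residueClass (1 : ZMod l) n : ℂ))) (1 + σ) with hS
  have hre1 : 1 < (1 + σ : ℂ).re := by simp [hσ]
  have hkey : (l.totient : ℂ) * S = (-1) ^ (k + 1) * ∑ χ, f χ := by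
    have e1 : LSeries (fun n ↦ (ArithmeticFunction.vonMangoldt.residueClass (1 : ZMod l) n : ℂ))
        =ᶠ[𝓝 (1 + σ : ℂ)] fun s ↦ -(l.totient : ℂ)⁻¹ * ∑ χ : DirichletCharacter ℂ l,
          logDeriv (DirichletCharacter.LFunction χ) s := by
      have : ∀ᶠ s : ℂ in 𝓝 (1 + σ : ℂ), 1 < s.re :=
        continuous_re.continuousAt.eventually_const_lt hre1
      filter_upwards [this] with s hs
      rw [ArithmeticFunction.vonMangoldt.LSeries_residueClass_eq isUnit_one hs]
      congr 1
      refine Finset.sum_congr rfl fun χ _ ↦ ?_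
      rw [inv_one, map_one, one_mul, logDeriv_apply]
    have e2 := e1.iteratedDeriv_eq k
    rw [LSeries_iteratedDeriv k (lt_of_le_of_lt
      (ArithmeticFunction.vonMangoldt.abscissaOfAbsConv_residueClass_le_one _)
      (by exact_mod_cast hre1)), iteratedDeriv_const_mul_field, iteratedDeriv_fun_sum] at e2
    · have hne : (l.totient : ℂ) ≠ 0 := by exact_mod_cast hφ0.ne'
      have e3 : S = (-1) ^ k * (-(l.totient : ℂ)⁻¹ * ∑ χ, f χ) := by
        rw [← e2, ← mul_assoc, ← mul_pow]; simp [hS]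
      rw [e3, pow_succ]
      field_simp
    · intro χ _
      apply AnalyticAt.contDiffAt
      have hd : AnalyticAt ℂ (DirichletCharacter.LFunction χ) (1 + σ) := by
        apply DifferentiableOn.analyticAt (s := {s : ℂ | 1 < s.re})
        · intro z hz
          apply DifferentiableAt.differentiableWithinAt
          apply DirichletCharacter.differentiableAt_LFunction χ z (Or.inl _)
          rintro rfl; simp at hz
        · exact (isOpen_lt continuous_const continuous_re).mem_nhds hre1
      refine hd.deriv.div hd (DirichletCharacter.LFunction_ne_zero_of_one_le_re χ (Or.inr ?_) hre1.le)
      intro h; rw [h] at hre1; simp at hre1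
  have hmain : ‖(l.totient : ℂ) * S - k.factorial * ((σ : ℂ) ^ (k + 1))⁻¹‖ ≤ P + l * B := by
    have e : (l.totient : ℂ) * S - k.factorial * ((σ : ℂ) ^ (k + 1))⁻¹ =
        (-1) ^ (k + 1) * ((f 1 + (-1) ^ k * k.factorial * ((σ : ℂ) ^ (k + 1))⁻¹) +
          ∑ χ ∈ Finset.univ.erase (1 : DirichletCharacter ℂ l), f χ) := by
      rw [hkey, ← Finset.add_sum_erase _ _ (Finset.mem_univ (1 : DirichletCharacter ℂ l))]
      have : (-1 : ℂ) ^ (k + 1) * (-1) ^ k = -1 := by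
        rw [pow_succ, mul_right_comm, ← mul_pow]; simp
      linear_combination (-(k.factorial : ℂ) * ((σ : ℂ) ^ (k + 1))⁻¹) * this
    rw [e, norm_mul, norm_pow, norm_neg, norm_one, one_pow, one_mul]
    calc _ ≤ B + (P + (l - 1) * B) := (norm_add_le _ _).trans (add_le_add htriv hsum)
      _ = P + l * B := by ring
  have hre : k.factorial * (σ ^ (k + 1))⁻¹ - (P + l * B) ≤ l.totient * S.re := by
    have h1 := (abs_le.1 ((abs_re_le_norm _).trans hmain)).1
    have e1 : ((l.totient : ℂ) * S).re = l.totient * S.re := by simp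
    have e2 : ((k.factorial : ℂ) * ((σ : ℂ) ^ (k + 1))⁻¹).re = k.factorial * (σ ^ (k + 1))⁻¹ := by
      have : (k.factorial : ℂ) * ((σ : ℂ) ^ (k + 1))⁻¹ =
        ((k.factorial * (σ ^ (k + 1))⁻¹ : ℝ) : ℂ) := by push_cast; rfl
      rw [this, ofReal_re]
    rw [sub_re, e1, e2] at h1
    linarith
  have hlB : l * B ≤ k.factorial * (θ / 8) / σ ^ (k + 1) := by
    have hk0 : (0 : ℝ) ≤ k := k.cast_nonneg
    have a1 : ((k + 1 : ℕ) : ℝ) ≤ 2 ^ (k + 1) := by exact_mod_cast Nat.lt_two_pow_self.le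
    have a2 : 48 * Q * Real.exp (5 * Q) ≤ 2 ^ (k + 1) := by
      have h1 : Real.exp (6.9 * Q) ≤ 2 ^ (k + 1) := by
        rw [← Real.exp_log (show (0 : ℝ) < 2 ^ (k + 1) by positivity), Real.exp_le_exp, Real.log_pow]
        have := Real.log_two_gt_d9
        push_cast
        nlinarith
      refine le_trans ?_ h1
      have h2 : 6.9 * Q = Q + 0.9 * Q + 5 * Q := by ring
      rw [h2, Real.exp_add, Real.exp_add]
      refine mul_le_mul_of_nonneg_right ?_ (Real.exp_pos _).le
      have h3 := Real.add_one_le_exp Q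
      have h4 := Real.add_one_le_exp (0.9 * Q)
      have h5 : 48 ≤ Real.exp (0.9 * Q) := by linarith
      nlinarith [Real.exp_pos Q]
    have a3 : l * ((k + 1 : ℕ) : ℝ) * (6 * Q) * 8 ≤ θ * 4 ^ (k + 1) := by
      have h1 : (4 : ℝ) ^ (k + 1) = 2 ^ (k + 1) * 2 ^ (k + 1) := by rw [← mul_pow]; norm_num
      have h2 : θ * Real.exp (5 * Q) = Real.exp Q := by rw [hθ, ← Real.exp_add]; ring_nf
      calc l * ((k + 1 : ℕ) : ℝ) * (6 * Q) * 8 ≤ Real.exp Q * 2 ^ (k + 1) * (6 * Q) * 8 := by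
            gcongr; exact H.level_le
        _ = θ * (2 ^ (k + 1) * (48 * Q * Real.exp (5 * Q))) := by rw [← h2]; ring
        _ ≤ θ * 4 ^ (k + 1) := by rw [h1]; gcongr
    rw [hB, Nat.factorial_succ, mul_pow]
    push_cast at a3 ⊢
    rw [← mul_div_assoc, div_le_div_iff₀ (by positivity) (by positivity)]
    have : (0 : ℝ) ≤ k.factorial * σ ^ (k + 1) / 8 := by positivity
    have := mul_le_mul_of_nonneg_left a3 this
    convert this using 1 <;> ring
  have hfin : k.factorial * (θ / 8) / σ ^ (k + 1) ≤ l.totient * S.re := by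
    refine le_trans ?_ hre
    have : k.factorial * (σ ^ (k + 1))⁻¹ - P = k.factorial * (θ / 4) / σ ^ (k + 1) := by
      rw [hP]; ring
    have h2 : k.factorial * (θ / 4) / σ ^ (k + 1) = 2 * (k.factorial * (θ / 8) / σ ^ (k + 1)) := by
      ring
    linarith
  have hS0 : 0 ≤ S.re := by
    have h0 : 0 ≤ l.totient * S.re := le_trans (by positivity) hfin
    exact nonneg_of_mul_nonneg_right h0 hφ0
  exact hfin.trans (by gcongr)

end

open Finset in
theorem exists_sum_log_div_le_of_sparse : ∃ Z : ℝ, 0 < Z ∧ ∀ (s : Finset ℕ) (X : ℝ), 1 ≤ X →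
    (∀ n ∈ s, X < n) → (∀ n ∈ s, ((s.filter (· ≤ n)).card : ℝ) ≤ 15 * (n : ℝ) ^ (3 / 4 : ℝ)) →
    ∑ n ∈ s, Real.log n / n ≤ Z * X ^ (-(1 / 10) : ℝ) := by
  have hsum : Summable (fun i : ℕ ↦ (i : ℝ) ^ (-(16 / 15) : ℝ)) := by
    rw [Real.summable_nat_rpow]; norm_num
  have hnn : ∀ i : ℕ, 0 ≤ (i : ℝ) ^ (-(16 / 15) : ℝ) := fun i ↦ by positivity
  refine ⟨10 * 225 * (∑' i : ℕ, (i : ℝ) ^ (-(16 / 15) : ℝ)), ?_, fun s X hX hs hc ↦ ?_⟩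
  · have := hsum.tsum_pos hnn 1 (by simp)
    positivity
  have hterm : ∀ n ∈ s, Real.log n / n ≤ 10 * 225 * X ^ (-(1 / 10) : ℝ) *
      ((s.filter (· ≤ n)).card : ℝ) ^ (-(16 / 15) : ℝ) := by
    intro n hn
    have hn0 : (0 : ℝ) < n := by linarith [hs n hn]
    have h1 : Real.log n ≤ 10 * (n : ℝ) ^ (1 / 10 : ℝ) := by
      have := Real.log_le_rpow_div hn0.le (show (0 : ℝ) < 1 / 10 by norm_num)
      linarith
    have h2 : Real.log n / n ≤ 10 * (n : ℝ) ^ (-(9 / 10) : ℝ) := by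
      rw [div_le_iff₀ hn0]
      calc _ ≤ _ := h1
        _ = 10 * ((n : ℝ) ^ (-(9 / 10) : ℝ) * (n : ℝ) ^ (1 : ℝ)) := by
          rw [← Real.rpow_add hn0]; norm_num
        _ = _ := by rw [Real.rpow_one]; ring
    have h3 : (n : ℝ) ^ (-(9 / 10) : ℝ) = (n : ℝ) ^ (-(1 / 10) : ℝ) * (n : ℝ) ^ (-(4 / 5) : ℝ) := by
      rw [← Real.rpow_add hn0]; norm_num
    have h4 : (n : ℝ) ^ (-(1 / 10) : ℝ) ≤ X ^ (-(1 / 10) : ℝ) :=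
      Real.rpow_le_rpow_of_nonpos (by linarith) (hs n hn).le (by norm_num)
    have hpos : 0 < ((s.filter (· ≤ n)).card : ℝ) := by
      rw [Nat.cast_pos, card_pos]; exact ⟨n, by simp [hn]⟩
    have h5 : (n : ℝ) ^ (-(4 / 5) : ℝ) ≤ 225 * ((s.filter (· ≤ n)).card : ℝ) ^ (-(16 / 15) : ℝ) := by
      have e1 : (n : ℝ) ^ (-(4 / 5) : ℝ) = ((n : ℝ) ^ (3 / 4 : ℝ)) ^ (-(16 / 15) : ℝ) := by
        rw [← Real.rpow_mul hn0.le]; norm_num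
      have e2 : ((n : ℝ) ^ (3 / 4 : ℝ)) ^ (-(16 / 15) : ℝ) ≤
          (((s.filter (· ≤ n)).card : ℝ) / 15) ^ (-(16 / 15) : ℝ) := by
        apply Real.rpow_le_rpow_of_nonpos (by positivity) _ (by norm_num)
        have := hc n hn
        linarith
      rw [e1]
      refine e2.trans ?_
      rw [Real.div_rpow hpos.le (by norm_num), div_eq_mul_inv, ← Real.rpow_neg (by norm_num), mul_comm]
      refine mul_le_mul_of_nonneg_right ?_ (by positivity)
      calc (15 : ℝ) ^ (-(-(16 / 15)) : ℝ) ≤ 15 ^ (2 : ℝ) :=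
            Real.rpow_le_rpow_of_exponent_le (by norm_num) (by norm_num)
        _ = 225 := by norm_num
    calc _ ≤ _ := h2
      _ ≤ 10 * (X ^ (-(1 / 10) : ℝ) * (225 * ((s.filter (· ≤ n)).card : ℝ) ^ (-(16 / 15) : ℝ))) := by
        rw [h3]; gcongr
      _ = _ := by ring
  refine (sum_le_sum hterm).trans ?_
  rw [← mul_sum]
  have hinj : Set.InjOn (fun n ↦ (s.filter (· ≤ n)).card) s := by
    intro m hm n hn h
    by_contra hne
    rcases lt_or_gt_of_ne hne with hlt | hlt
    · refine (card_lt_card (?_ : s.filter (· ≤ m) ⊂ s.filter (· ≤ n))).ne h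
      rw [ssubset_iff_of_subset (monotone_filter_right _ fun x _ (hx : x ≤ m) ↦ hx.trans hlt.le)]
      exact ⟨n, by simpa using hn, by simp [hlt]⟩
    · refine (card_lt_card (?_ : s.filter (· ≤ n) ⊂ s.filter (· ≤ m))).ne' h
      rw [ssubset_iff_of_subset (monotone_filter_right _ fun x _ (hx : x ≤ n) ↦ hx.trans hlt.le)]
      exact ⟨m, by simpa using hm, by simp [hlt]⟩
  have : ∑ n ∈ s, ((s.filter (· ≤ n)).card : ℝ) ^ (-(16 / 15) : ℝ) ≤
      ∑' i : ℕ, (i : ℝ) ^ (-(16 / 15) : ℝ) := by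
    rw [← sum_image (f := fun i : ℕ ↦ (i : ℝ) ^ (-(16 / 15) : ℝ)) hinj]
    exact hsum.sum_le_tsum _ fun i _ ↦ hnn i
  calc _ ≤ 10 * 225 * X ^ (-(1 / 10) : ℝ) * ∑' i : ℕ, (i : ℝ) ^ (-(16 / 15) : ℝ) := by gcongr
    _ = _ := by ring

open Finset in
theorem card_primePow_not_prime_le {Y : ℕ} (hY : 1 ≤ Y) :
    (((range (Y + 1)).filter (fun n ↦ IsPrimePow n ∧ ¬ n.Prime)).card : ℝ) ≤
      14 * (Y : ℝ) ^ (3 / 4 : ℝ) := by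
  have hY1 : (1 : ℝ) ≤ Y := by exact_mod_cast hY
  have hsub : (range (Y + 1)).filter (fun n ↦ IsPrimePow n ∧ ¬ n.Prime) ⊆
      (range (Nat.sqrt Y + 1) ×ˢ range (Nat.log 2 Y + 1)).image (fun x ↦ x.1 ^ x.2) := by
    intro n hn
    simp only [mem_filter, mem_range, isPrimePow_nat_iff] at hn
    obtain ⟨hnY, ⟨p, m, hp, hm, rfl⟩, hnp⟩ := hn
    have hm2 : 2 ≤ m := by
      rcases Nat.lt_or_ge m 2 with h | h
      · have : m = 1 := by omega
        subst this; simp [hp] at hnp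
      · exact h
    simp only [mem_image, mem_product, mem_range, Prod.exists]
    refine ⟨p, m, ⟨?_, ?_⟩, rfl⟩
    · rw [Nat.lt_succ_iff, Nat.le_sqrt, ← pow_two]
      exact (Nat.pow_le_pow_right hp.pos hm2).trans (by omega)
    · rw [Nat.lt_succ_iff]
      apply Nat.le_log_of_pow_le (by norm_num)
      exact (Nat.pow_le_pow_left hp.two_le m).trans (by omega)
  have hcard := (card_le_card hsub).trans card_image_le
  rw [card_product, card_range, card_range] at hcard
  have h1 : ((Nat.sqrt Y + 1 : ℕ) : ℝ) ≤ 2 * (Y : ℝ) ^ (1 / 2 : ℝ) := by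
    have e1 : (Nat.sqrt Y : ℝ) ≤ (Y : ℝ) ^ (1 / 2 : ℝ) := by
      rw [← Real.sqrt_eq_rpow]; exact Real.nat_sqrt_le_real_sqrt
    have e2 : 1 ≤ (Y : ℝ) ^ (1 / 2 : ℝ) := Real.one_le_rpow hY1 (by norm_num)
    push_cast; linarith
  have h2 : ((Nat.log 2 Y + 1 : ℕ) : ℝ) ≤ 7 * (Y : ℝ) ^ (1 / 4 : ℝ) := by
    have e0 : (Nat.log 2 Y : ℝ) ≤ Real.logb 2 Y := by exact_mod_cast Real.natLog_le_logb Y 2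
    have e1 : Real.logb 2 Y * Real.log 2 = Real.log Y := by
      rw [Real.logb, div_mul_cancel₀]; exact (Real.log_pos (by norm_num)).ne'
    have e2 : 1 ≤ (Y : ℝ) ^ (1 / 4 : ℝ) := Real.one_le_rpow hY1 (by norm_num)
    have e3 := Real.log_le_rpow_div (show (0 : ℝ) ≤ Y by positivity) (show (0 : ℝ) < 1 / 4 by norm_num)
    have e4 := Real.log_two_gt_d9
    have e5 : 0 ≤ Real.logb 2 Y := Real.logb_nonneg (by norm_num) hY1
    push_cast
    nlinarith
  calc _ ≤ ((Nat.sqrt Y + 1 : ℕ) : ℝ) * ((Nat.log 2 Y + 1 : ℕ) : ℝ) := by exact_mod_cast hcard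
    _ ≤ (2 * (Y : ℝ) ^ (1 / 2 : ℝ)) * (7 * (Y : ℝ) ^ (1 / 4 : ℝ)) := by gcongr
    _ = 14 * ((Y : ℝ) ^ (1 / 2 : ℝ) * (Y : ℝ) ^ (1 / 4 : ℝ)) := by ring
    _ = _ := by rw [← Real.rpow_add (by positivity)]; norm_num

section

open Complex Metric Set Filter Topology

section

lemma logMul_iterate_apply (f : ℕ → ℂ) (k n : ℕ) :
    LSeries.logMul^[k] f n = (Complex.log n) ^ k * f n := by
  induction k generalizing f with
  | zero => simp
  | succ k ih => rw [Function.iterate_succ_apply, ih, LSeries.logMul]; ring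

lemma re_LSeries_le_of_sum_le {f : ℕ → ℂ} {g : ℕ → ℝ} (hg : ∀ n, f n = g n) (hg0 : ∀ n, 0 ≤ g n)
    {x : ℝ} {B : ℝ}
    (h : ∀ N, ∑ n ∈ Finset.range N, g n / (n : ℝ) ^ x * (if n = 0 then 0 else 1) ≤ B) :
    (LSeries f x).re ≤ B := by
  have e : ∀ n, (LSeries.term f x n).re = g n / (n : ℝ) ^ x * (if n = 0 then 0 else 1) := by
    intro n
    rcases eq_or_ne n 0 with rfl | hn
    · simp
    · have : (n : ℂ) ^ (x : ℂ) = ((n : ℝ) ^ x : ℝ) := by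
        rw [ofReal_cpow n.cast_nonneg]; simp
      rw [LSeries.term_of_ne_zero hn, this, div_ofReal_re, hg, ofReal_re]
      simp [hn]
  by_cases hs : LSeriesSummable f x
  · rw [LSeries, re_tsum hs, tsum_congr e]
    refine Real.tsum_le_of_sum_range_le (fun n ↦ ?_) h
    have := hg0 n
    positivity
  · rw [LSeries, tsum_eq_zero_of_not_summable hs, zero_re]
    simpa using h 0

lemma sum_rpow_le_norm_riemannZeta {δ : ℝ} (hδ : 0 < δ) (s : Finset ℕ) :
    ∑ n ∈ s, 1 / (n : ℝ) ^ (1 + δ) ≤ ‖riemannZeta (1 + δ)‖ := by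
  rw [zeta_eq_tsum_one_div_nat_cpow (by simpa using hδ)]
  have e : ∀ n : ℕ, 1 / (n : ℂ) ^ ((1 : ℂ) + δ) = ((1 / (n : ℝ) ^ (1 + δ) : ℝ) : ℂ) := by
    intro n
    push_cast
    rw [ofReal_cpow n.cast_nonneg]
    push_cast
    rfl
  simp_rw [e]
  rw [← ofReal_tsum, norm_real]
  refine le_trans ?_ (le_abs_self _)
  refine Summable.sum_le_tsum (f := fun n : ℕ ↦ 1 / (n : ℝ) ^ (1 + δ)) s (fun i _ ↦ by positivity) ?_
  exact Real.summable_one_div_nat_rpow.2 (by linarith)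

variable {n k : ℕ} {σ : ℝ}

lemma log_pow_div_rpow_le (hn : n ≠ 0) (hσ : 0 < σ) :
    Real.log n ^ k / (n : ℝ) ^ σ ≤ k.factorial / σ ^ k := by
  have hn1 : (0 : ℝ) < n := by positivity
  have hl : 0 ≤ Real.log n := Real.log_natCast_nonneg n
  have := Real.pow_div_factorial_le_exp (σ * Real.log n) (by positivity) k
  rw [mul_comm σ, ← Real.rpow_def_of_pos hn1, div_le_iff₀ (by positivity), mul_pow] at this
  rw [div_le_div_iff₀ (by positivity) (by positivity)]
  linarith

lemma vonMangoldt_mid_le (hn : n ≠ 0) (hσ : 0 < σ) :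
    Real.log n ^ k * ArithmeticFunction.vonMangoldt n / (n : ℝ) ^ (1 + σ) ≤
      k.factorial / σ ^ k * (Real.log n / n) := by
  have hn1 : (0 : ℝ) < n := by positivity
  have hl : 0 ≤ Real.log n := Real.log_natCast_nonneg n
  have h1 := log_pow_div_rpow_le (k := k) hn hσ
  have h2 : ArithmeticFunction.vonMangoldt n ≤ Real.log n := ArithmeticFunction.vonMangoldt_le_log
  rw [Real.rpow_add hn1, Real.rpow_one, mul_comm (n : ℝ), ← div_mul_div_comm]
  exact mul_le_mul h1 (by gcongr) (div_nonneg ArithmeticFunction.vonMangoldt_nonneg hn1.le) (by positivity)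

lemma vonMangoldt_head_le {a : ℝ} (hn : n ≠ 0) (hσ : 0 < σ) (ha : Real.log n ≤ a) :
    Real.log n ^ k * ArithmeticFunction.vonMangoldt n / (n : ℝ) ^ (1 + σ) ≤ a ^ k := by
  have hn1 : (1 : ℝ) ≤ n := by exact_mod_cast Nat.one_le_iff_ne_zero.2 hn
  have hl : 0 ≤ Real.log n := Real.log_natCast_nonneg n
  have h2 : ArithmeticFunction.vonMangoldt n ≤ n :=
    ArithmeticFunction.vonMangoldt_le_log.trans (Real.log_le_self (by positivity))
  rw [div_le_iff₀ (by positivity), Real.rpow_add (by positivity), Real.rpow_one]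
  have h3 : 1 ≤ (n : ℝ) ^ σ := Real.one_le_rpow hn1 hσ.le
  have h4 : Real.log n ^ k ≤ a ^ k := by gcongr
  refine mul_le_mul h4 ?_ ArithmeticFunction.vonMangoldt_nonneg (pow_nonneg (hl.trans ha) _)
  nlinarith

lemma vonMangoldt_tail_le {b : ℝ} (hn : n ≠ 0) (hσ : 0 < σ) (hb : b ≤ Real.log n) :
    Real.log n ^ k * ArithmeticFunction.vonMangoldt n / (n : ℝ) ^ (1 + σ) ≤
      k.factorial / σ ^ k * (2 ^ k * Real.exp (-(b * σ / 4)) * (8 / σ)) *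
        (1 / (n : ℝ) ^ (1 + σ / 8)) := by
  have hn1 : (0 : ℝ) < n := by positivity
  have hl : 0 ≤ Real.log n := Real.log_natCast_nonneg n
  have h1 := log_pow_div_rpow_le (k := k) hn (half_pos hσ)
  have h2 : ArithmeticFunction.vonMangoldt n ≤ (8 / σ) * (n : ℝ) ^ (σ / 8) := by
    refine (ArithmeticFunction.vonMangoldt_le_log.trans
      (Real.log_le_rpow_div hn1.le (show 0 < σ / 8 by positivity))).trans (le_of_eq ?_)
    field_simp
  have h3 : 1 / (n : ℝ) ^ (σ / 4) ≤ Real.exp (-(b * σ / 4)) := by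
    rw [Real.exp_neg, ← one_div, Real.rpow_def_of_pos hn1]
    gcongr
    nlinarith
  have e : (n : ℝ) ^ (1 + σ) = (n : ℝ) ^ (σ / 2) * (n : ℝ) ^ (σ / 4) * (n : ℝ) ^ (1 + σ / 8) *
      (n : ℝ) ^ (σ / 8) := by
    rw [← Real.rpow_add hn1, ← Real.rpow_add hn1, ← Real.rpow_add hn1]; ring_nf
  have e2 : Real.log n ^ k * ArithmeticFunction.vonMangoldt n / (n : ℝ) ^ (1 + σ) =
      (Real.log n ^ k / (n : ℝ) ^ (σ / 2)) * (1 / (n : ℝ) ^ (σ / 4)) *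
      (ArithmeticFunction.vonMangoldt n / (n : ℝ) ^ (σ / 8)) * (1 / (n : ℝ) ^ (1 + σ / 8)) := by
    rw [e]; field_simp
  have h4 : ArithmeticFunction.vonMangoldt n / (n : ℝ) ^ (σ / 8) ≤ 8 / σ := by
    rwa [div_le_iff₀ (by positivity)]
  rw [e2]
  have h5 := div_nonneg (ArithmeticFunction.vonMangoldt_nonneg (n := n))
    (show 0 ≤ (n : ℝ) ^ (σ / 8) by positivity)
  calc _ ≤ (k.factorial / (σ / 2) ^ k) * Real.exp (-(b * σ / 4)) * (8 / σ) *
        (1 / (n : ℝ) ^ (1 + σ / 8)) := by gcongr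
    _ = _ := by rw [div_pow]; field_simp

end

end

section

open Complex Metric Set Filter Topology

section

open ArithmeticFunction.vonMangoldt in
theorem IsAdmissible.exists_many_primes {l : ℕ} [Fact l.Prime] {η σ Q Z : ℝ}
    (H : IsAdmissible l η σ Q) (hQ : 1 ≤ Q) (hZQ : Z ≤ Q)
    (hZ : ∀ (s : Finset ℕ) (X : ℝ), 1 ≤ X → (∀ n ∈ s, X < n) →
      (∀ n ∈ s, ((s.filter (· ≤ n)).card : ℝ) ≤ 15 * (n : ℝ) ^ (3 / 4 : ℝ)) →
      ∑ n ∈ s, Real.log n / n ≤ Z * X ^ (-(1 / 10) : ℝ)) {k : ℕ} (hk : 100 * Q ≤ k) :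
    ∃ Y : ℕ, Real.exp (100 * Q) ≤ Y ∧ Y ≤ Real.exp (8 * k / σ) ∧ (Y : ℝ) ^ (3 / 4 : ℝ) ≤
      ((Finset.range (Y + 1)).filter (fun p : ℕ ↦ p.Prime ∧ (p : ZMod l) = 1)).card := by
  by_contra! hcon
  have hσ := H.σ_pos
  have hσQ := H.mul_eq
  set a := 100 * Q with ha
  set b := 8 * k / σ with hb
  set A : ℝ := k.factorial / σ ^ k with hA
  have hA0 : 0 < A := by positivity
  set f : ℕ → ℝ := residueClass (1 : ZMod l) with hf
  have hf0 : ∀ n, 0 ≤ f n := residueClass_nonneg _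
  have hfle : ∀ n, f n ≤ ArithmeticFunction.vonMangoldt n := residueClass_le _
  have hlow := H.residueClass_lower (k := k) (by linarith)
  set B : ℝ := A * (Real.exp (a - 6 * k) + Q * Real.exp (-(10 * Q)) +
    2 * Real.exp (4 * Q - k)) with hB
  have hup : (LSeries (LSeries.logMul^[k] (fun n ↦ (f n : ℂ))) ((1 + σ : ℝ) : ℂ)).re ≤ B := by
    refine re_LSeries_le_of_sum_le (g := fun n ↦ Real.log n ^ k * f n) (fun n ↦ ?_) (fun n ↦ ?_)
      fun N ↦ ?_
    · rw [logMul_iterate_apply]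
      rw [ofReal_mul, ofReal_pow, natCast_log]
    · exact mul_nonneg (pow_nonneg (Real.log_natCast_nonneg n) _) (hf0 n)
    set G : ℕ → ℝ := fun n ↦ Real.log n ^ k * f n / (n : ℝ) ^ (1 + σ) * (if n = 0 then 0 else 1)
    have hG : ∀ n ≠ 0, G n ≤
        Real.log n ^ k * ArithmeticFunction.vonMangoldt n / (n : ℝ) ^ (1 + σ) := by
      intro n hn
      simp only [G, hn, if_false, mul_one]
      have := hfle n
      have : 0 ≤ Real.log n := Real.log_natCast_nonneg n
      gcongr
    have hG0 : ∀ n, f n = 0 → G n = 0 := fun n hn ↦ by simp [G, hn]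
    set s := (Finset.range N).filter (fun n ↦ f n ≠ 0) with hs
    have hsne : ∀ n ∈ s, n ≠ 0 := by
      rintro n hn rfl
      simp [hs, hf] at hn
    have hsum : ∑ n ∈ Finset.range N, G n = ∑ n ∈ s, G n := by
      refine (Finset.sum_filter_of_ne fun n _ hn ↦ mt (hG0 n) hn).symm
    set s₁ := s.filter (fun n : ℕ ↦ Real.log n ≤ a)
    set s₂ := (s.filter (fun n : ℕ ↦ ¬ Real.log n ≤ a)).filter (fun n : ℕ ↦ Real.log n ≤ b)
    set s₃ := (s.filter (fun n : ℕ ↦ ¬ Real.log n ≤ a)).filter (fun n : ℕ ↦ ¬ Real.log n ≤ b)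
    have hsplit : ∑ n ∈ s, G n = ∑ n ∈ s₁, G n + (∑ n ∈ s₂, G n + ∑ n ∈ s₃, G n) := by
      rw [Finset.sum_filter_add_sum_filter_not, Finset.sum_filter_add_sum_filter_not]
    have h₁ : ∑ n ∈ s₁, G n ≤ A * Real.exp (a - 6 * k) := by
      have hterm : ∀ n ∈ s₁, G n ≤ a ^ k := by
        intro n hn
        have hn' := Finset.mem_filter.1 hn
        have h0 := hsne n hn'.1
        exact (hG n h0).trans (vonMangoldt_head_le h0 hσ hn'.2)
      have hcard : (s₁.card : ℝ) ≤ Real.exp a := by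
        have hsub : s₁ ⊆ Finset.Icc 1 ⌊Real.exp a⌋₊ := by
          intro n hn
          have hn' := Finset.mem_filter.1 hn
          have h0 := hsne n hn'.1
          rw [Finset.mem_Icc]
          refine ⟨Nat.one_le_iff_ne_zero.2 h0, Nat.le_floor ?_⟩
          rw [← Real.log_le_iff_le_exp (by positivity)]
          exact hn'.2
        have := Finset.card_le_card hsub
        rw [Nat.card_Icc, Nat.add_sub_cancel] at this
        exact (Nat.cast_le.2 this).trans (Nat.floor_le (Real.exp_pos _).le)
      calc ∑ n ∈ s₁, G n ≤ s₁.card • a ^ k := Finset.sum_le_card_nsmul _ _ _ hterm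
        _ ≤ Real.exp a * a ^ k := by rw [nsmul_eq_mul]; gcongr
        _ ≤ A * Real.exp (a - 6 * k) := by
          have e1 : a ^ k = (1 / 800) ^ k / σ ^ k := by
            rw [← div_pow]; congr 1; field_simp; rw [ha]; linarith
          have e2 : (1 / 800 : ℝ) ^ k ≤ Real.exp (-(6 * k)) := by
            have : Real.exp (-(6 * k)) = Real.exp (-6) ^ k := by
              rw [← Real.exp_nat_mul]; ring_nf
            rw [this]
            gcongr
            rw [one_div, Real.exp_neg]
            gcongr
            calc Real.exp 6 = Real.exp 1 ^ 6 := by rw [← Real.exp_nat_mul]; norm_num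
              _ ≤ 2.7182818286 ^ 6 := by gcongr; exact Real.exp_one_lt_d9.le
              _ ≤ 800 := by norm_num
          have e3 : (1 : ℝ) ≤ k.factorial := by exact_mod_cast k.factorial_pos
          rw [e1, sub_eq_add_neg, Real.exp_add, hA]
          calc Real.exp a * ((1 / 800) ^ k / σ ^ k) ≤
              Real.exp a * (Real.exp (-(6 * k)) / σ ^ k) := by gcongr
            _ = 1 / σ ^ k * (Real.exp a * Real.exp (-(6 * k))) := by ring
            _ ≤ _ := by gcongr
    have h₂ : ∑ n ∈ s₂, G n ≤ A * (Q * Real.exp (-(10 * Q))) := by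
      have hmem : ∀ n ∈ s₂, n ≠ 0 ∧ f n ≠ 0 ∧ a < Real.log n ∧ Real.log n ≤ b := by
        intro n hn
        have h1 := Finset.mem_filter.1 hn
        have h2 := Finset.mem_filter.1 h1.1
        exact ⟨hsne n h2.1, (Finset.mem_filter.1 h2.1).2, not_le.1 h2.2, h1.2⟩
      have hterm : ∀ n ∈ s₂, G n ≤ A * (Real.log n / n) := fun n hn ↦
        (hG n (hmem n hn).1).trans (vonMangoldt_mid_le (hmem n hn).1 hσ)
      refine (Finset.sum_le_sum hterm).trans ?_
      rw [← Finset.mul_sum]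
      refine mul_le_mul_of_nonneg_left ?_ hA0.le
      have hgt : ∀ n ∈ s₂, Real.exp a < n := by
        intro n hn
        obtain ⟨h0, -, h2, -⟩ := hmem n hn
        rwa [← Real.lt_log_iff_exp_lt (by positivity)]
      refine (hZ s₂ (Real.exp a) (Real.one_le_exp (by positivity)) hgt ?_).trans ?_
      · intro n hn
        obtain ⟨h0, -, h2, h3⟩ := hmem n hn
        have hc := hcon n (hgt n hn).le (by
          rwa [← Real.log_le_iff_le_exp (by positivity)])
        have hp := card_primePow_not_prime_le (Nat.one_le_iff_ne_zero.2 h0)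
        have hsub : s₂.filter (· ≤ n) ⊆
            ((Finset.range (n + 1)).filter (fun p : ℕ ↦ p.Prime ∧ (p : ZMod l) = 1)) ∪
            ((Finset.range (n + 1)).filter (fun n : ℕ ↦ IsPrimePow n ∧ ¬ n.Prime)) := by
          intro m hm
          rw [Finset.mem_filter] at hm
          obtain ⟨-, hfm, -, -⟩ := hmem m hm.1
          have hm1 : (m : ZMod l) = 1 ∧ ArithmeticFunction.vonMangoldt m ≠ 0 := by
            simpa [hf, residueClass, Set.indicator_apply] using hfm
          have hpp := ArithmeticFunction.vonMangoldt_ne_zero_iff.1 hm1.2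
          simp only [Finset.mem_union, Finset.mem_filter, Finset.mem_range]
          have := hm.2
          by_cases hmp : m.Prime
          · exact Or.inl ⟨by omega, hmp, hm1.1⟩
          · exact Or.inr ⟨by omega, hpp, hmp⟩
        have := (Finset.card_le_card hsub).trans (Finset.card_union_le _ _)
        have : ((s₂.filter (· ≤ n)).card : ℝ) ≤ _ := Nat.cast_le.2 this
        push_cast at this
        linarith
      · rw [← Real.exp_mul, ha]
        have : 100 * Q * (-(1 / 10)) = -(10 * Q) := by ring
        rw [this]
        gcongr
    have h₃ : ∑ n ∈ s₃, G n ≤ A * (2 * Real.exp (4 * Q - k)) := by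
      have hmem : ∀ n ∈ s₃, n ≠ 0 ∧ b ≤ Real.log n := by
        intro n hn
        have h1 := Finset.mem_filter.1 hn
        have h2 := Finset.mem_filter.1 h1.1
        exact ⟨hsne n h2.1, (not_le.1 h1.2).le⟩
      refine (Finset.sum_le_sum fun n hn ↦ (hG n (hmem n hn).1).trans
        (vonMangoldt_tail_le (hmem n hn).1 hσ (hmem n hn).2)).trans ?_
      rw [← Finset.mul_sum, mul_assoc]
      refine mul_le_mul_of_nonneg_left ?_ hA0.le
      have hz := sum_rpow_le_norm_riemannZeta (show 0 < σ / 8 by positivity) s₃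
      have hz2 : ‖riemannZeta (1 + (σ / 8 : ℝ))‖ ≤ 2 * (8 / σ) := by
        have := H.zeta_le (1 + (σ / 8 : ℝ)) ?_ ?_
        · rw [add_sub_cancel_left, norm_mul, norm_real, Real.norm_of_nonneg (by positivity)] at this
          have h8 : σ / 8 * (8 / σ) = 1 := by field_simp
          have h9 : 0 < 8 / σ := by positivity
          calc ‖riemannZeta (1 + (σ / 8 : ℝ))‖ =
              (σ / 8 * ‖riemannZeta (1 + (σ / 8 : ℝ))‖) * (8 / σ) := by
                rw [mul_right_comm, h8, one_mul]
            _ ≤ _ := by gcongr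
        · rw [mem_ball, dist_eq, add_sub_cancel_left, norm_real, Real.norm_of_nonneg (by positivity)]
          have := H.σ_small
          linarith
        · simp [hσ.ne']
      have he : 2 ^ k * Real.exp (-(b * σ / 4)) ≤ Real.exp (-k) := by
        have e1 : b * σ / 4 = 2 * k := by rw [hb]; field_simp; ring
        have e2 : (2 : ℝ) ^ k ≤ Real.exp k := by
          have : Real.exp (k : ℝ) = Real.exp 1 ^ k := by rw [← Real.exp_nat_mul]; ring_nf
          rw [this]
          gcongr
          have := Real.exp_one_gt_d9
          linarith
        calc _ ≤ Real.exp k * Real.exp (-(b * σ / 4)) := by gcongr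
          _ = _ := by rw [← Real.exp_add, e1]; ring_nf
      have hi := H.inv_le
      calc _ ≤ Real.exp (-k) * Real.exp (2 * Q) * (2 * Real.exp (2 * Q)) := by
            refine mul_le_mul (by gcongr) (hz.trans (hz2.trans (by gcongr))) ?_ (by positivity)
            exact Finset.sum_nonneg fun n _ ↦ by positivity
        _ = 2 * (Real.exp (-k) * Real.exp (2 * Q) * Real.exp (2 * Q)) := by ring
        _ = _ := by rw [← Real.exp_add, ← Real.exp_add]; ring_nf
    change ∑ n ∈ Finset.range N, G n ≤ B
    rw [hsum, hsplit, hB]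
    linarith
  push_cast at hup
  set S := (LSeries (LSeries.logMul^[k] (fun n ↦ (f n : ℂ))) (1 + σ)).re
  have hl : (l : ℝ) * B ≥ k.factorial * (Real.exp (-(4 * Q)) / 8) / σ ^ (k + 1) :=
    hlow.trans (by gcongr)
  have hlt : (l : ℝ) * B < k.factorial * (Real.exp (-(4 * Q)) / 8) / σ ^ (k + 1) := by
    have e1 : k.factorial * (Real.exp (-(4 * Q)) / 8) / σ ^ (k + 1) =
        A * (Real.exp (-(4 * Q)) * (1 / σ) / 8) := by
      rw [hA, pow_succ]; field_simp
    have e2 : 1 / σ = 80000 * Q := by field_simp; linarith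
    have e3 : B ≤ A * ((3 + Q) * Real.exp (-(5 * Q))) := by
      rw [hB]
      have k1 : Real.exp (a - 6 * k) ≤ Real.exp (-(5 * Q)) := by
        rw [Real.exp_le_exp]; linarith
      have k2 : Real.exp (-(10 * Q)) ≤ Real.exp (-(5 * Q)) := by
        rw [Real.exp_le_exp]; linarith
      have k3 : Real.exp (4 * Q - k) ≤ Real.exp (-(5 * Q)) := by
        rw [Real.exp_le_exp]; linarith
      refine mul_le_mul_of_nonneg_left ?_ hA0.le
      nlinarith
    have e4 : Real.exp Q * Real.exp (-(5 * Q)) = Real.exp (-(4 * Q)) := by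
      rw [← Real.exp_add]; ring_nf
    calc (l : ℝ) * B ≤ Real.exp Q * (A * ((3 + Q) * Real.exp (-(5 * Q)))) := by
          have := H.level_le
          gcongr
      _ = A * (Real.exp (-(4 * Q)) * (3 + Q)) := by rw [← e4]; ring
      _ < A * (Real.exp (-(4 * Q)) * (10000 * Q)) := by
          gcongr
          linarith
      _ = _ := by rw [e1, e2]; ring
  linarith

/-- For every prime modulus `l ≤ exp Q`, there is a scale `Y` between `exp (100 Q)` and
`exp (C Q ^ 2)` up to which there are many primes congruent to `1` modulo `l`. -/
theorem exists_many_primes_eq_one : ∃ C Q₀ : ℝ, 0 < C ∧ ∀ Q : ℝ, Q₀ ≤ Q → ∀ l : ℕ, l.Prime →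
    (l : ℝ) ≤ Real.exp Q → ∃ Y : ℕ, Real.exp (100 * Q) ≤ Y ∧ Y ≤ Real.exp (C * Q ^ 2) ∧
      (Y : ℝ) ^ (3 / 4 : ℝ) ≤
        ((Finset.range (Y + 1)).filter (fun p : ℕ ↦ p.Prime ∧ (p : ZMod l) = 1)).card := by
  obtain ⟨Z, hZ0, hZ⟩ := exists_sum_log_div_le_of_sparse
  obtain ⟨η, hη0, hη1, hζ, htriv⟩ := exists_logDeriv_trivial_bounds
  refine ⟨640000 * 101, max (max 640000 Z) (32 / η), by norm_num, fun Q hQ l hl hlQ ↦ ?_⟩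
  have : Fact l.Prime := ⟨hl⟩
  simp only [max_le_iff] at hQ
  obtain ⟨⟨hQ1, hQZ⟩, hQη⟩ := hQ
  have hQ0 : 0 < Q := by linarith
  have hσ : 8 / (1 / (80000 * Q)) = 640000 * Q := by field_simp; norm_num
  have H : IsAdmissible l η (1 / (80000 * Q)) Q := by
    refine ⟨hζ, htriv l, by positivity, ?_, hη1, hlQ, ?_, ?_, hQη⟩
    · rw [div_le_iff₀ hη0] at hQη
      rw [← mul_div_assoc, div_le_iff₀ (by positivity)]
      nlinarith
    · rw [hσ, two_mul, Real.exp_add]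
      have := Real.add_one_le_exp Q
      gcongr <;> linarith
    · field_simp
  obtain ⟨Y, h1, h2, h3⟩ := H.exists_many_primes (by linarith) hQZ hZ (Nat.le_ceil (100 * Q))
  refine ⟨Y, h1, h2.trans ?_, h3⟩
  rw [Real.exp_le_exp]
  have hc := (Nat.ceil_lt_add_one (show 0 ≤ 100 * Q by positivity)).le
  have : 8 * (⌈100 * Q⌉₊ : ℝ) / (1 / (80000 * Q)) = 640000 * Q * ⌈100 * Q⌉₊ := by
    rw [← hσ]; ring
  rw [this]
  nlinarith

end

end

section

open Finset

lemma norm_sum_comp_sq_le {ι X : Type*} [Fintype X] [DecidableEq X] (A : Finset ι) (π : ι → X)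
    (Φ : X → ℂ) : ‖∑ a ∈ A, Φ (π a)‖ ^ 2 ≤
      (∑ a ∈ A, ∑ a' ∈ A, if π a = π a' then 1 else 0) * ∑ x, ‖Φ x‖ ^ 2 := by
  set r : X → ℝ := fun x ↦ ∑ a ∈ A, if π a = x then 1 else 0 with hr
  have hr0 : ∀ x, 0 ≤ r x := fun x ↦ sum_nonneg fun a _ ↦ by positivity
  have h1 : ∑ a ∈ A, Φ (π a) = ∑ x, (r x : ℂ) * Φ x := by
    simp only [hr, Complex.ofReal_sum, sum_mul]
    rw [sum_comm]
    refine sum_congr rfl fun a _ ↦ ?_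
    rw [sum_eq_single (π a)] <;> simp +contextual [eq_comm]
  have h2 : ‖∑ a ∈ A, Φ (π a)‖ ≤ ∑ x, r x * ‖Φ x‖ := by
    rw [h1]
    refine (norm_sum_le _ _).trans (sum_le_sum fun x _ ↦ ?_)
    rw [norm_mul, Complex.norm_real, Real.norm_of_nonneg (hr0 x)]
  have h3 : ∑ x, r x ^ 2 = ∑ a ∈ A, ∑ a' ∈ A, if π a = π a' then 1 else 0 := by
    simp only [hr, pow_two, sum_mul_sum]
    rw [sum_comm]
    refine sum_congr rfl fun a _ ↦ ?_
    rw [sum_comm]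
    refine sum_congr rfl fun a' _ ↦ ?_
    rw [sum_eq_single (π a)]
    · simp [eq_comm]
    · simp +contextual [eq_comm]
    · simp
  calc _ ≤ (∑ x, r x * ‖Φ x‖) ^ 2 := by gcongr
    _ ≤ (∑ x, r x ^ 2) * ∑ x, ‖Φ x‖ ^ 2 := sum_mul_sq_le_sq_mul_sq _ _ _
    _ = _ := by rw [h3]

lemma norm_sum_mulChar_shift_le {p : ℕ} [Fact p.Prime] {χ : DirichletCharacter ℂ p} (hχ : χ ≠ 1)
    (b b' : ZMod p) : ‖∑ u, χ (u + b) * star (χ (u + b'))‖ ≤ if b = b' then (p : ℝ) else 1 := by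
  split_ifs with h
  · refine (norm_sum_le _ _).trans ?_
    calc ∑ u : ZMod p, ‖χ (u + b) * star (χ (u + b'))‖ ≤ ∑ u : ZMod p, (1 : ℝ) := by
          refine sum_le_sum fun u _ ↦ ?_
          rw [norm_mul, norm_star]
          exact mul_le_one₀ (χ.norm_le_one _) (norm_nonneg _) (χ.norm_le_one _)
      _ = p := by simp [ZMod.card]
  · have hd : b - b' ≠ 0 := sub_ne_zero.2 h
    have e : ∑ u, χ (u + b) * star (χ (u + b')) = χ⁻¹ (-1) * jacobiSum χ χ⁻¹ := by
      rw [jacobiSum, mul_sum]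
      refine Fintype.sum_bijective (fun u ↦ (u + b) / (b - b'))
        ⟨fun u v huv ↦ ?_, fun v ↦ ⟨v * (b - b') - b, ?_⟩⟩ _ _ fun u ↦ ?_
      · exact add_right_cancel ((div_left_inj' hd).1 huv)
      · field_simp; ring
      · rw [MulChar.star_apply']
        have e1 : u + b = (b - b') * ((u + b) / (b - b')) := by field_simp
        have e2 : u + b' = (b - b') * (-1 * (1 - (u + b) / (b - b'))) := by field_simp; ring
        have e3 : χ (b - b') * χ⁻¹ (b - b') = 1 := by
          rw [← MulChar.mul_apply, mul_inv_cancel, MulChar.one_apply (isUnit_iff_ne_zero.2 hd)]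
        rw [e2, map_mul χ⁻¹, map_mul χ⁻¹]
        have e4 : χ (u + b) = χ (b - b') * χ ((u + b) / (b - b')) := by rw [← map_mul, ← e1]
        rw [e4]
        linear_combination (χ ((u + b) / (b - b')) * (χ⁻¹ (-1) *
          χ⁻¹ (1 - (u + b) / (b - b')))) * e3
    rw [e, jacobiSum_nontrivial_inv hχ, norm_mul, norm_neg]
    exact mul_le_one₀ (DirichletCharacter.norm_le_one _ _) (norm_nonneg _)
      (DirichletCharacter.norm_le_one _ _)

lemma norm_sum_mulChar_mul_star_sq_le {p q : ℕ} [Fact p.Prime] [Fact q.Prime]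
    {χ : DirichletCharacter ℂ p} {ψ : DirichletCharacter ℂ q} (hχ : χ ≠ 1) (hψ : ψ ≠ 1) (c : ℕ)
    (A B : Finset ℕ) :
    ‖∑ a ∈ A, ∑ b ∈ B, χ ((c + a + b : ℕ) : ZMod p) * star (ψ ((c + a + b : ℕ) : ZMod q))‖ ^ 2 ≤
      (∑ a ∈ A, ∑ a' ∈ A, (if (a : ZMod p) = a' then 1 else 0) *
        (if (a : ZMod q) = a' then 1 else 0)) *
      ∑ b ∈ B, ∑ b' ∈ B, (if (b : ZMod p) = b' then (p : ℝ) else 1) *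
        (if (b : ZMod q) = b' then (q : ℝ) else 1) := by
  set Φ : ZMod p × ZMod q → ℂ := fun x ↦ ∑ b ∈ B, χ (x.1 + b) * star (ψ (x.2 + b)) with hΦ
  set π : ℕ → ZMod p × ZMod q := fun a ↦ (((c + a : ℕ) : ZMod p), ((c + a : ℕ) : ZMod q)) with hπ
  have h1 := norm_sum_comp_sq_le A π Φ
  have e1 : ∑ a ∈ A, Φ (π a) = ∑ a ∈ A, ∑ b ∈ B, χ ((c + a + b : ℕ) : ZMod p) *
      star (ψ ((c + a + b : ℕ) : ZMod q)) := by
    simp [hΦ, hπ]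
  have e2 : (∑ a ∈ A, ∑ a' ∈ A, if π a = π a' then (1 : ℝ) else 0) =
      ∑ a ∈ A, ∑ a' ∈ A, (if (a : ZMod p) = a' then 1 else 0) *
        (if (a : ZMod q) = a' then 1 else 0) := by
    refine sum_congr rfl fun a _ ↦ sum_congr rfl fun a' _ ↦ ?_
    by_cases h1 : (a : ZMod p) = a' <;> by_cases h2 : (a : ZMod q) = a' <;> simp [hπ, h1, h2]
  rw [e1, e2] at h1
  refine h1.trans (mul_le_mul_of_nonneg_left ?_ ?_)
  · have e3 : ((∑ x, ‖Φ x‖ ^ 2 : ℝ) : ℂ) = ∑ b ∈ B, ∑ b' ∈ B,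
        (∑ u : ZMod p, χ (u + b) * star (χ (u + b'))) *
        star (∑ v : ZMod q, ψ (v + b) * star (ψ (v + b'))) := by
      push_cast
      calc ∑ x, (‖Φ x‖ : ℂ) ^ 2 = ∑ x : ZMod p × ZMod q, ∑ b ∈ B, ∑ b' ∈ B,
          (χ (x.1 + b) * star (χ (x.1 + b'))) * (star (ψ (x.2 + b) * star (ψ (x.2 + b')))) := by
            refine sum_congr rfl fun x _ ↦ ?_
            rw [← Complex.mul_conj', hΦ, map_sum, sum_mul_sum]
            refine sum_congr rfl fun b _ ↦ sum_congr rfl fun b' _ ↦ ?_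
            simp only [map_mul, star_mul', star_star, starRingEnd_apply]
            ring
        _ = _ := by
            rw [sum_comm]
            refine sum_congr rfl fun b _ ↦ ?_
            rw [sum_comm]
            refine sum_congr rfl fun b' _ ↦ ?_
            rw [star_sum, sum_mul_sum, ← univ_product_univ, sum_product]
    have e4 : ∑ x, ‖Φ x‖ ^ 2 = ‖((∑ x, ‖Φ x‖ ^ 2 : ℝ) : ℂ)‖ := by
      rw [Complex.norm_real, Real.norm_of_nonneg]
      positivity
    rw [e4, e3]
    refine (norm_sum_le _ _).trans (sum_le_sum fun b _ ↦ (norm_sum_le _ _).trans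
      (sum_le_sum fun b' _ ↦ ?_))
    rw [norm_mul, norm_star]
    exact mul_le_mul (norm_sum_mulChar_shift_le hχ _ _) (norm_sum_mulChar_shift_le hψ _ _)
      (norm_nonneg _) (by positivity)
  · exact sum_nonneg fun a _ ↦ sum_nonneg fun a' _ ↦ by positivity

end

section

open Finset

lemma card_filter_dvd_le {P : Finset ℕ} (hP : ∀ p ∈ P, p.Prime) {n w : ℕ} (hn : n ≠ 0)
    (hw : n < 2 ^ w) : (P.filter (· ∣ n)).card ≤ w := by
  have h1 : ∏ p ∈ P.filter (· ∣ n), p ∣ n :=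
    prod_primes_dvd n (fun p hp ↦ (hP p (mem_filter.1 hp).1).prime)
      fun p hp ↦ (mem_filter.1 hp).2
  have h2 : 2 ^ (P.filter (· ∣ n)).card ≤ ∏ p ∈ P.filter (· ∣ n), p :=
    pow_card_le_prod _ _ _ fun p hp ↦ (hP p (mem_filter.1 hp).1).two_le
  exact ((Nat.pow_lt_pow_iff_right (by norm_num)).1
    ((h2.trans (Nat.le_of_dvd (Nat.pos_of_ne_zero hn) h1)).trans_lt hw)).le

lemma card_filter_zmod_eq_le {P : Finset ℕ} (hP : ∀ p ∈ P, p.Prime) {a b w : ℕ} (hab : a ≠ b)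
    (ha : a < 2 ^ w) (hb : b < 2 ^ w) : (P.filter (fun p ↦ (a : ZMod p) = b)).card ≤ w := by
  refine le_trans (card_le_card fun p hp ↦ ?_)
    (card_filter_dvd_le hP (n := ((a : ℤ) - b).natAbs) (w := w) (by omega) (by omega))
  rw [mem_filter] at hp ⊢
  refine ⟨hp.1, ?_⟩
  rw [← Int.natCast_dvd_natCast, Int.dvd_natAbs, ← ZMod.intCast_zmod_eq_zero_iff_dvd]
  push_cast
  rw [hp.2, sub_self]

lemma sum_sum_sq_le (S : Finset ℕ) (f : ℕ → ℕ → ℝ) {D W R : ℝ}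
    (hf0 : ∀ b ∈ S, ∀ b' ∈ S, 0 ≤ f b b')
    (hf : ∀ b ∈ S, ∀ b' ∈ S, f b b' ≤ if b = b' then D else W) (hD : D ^ 2 ≤ R ^ 2 * S.card) :
    ∑ b ∈ S, ∑ b' ∈ S, f b b' ^ 2 ≤ (R ^ 2 + W ^ 2) * (S.card : ℝ) ^ 2 := by
  calc ∑ b ∈ S, ∑ b' ∈ S, f b b' ^ 2 ≤
      ∑ b ∈ S, ∑ b' ∈ S, ((if b = b' then D ^ 2 else 0) + W ^ 2) := by
        refine sum_le_sum fun b hb ↦ sum_le_sum fun b' hb' ↦ ?_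
        have h0 := hf0 b hb b' hb'
        have h1 := hf b hb b' hb'
        split_ifs at h1 ⊢ <;> nlinarith
    _ = D ^ 2 * S.card + S.card ^ 2 * W ^ 2 := by
        simp only [sum_add_distrib, sum_ite_eq, sum_const, nsmul_eq_mul]
        rw [sum_congr rfl fun b hb ↦ if_pos hb, sum_const, nsmul_eq_mul]
        ring
    _ ≤ _ := by nlinarith [(S.card.cast_nonneg : (0 : ℝ) ≤ S.card)]

lemma exists_dirichletCharacter_pow_eq_one {l p : ℕ} (hl : l.Prime) (hp : p.Prime)
    (hpl : (p : ZMod l) = 1) : ∃ χ : DirichletCharacter ℂ p, χ ≠ 1 ∧ χ ^ l = 1 := by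
  have : Fact p.Prime := ⟨hp⟩
  have hdvd : l ∣ Fintype.card (ZMod p) - 1 := by
    rw [ZMod.card, ← CharP.cast_eq_zero_iff (ZMod l) l, Nat.cast_sub hp.one_le, hpl]
    simp
  obtain ⟨χ, hχ⟩ := MulChar.exists_mulChar_orderOf (ZMod p) hdvd
    (Complex.isPrimitiveRoot_exp l hl.ne_zero)
  refine ⟨χ, ?_, by rw [← hχ, pow_orderOf_eq_one]⟩
  rintro rfl
  rw [orderOf_one] at hχ
  exact hl.one_lt.ne hχ

theorem card_filter_isPow_mul_le {l w Y c : ℕ} (hl : l.Prime) (P A B : Finset ℕ)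
    (hP : ∀ p ∈ P, p.Prime ∧ (p : ZMod l) = 1 ∧ p ≤ Y) (hA : Y ^ 2 ≤ A.card) (hB : Y ^ 2 ≤ B.card)
    (hY : 1 ≤ Y) (hlt : ∀ a ∈ A, ∀ b ∈ B, c + a + b < 2 ^ w)
    (hpos : ∀ a ∈ A, ∀ b ∈ B, c + a + b ≠ 0) (hw : 1 ≤ w) (hwP : 2 * w ≤ P.card)
    {E : Finset (ℕ × ℕ)} (hE : E ⊆ A ×ˢ B) (hpow : ∀ x ∈ E, ∃ y, c + x.1 + x.2 = y ^ l) :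
    (E.card : ℝ) * (P.card : ℝ) ^ 2 ≤
      16 * w ^ 2 * Y * (A.card * B.card) := by
  have hprime : ∀ p ∈ P, p.Prime := fun p hp ↦ (hP p hp).1
  have hχ : ∀ p, ∃ χ : DirichletCharacter ℂ p, p ∈ P → χ ≠ 1 ∧ χ ^ l = 1 := by
    intro p
    by_cases hp : p ∈ P
    · obtain ⟨χ, h⟩ := exists_dirichletCharacter_pow_eq_one hl (hP p hp).1 (hP p hp).2.1
      exact ⟨χ, fun _ ↦ h⟩
    · exact ⟨1, fun h ↦ absurd h hp⟩
  choose χ hχ using hχ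
  set W : ℕ → ℂ := fun s ↦ ∑ p ∈ P, χ p (s : ZMod p) with hW
  have hYR : (1 : ℝ) ≤ Y := by exact_mod_cast hY
  have hwR : (1 : ℝ) ≤ w := by exact_mod_cast hw
  have hAR : (Y : ℝ) ^ 2 ≤ A.card := by exact_mod_cast hA
  have hBR : (Y : ℝ) ^ 2 ≤ B.card := by exact_mod_cast hB
  have hPcard : P.card ≤ Y := by
    have : P ⊆ Icc 1 Y := fun p hp ↦ mem_Icc.2 ⟨(hprime p hp).one_le, (hP p hp).2.2⟩
    simpa using card_le_card this
  have hPR : (P.card : ℝ) ≤ Y := by exact_mod_cast hPcard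
  have hAne : A.Nonempty := card_pos.1 (lt_of_lt_of_le (by positivity) hA)
  have hBne : B.Nonempty := card_pos.1 (lt_of_lt_of_le (by positivity) hB)
  have hAlt : ∀ a ∈ A, a < 2 ^ w := fun a ha ↦ by
    obtain ⟨b, hb⟩ := hBne
    have := hlt a ha b hb
    omega
  have hBlt : ∀ b ∈ B, b < 2 ^ w := fun b hb ↦ by
    obtain ⟨a, ha⟩ := hAne
    have := hlt a ha b hb
    omega
  have hlarge : ∀ s, s ≠ 0 → s < 2 ^ w → (∃ y, s = y ^ l) → (P.card : ℝ) / 2 ≤ ‖W s‖ := by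
    rintro s hs0 hs ⟨y, rfl⟩
    have hval : ∀ p ∈ P, χ p ((y ^ l : ℕ) : ZMod p) = if p ∣ y ^ l then 0 else 1 := by
      intro p hp
      have : Fact p.Prime := ⟨hprime p hp⟩
      split_ifs with h
      · rw [(CharP.cast_eq_zero_iff (ZMod p) p _).2 h]
        exact MulChar.map_nonunit _ not_isUnit_zero
      · have hy : (y : ZMod p) ≠ 0 := by
          rw [Ne, CharP.cast_eq_zero_iff (ZMod p) p]
          exact fun h' ↦ h (dvd_pow h' hl.ne_zero)
        rw [Nat.cast_pow, map_pow, ← MulChar.pow_apply' _ hl.ne_zero, (hχ p hp).2,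
          MulChar.one_apply (isUnit_iff_ne_zero.2 hy)]
    have hWs : W (y ^ l) = ((P.filter (fun p ↦ ¬ p ∣ y ^ l)).card : ℂ) := by
      rw [hW]
      simp only
      rw [sum_congr rfl hval, sum_ite]
      simp
    rw [hWs, Complex.norm_natCast]
    have h1 := card_filter_dvd_le hprime hs0 hs
    have h2 := card_filter_add_card_filter_not (s := P) (fun p ↦ p ∣ y ^ l)
    have h3 : P.card ≤ 2 * (P.filter (fun p ↦ ¬ p ∣ y ^ l)).card := by omega
    have : (P.card : ℝ) ≤ 2 * (P.filter (fun p ↦ ¬ p ∣ y ^ l)).card := by exact_mod_cast h3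
    linarith
  set T : ℕ → ℕ → ℝ := fun p q ↦ ∑ a ∈ A, ∑ a' ∈ A, (if (a : ZMod p) = a' then (1 : ℝ) else 0) *
        (if (a : ZMod q) = a' then 1 else 0) with hT
  set G : ℕ → ℕ → ℝ := fun p q ↦ ∑ b ∈ B, ∑ b' ∈ B, (if (b : ZMod p) = b' then (p : ℝ) else 1) *
        (if (b : ZMod q) = b' then (q : ℝ) else 1) with hG
  have hT0 : ∀ p q, 0 ≤ T p q := fun p q ↦ sum_nonneg fun _ _ ↦ sum_nonneg fun _ _ ↦ by positivity
  have hG0 : ∀ p q, 0 ≤ G p q := fun p q ↦ sum_nonneg fun _ _ ↦ sum_nonneg fun _ _ ↦ by positivity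
  have swap : ∀ (S : Finset ℕ) (f : ℕ → ℕ → ℕ → ℝ),
      ∑ x ∈ P ×ˢ P, ∑ a ∈ S, ∑ a' ∈ S, f x.1 a a' * f x.2 a a' =
      ∑ a ∈ S, ∑ a' ∈ S, (∑ p ∈ P, f p a a') ^ 2 := by
    intro S f
    rw [sum_comm]
    refine sum_congr rfl fun a _ ↦ ?_
    rw [sum_comm]
    refine sum_congr rfl fun a' _ ↦ ?_
    rw [pow_two, sum_mul_sum, sum_product]
  have hTsum : ∑ x ∈ P ×ˢ P, T x.1 x.2 ≤ (1 ^ 2 + (w : ℝ) ^ 2) * (A.card : ℝ) ^ 2 := by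
    simp only [hT]
    rw [swap A (fun p a a' ↦ if (a : ZMod p) = a' then (1 : ℝ) else 0)]
    refine sum_sum_sq_le A _ (D := P.card) (fun b _ b' _ ↦ sum_nonneg fun _ _ ↦ by positivity)
      (fun a ha a' ha' ↦ ?_) ?_
    · rw [sum_boole]
      split_ifs with h
      · exact_mod_cast card_filter_le _ _
      · exact_mod_cast card_filter_zmod_eq_le hprime h (hAlt a ha) (hAlt a' ha')
    · calc (P.card : ℝ) ^ 2 ≤ (Y : ℝ) ^ 2 := by gcongr
        _ ≤ _ := by linarith
  have hGsum : ∑ x ∈ P ×ˢ P, G x.1 x.2 ≤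
      ((Y : ℝ) ^ 2 + (Y + w * Y : ℝ) ^ 2) * (B.card : ℝ) ^ 2 := by
    simp only [hG]
    rw [swap B (fun p b b' ↦ if (b : ZMod p) = b' then (p : ℝ) else 1)]
    refine sum_sum_sq_le B _ (D := (Y : ℝ) ^ 2)
      (fun b _ b' _ ↦ sum_nonneg fun _ _ ↦ by positivity) (fun b hb b' hb' ↦ ?_) ?_
    · split_ifs with h
      · calc _ ≤ ∑ p ∈ P, (Y : ℝ) := by
              refine sum_le_sum fun p hp ↦ ?_
              have : (p : ℝ) ≤ Y := by exact_mod_cast (hP p hp).2.2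
              split_ifs <;> linarith
          _ = P.card * Y := by simp
          _ ≤ _ := by nlinarith
      · calc _ ≤ ∑ p ∈ P, (1 + Y * (if (b : ZMod p) = b' then (1 : ℝ) else 0)) := by
              refine sum_le_sum fun p hp ↦ ?_
              have : (p : ℝ) ≤ Y := by exact_mod_cast (hP p hp).2.2
              split_ifs <;> linarith
          _ = P.card + Y * (P.filter (fun p ↦ (b : ZMod p) = b')).card := by
              rw [sum_add_distrib, ← mul_sum, sum_boole]; simp
          _ ≤ _ := by
              have : ((P.filter (fun p ↦ (b : ZMod p) = b')).card : ℝ) ≤ w := by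
                exact_mod_cast card_filter_zmod_eq_le hprime h (hBlt b hb) (hBlt b' hb')
              nlinarith
    · nlinarith [sq_nonneg (Y : ℝ)]
  have hsecond : ∑ x ∈ A ×ˢ B, ‖W (c + x.1 + x.2)‖ ^ 2 ≤ 4 * w ^ 2 * Y * (A.card * B.card) := by
    have e1 : ((∑ x ∈ A ×ˢ B, ‖W (c + x.1 + x.2)‖ ^ 2 : ℝ) : ℂ) = ∑ y ∈ P ×ˢ P, ∑ a ∈ A, ∑ b ∈ B,
        χ y.1 ((c + a + b : ℕ) : ZMod y.1) * star (χ y.2 ((c + a + b : ℕ) : ZMod y.2)) := by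
      push_cast
      simp_rw [← sum_product' A B]
      rw [sum_comm]
      refine sum_congr rfl fun x _ ↦ ?_
      rw [← Complex.mul_conj', hW]
      simp only
      rw [map_sum, sum_mul_sum, ← sum_product']
      push_cast
      rfl
    have e2 : ∑ x ∈ A ×ˢ B, ‖W (c + x.1 + x.2)‖ ^ 2 =
        ‖((∑ x ∈ A ×ˢ B, ‖W (c + x.1 + x.2)‖ ^ 2 : ℝ) : ℂ)‖ := by
      rw [Complex.norm_real, Real.norm_of_nonneg]
      positivity
    rw [e2, e1]
    calc _ ≤ ∑ y ∈ P ×ˢ P, √(T y.1 y.2) * √(G y.1 y.2) := by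
          refine (norm_sum_le _ _).trans (sum_le_sum fun y hy ↦ ?_)
          rw [mem_product] at hy
          have : Fact y.1.Prime := ⟨hprime _ hy.1⟩
          have : Fact y.2.Prime := ⟨hprime _ hy.2⟩
          rw [← Real.sqrt_mul (hT0 _ _)]
          exact Real.le_sqrt_of_sq_le
            (norm_sum_mulChar_mul_star_sq_le (hχ _ hy.1).1 (hχ _ hy.2).1 c A B)
      _ ≤ √(∑ y ∈ P ×ˢ P, T y.1 y.2) * √(∑ y ∈ P ×ˢ P, G y.1 y.2) :=
          Real.sum_sqrt_mul_sqrt_le _ (fun _ ↦ hT0 _ _) fun _ ↦ hG0 _ _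
      _ ≤ √((1 ^ 2 + (w : ℝ) ^ 2) * (A.card : ℝ) ^ 2) *
          √(((Y : ℝ) ^ 2 + (Y + w * Y : ℝ) ^ 2) * (B.card : ℝ) ^ 2) := by gcongr
      _ ≤ (3 / 2 * w * A.card) * (5 / 2 * w * Y * B.card) := by
          gcongr
          · apply Real.sqrt_le_iff.2 ⟨by positivity, ?_⟩
            rw [mul_pow]
            gcongr
            nlinarith
          · apply Real.sqrt_le_iff.2 ⟨by positivity, ?_⟩
            rw [mul_pow]
            gcongr
            have : (Y : ℝ) ^ 2 + (Y + w * Y : ℝ) ^ 2 = Y ^ 2 * (1 + (1 + w) ^ 2) := by ring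
            rw [this, mul_pow, mul_comm]
            gcongr
            nlinarith
      _ ≤ _ := by
          have : (0 : ℝ) ≤ w ^ 2 * Y * (A.card * B.card) := by positivity
          nlinarith
  have hfirst : (E.card : ℝ) * ((P.card : ℝ) / 2) ^ 2 ≤ ∑ x ∈ A ×ˢ B, ‖W (c + x.1 + x.2)‖ ^ 2 := by
    rw [← nsmul_eq_mul, ← sum_const]
    refine le_trans (sum_le_sum fun x hx ↦ ?_)
      (sum_le_sum_of_subset_of_nonneg hE fun _ _ _ ↦ by positivity)
    have hx' := mem_product.1 (hE hx)
    have := hlarge _ (hpos _ hx'.1 _ hx'.2) (hlt _ hx'.1 _ hx'.2) (hpow x hx)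
    gcongr
  linarith

end

section

open Finset

/-- Two large sets of integers cannot have all their pairwise sums equal to pure powers. -/
theorem exists_card_lt_of_forall_add_isPurePower : ∃ C : ℝ, 0 < C ∧ ∃ w₀ : ℝ, ∀ w : ℕ, w₀ ≤ w →
    ∀ A B : Finset ℕ, (∀ a ∈ A, ∀ b ∈ B, 2 ≤ a + b ∧ a + b < 2 ^ w ∧ IsPurePower (a + b)) →
      (A.card : ℝ) < Real.exp (C * Real.log w ^ 2) ∨
      (B.card : ℝ) < Real.exp (C * Real.log w ^ 2) := by
  obtain ⟨C, Q₀, hC, h⟩ := exists_many_primes_eq_one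
  refine ⟨2 * C, by positivity, max 2 (Real.exp Q₀), fun w hw A B hAB ↦ ?_⟩
  rw [max_le_iff] at hw
  have hw0 : (0 : ℝ) < w := by linarith
  by_contra! hcon
  obtain ⟨hA, hB⟩ := hcon
  have hApos : (0 : ℝ) < A.card := (Real.exp_pos _).trans_le hA
  have hBpos : (0 : ℝ) < B.card := (Real.exp_pos _).trans_le hB
  classical
  set E : ℕ → Finset (ℕ × ℕ) := fun l ↦ (A ×ˢ B).filter (fun x ↦ ∃ y, x.1 + x.2 = y ^ l) with hE
  have hcover : A ×ˢ B ⊆ ((range w).filter Nat.Prime).biUnion E := by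
    intro x hx
    obtain ⟨h1, h2, h3⟩ := hAB _ (mem_product.1 hx).1 _ (mem_product.1 hx).2
    obtain ⟨l, hl, hlw, y, -, hy⟩ := h3.exists_prime h1 h2
    rw [mem_biUnion]
    exact ⟨l, by simp [hl, hlw], mem_filter.2 ⟨hx, y, hy⟩⟩
  have hEl : ∀ l ∈ (range w).filter Nat.Prime,
      ((E l).card : ℝ) * (w : ℝ) ^ 2 ≤ A.card * B.card := by
    intro l hl
    rw [mem_filter, mem_range] at hl
    obtain ⟨Y, hY1, hY2, hY3⟩ := h (Real.log w)
      ((Real.le_log_iff_exp_le hw0).2 hw.2) l hl.2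
      (by rw [Real.exp_log hw0]; exact_mod_cast hl.1.le)
    set P := (range (Y + 1)).filter (fun p : ℕ ↦ p.Prime ∧ (p : ZMod l) = 1) with hP
    have hYw : (w : ℝ) ^ 100 ≤ Y := by
      refine le_trans (le_of_eq ?_) hY1
      rw [mul_comm, Real.exp_mul, Real.exp_log hw0]
      norm_cast
    have hw1 : (1 : ℝ) ≤ w := by linarith
    have hY0 : (1 : ℝ) ≤ Y := (one_le_pow₀ hw1).trans hYw
    have hsq : ((Y : ℝ) ^ 2) ≤ Real.exp (2 * C * Real.log w ^ 2) := by
      calc (Y : ℝ) ^ 2 ≤ Real.exp (C * Real.log w ^ 2) ^ 2 := by gcongr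
        _ = _ := by rw [← Real.exp_nat_mul]; push_cast; ring_nf
    have hYhalf : (w : ℝ) ^ 50 ≤ (Y : ℝ) ^ (1 / 2 : ℝ) := by
      rw [← Real.sqrt_eq_rpow]
      apply Real.le_sqrt_of_sq_le
      rw [← pow_mul]
      exact hYw
    have hpow2 : ∀ k, (2 : ℝ) ^ k ≤ (w : ℝ) ^ k := fun k ↦ by gcongr; exact hw.1
    have hPsq : (Y : ℝ) * (w : ℝ) ^ 50 ≤ (P.card : ℝ) ^ 2 := by
      calc (Y : ℝ) * (w : ℝ) ^ 50 ≤ (Y : ℝ) ^ (1 : ℝ) * (Y : ℝ) ^ (1 / 2 : ℝ) := by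
            rw [Real.rpow_one]; gcongr
        _ = ((Y : ℝ) ^ (3 / 4 : ℝ)) ^ 2 := by
            rw [← Real.rpow_add (by positivity), ← Real.rpow_natCast, ← Real.rpow_mul (by positivity)]
            norm_num
        _ ≤ _ := by gcongr
    have hwP : 2 * w ≤ P.card := by
      have : (w : ℝ) ^ 50 ≤ P.card := by
        refine hYhalf.trans (le_trans ?_ hY3)
        exact Real.rpow_le_rpow_of_exponent_le hY0 (by norm_num)
      have h2 : (2 : ℝ) * w ≤ (w : ℝ) ^ 50 := by
        have : (2 : ℝ) ^ 49 ≤ (w : ℝ) ^ 49 := hpow2 49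
        calc (2 : ℝ) * w ≤ (w : ℝ) ^ 49 * w := by gcongr; linarith
          _ = _ := by ring
      exact_mod_cast h2.trans this
    have key := card_filter_isPow_mul_le (c := 0) (w := w) (Y := Y) hl.2 P A B
      (fun p hp ↦ by
        rw [hP, mem_filter, mem_range] at hp
        exact ⟨hp.2.1, hp.2.2, by omega⟩)
      (by exact_mod_cast hsq.trans hA) (by exact_mod_cast hsq.trans hB) (by exact_mod_cast hY0)
      (fun a ha b hb ↦ by rw [zero_add]; exact (hAB a ha b hb).2.1)
      (fun a ha b hb ↦ by have := (hAB a ha b hb).1; omega) (by exact_mod_cast hw1) hwP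
      (E := E l) (filter_subset _ _) (fun x hx ↦ by rw [zero_add]; exact (mem_filter.1 hx).2)
    have h16 : (16 : ℝ) * w ^ 4 ≤ (w : ℝ) ^ 50 := by
      have : (2 : ℝ) ^ 46 ≤ (w : ℝ) ^ 46 := hpow2 46
      calc (16 : ℝ) * w ^ 4 ≤ w ^ 46 * w ^ 4 := by gcongr; linarith
        _ = _ := by ring
    have h3 : ((E l).card : ℝ) * (Y * (16 * w ^ 4)) ≤ 16 * w ^ 2 * Y * (A.card * B.card) := by
      refine le_trans ?_ key
      gcongr
      refine le_trans ?_ hPsq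
      gcongr
    have h4 : 0 < 16 * (w : ℝ) ^ 2 * Y := by positivity
    refine le_of_mul_le_mul_left ?_ h4
    linarith
  have hcard : (A.card * B.card : ℝ) ≤ ∑ l ∈ (range w).filter Nat.Prime, ((E l).card : ℝ) := by
    have := (card_le_card hcover).trans card_biUnion_le
    rw [card_product] at this
    exact_mod_cast this
  have hlast : (A.card * B.card : ℝ) * w ^ 2 ≤ w * (A.card * B.card) := by
    calc (A.card * B.card : ℝ) * w ^ 2 ≤
        (∑ l ∈ (range w).filter Nat.Prime, ((E l).card : ℝ)) * w ^ 2 := by gcongr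
      _ ≤ ∑ l ∈ (range w).filter Nat.Prime, (A.card * B.card : ℝ) := by
          rw [sum_mul]; exact sum_le_sum hEl
      _ = ((range w).filter Nat.Prime).card * (A.card * B.card : ℝ) := by
          rw [sum_const, nsmul_eq_mul]
      _ ≤ _ := by
          gcongr
          exact (card_filter_le _ _).trans (card_range w).le
  have hAB0 : (0 : ℝ) < A.card * B.card := by positivity
  nlinarith [mul_pos hAB0 hw0]

end

section

open Finset

/-- If all `i * m` with `1 ≤ i ≤ k` are pure powers then `m` is doubly exponentially large in
`π(k)`. -/
theorem two_pow_card_primes_le {m k w : ℕ} (hm : m ≠ 0) (hk : 2 ≤ k)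
    (h : ∀ i, 1 ≤ i → i ≤ k → i * m < 2 ^ w ∧ IsPurePower (i * m)) :
    2 ^ (((range (k + 1)).filter Nat.Prime).erase 2).card ≤ w := by
  have hex : ∀ q, ∃ l, q.Prime → q ≤ k → l.Prime ∧ l ∣ m.factorization q + 1 ∧
      ∀ r, r.Prime → r ≠ q → l ∣ m.factorization r := by
    intro q
    by_cases hq : q.Prime ∧ q ≤ k
    · obtain ⟨h1, h2⟩ := h q hq.1.one_le hq.2
      obtain ⟨l, hl, -, x, -, hx⟩ := h2.exists_prime
        (hq.1.two_le.trans (Nat.le_mul_of_pos_right q (Nat.pos_of_ne_zero hm))) h1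
      have hv : ∀ r, l ∣ (q * m).factorization r := by
        intro r
        rw [hx, Nat.factorization_pow]
        exact Dvd.intro _ rfl
      rw [Nat.factorization_mul hq.1.ne_zero hm] at hv
      refine ⟨l, fun _ _ ↦ ⟨hl, ?_, fun r hr hrq ↦ ?_⟩⟩
      · have := hv q
        rwa [Finsupp.add_apply, hq.1.factorization_self, add_comm] at this
      · have := hv r
        rwa [Finsupp.add_apply, hq.1.factorization, Finsupp.single_eq_of_ne hrq, zero_add] at this
    · exact ⟨2, fun h1 h2 ↦ absurd ⟨h1, h2⟩ hq⟩
  choose l hl using hex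
  set S := ((range (k + 1)).filter Nat.Prime).erase 2 with hS
  have hmem : ∀ q ∈ S, q.Prime ∧ q ≤ k ∧ q ≠ 2 := by
    intro q hq
    simp only [hS, mem_erase, mem_filter, mem_range] at hq
    exact ⟨hq.2.2, by omega, hq.1⟩
  have hinj : Set.InjOn l S := by
    intro q hq r hr hqr
    by_contra hne
    have h1 := hl q (hmem q hq).1 (hmem q hq).2.1
    have h2 := (hl r (hmem r hr).1 (hmem r hr).2.1).2.2 q (hmem q hq).1 hne
    rw [← hqr] at h2
    exact h1.1.one_lt.ne' (Nat.dvd_one.1 ((Nat.dvd_add_right h2).1 h1.2.1))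
  have hdvd : ∏ p ∈ S.image l, p ∣ m.factorization 2 := by
    refine prod_primes_dvd _ (fun p hp ↦ ?_) fun p hp ↦ ?_ <;>
      obtain ⟨q, hq, rfl⟩ := mem_image.1 hp <;>
      obtain ⟨h1, h2, h3⟩ := hmem q hq
    · exact (hl q h1 h2).1.prime
    · exact (hl q h1 h2).2.2 2 Nat.prime_two h3.symm
  have hpos : m.factorization 2 ≠ 0 := by
    intro h0
    have h2 := hl 2 Nat.prime_two hk
    rw [h0, zero_add] at h2
    exact h2.1.one_lt.ne' (Nat.dvd_one.1 h2.2.1)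
  have hle : m.factorization 2 ≤ w := by
    have h1 := Nat.ordProj_le 2 hm
    have h2 := (h 1 le_rfl (by omega)).1
    rw [one_mul] at h2
    exact ((Nat.pow_lt_pow_iff_right (by norm_num)).1 (h1.trans_lt h2)).le
  calc 2 ^ S.card = 2 ^ (S.image l).card := by rw [card_image_of_injOn hinj]
    _ ≤ ∏ p ∈ S.image l, p := pow_card_le_prod _ _ _ fun p hp ↦ by
        obtain ⟨q, hq, rfl⟩ := mem_image.1 hp
        exact (hl q (hmem q hq).1 (hmem q hq).2.1).1.two_le
    _ ≤ m.factorization 2 := Nat.le_of_dvd (Nat.pos_of_ne_zero hpos) hdvd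
    _ ≤ w := hle

end

section

open Filter

theorem eventually_two_mul_rpow_add_one_le_primeCounting :
    ∀ᶠ k : ℕ in atTop, 2 * (k : ℝ) ^ (2 / 3 : ℝ) + 1 ≤ Nat.primeCounting k := by
  have hlog := (isLittleO_log_rpow_atTop (r := 1 / 12) (by norm_num)).bound one_pos
  filter_upwards [tendsto_natCast_atTop_atTop.eventually hlog, eventually_ge_atTop (2 ^ 12)]
    with k hk hk2
  have hk0 : (2 : ℝ) ^ 12 ≤ k := by exact_mod_cast hk2
  have hk1 : (4096 : ℝ) ≤ k := by linarith [show (2 : ℝ) ^ 12 = 4096 by norm_num]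
  have hkpos : (0 : ℝ) < k := by linarith
  have hlogpos : 0 < Real.log k := Real.log_pos (by linarith)
  set y : ℝ := (k : ℝ) ^ (1 / 12 : ℝ) with hy
  have hy0 : 0 ≤ y := by positivity
  have hy12 : (k : ℝ) = y ^ 12 := by
    rw [hy, ← Real.rpow_natCast, ← Real.rpow_mul hkpos.le]; norm_num
  have hy8 : (k : ℝ) ^ (2 / 3 : ℝ) = y ^ 8 := by
    rw [hy, ← Real.rpow_natCast, ← Real.rpow_mul hkpos.le]; norm_num
  have hy2 : 2 ≤ y := by
    rw [hy12] at hk0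
    exact (pow_le_pow_iff_left₀ (by norm_num) hy0 (by norm_num)).1 hk0
  have hle : Real.log k ≤ y := by
    rw [one_mul, Real.norm_of_nonneg hlogpos.le, Real.norm_of_nonneg hy0] at hk
    exact hk
  have hsucc : Real.log (k + 1) ≤ y + 1 := by
    have h1 : Real.log (k + 1) ≤ Real.log (2 * k) :=
      Real.log_le_log (by positivity) (by linarith)
    rw [Real.log_mul (by norm_num) hkpos.ne'] at h1
    linarith [Real.log_two_lt_d9]
  refine le_trans ?_ (Chebyshev.pi_ge k)
  rw [le_div_iff₀ hlogpos, hy8]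
  have h2 : (2 * y ^ 8 + 1) * Real.log k ≤ (2 * y ^ 8 + 1) * y := by gcongr
  have h3 : y ^ 12 * (1 / 2) ≤ k * Real.log 2 := by
    rw [hy12]
    gcongr
    linarith [Real.log_two_gt_d9]
  have h4 : 2 ^ 3 ≤ y ^ 3 := by gcongr
  have h5 : 2 ≤ y ^ 8 := hy2.trans (le_self_pow₀ (by linarith) (by norm_num))
  have h6 : y * 2 ≤ y * y ^ 8 := by gcongr
  have h7 : y ^ 9 * 8 ≤ y ^ 9 * y ^ 3 := by gcongr; linarith
  linarith [show (2 * y ^ 8 + 1) * y = 2 * y ^ 9 + y by ring,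
    show y * y ^ 8 = y ^ 9 by ring, show y ^ 9 * y ^ 3 = y ^ 12 by ring]

/-- The multiples `i * m` with `1 ≤ i ≤ k` cannot all be pure powers below `2 ^ w` if
`k ≥ (log w) ^ (3 / 2)`. -/
theorem exists_not_forall_mul_isPurePower :
    ∃ w₁ : ℝ, ∀ w : ℕ, w₁ ≤ w → ∀ k m : ℕ, Real.log w ^ (3 / 2 : ℝ) ≤ k → m ≠ 0 →
      ¬ ∀ i, 1 ≤ i → i ≤ k → i * m < 2 ^ w ∧ IsPurePower (i * m) := by
  obtain ⟨K, hK⟩ := eventually_atTop.1 eventually_two_mul_rpow_add_one_le_primeCounting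
  have ht : Tendsto (fun x : ℝ ↦ Real.log x ^ (3 / 2 : ℝ)) atTop atTop :=
    (tendsto_rpow_atTop (by norm_num)).comp Real.tendsto_log_atTop
  obtain ⟨w₁, hw₁⟩ := eventually_atTop.1
    ((ht.eventually_ge_atTop (max (K : ℝ) 2)).and (eventually_ge_atTop 2))
  refine ⟨w₁, fun w hw k m hk hm h ↦ ?_⟩
  obtain ⟨h1, hw2⟩ := hw₁ w hw
  have hKk : K ≤ k := by exact_mod_cast (le_max_left _ _).trans (h1.trans hk)
  have h2k : 2 ≤ k := by exact_mod_cast (le_max_right _ _).trans (h1.trans hk)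
  have hpow := two_pow_card_primes_le hm h2k h
  have hpi := hK k hKk
  have hcard : Nat.primeCounting k =
      ((Finset.range (k + 1)).filter Nat.Prime).card := by
    rw [Nat.primeCounting, Nat.primeCounting', Nat.count_eq_card_filter_range]
  have hmem : 2 ∈ (Finset.range (k + 1)).filter Nat.Prime := by
    simp [Nat.prime_two]; omega
  rw [hcard, ← Finset.card_erase_add_one hmem] at hpi
  set c := (((Finset.range (k + 1)).filter Nat.Prime).erase 2).card
  push_cast at hpi
  have hlog0 : 0 < Real.log w := Real.log_pos (by linarith)
  have h3 : Real.log w ≤ (k : ℝ) ^ (2 / 3 : ℝ) := by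
    have := Real.rpow_le_rpow (by positivity) hk (show (0 : ℝ) ≤ 2 / 3 by norm_num)
    rw [← Real.rpow_mul hlog0.le] at this
    norm_num at this
    exact this
  have h4 : c * Real.log 2 ≤ Real.log w := by
    rw [← Real.log_pow]
    exact Real.log_le_log (by positivity) (by exact_mod_cast hpow)
  nlinarith [Real.log_two_gt_d9]

end

section

open Finset

/-- The elements whose colour is one of `γ 0, …, γ (i - 1)`. -/
def colorUnion {α κ : Type*} [Fintype α] [DecidableEq κ] (γ : ℕ → κ) (c : α → κ) (i : ℕ) :
    Finset α :=
  univ.filter fun x ↦ ∃ j < i, c x = γ j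

/-- The colouring obtained from `c` by giving all elements of `T` the colour `b`. -/
def recolor {α κ : Type*} [DecidableEq α] (c : α → κ) (T : Finset α) (b : κ) : α → κ :=
  fun x ↦ if x ∈ T then b else c x

theorem card_filter_recolor_eq_le {α κ : Type*} [Fintype α] [DecidableEq α] [Fintype κ]
    [DecidableEq κ] (T : Finset α) (b : κ) (c' : α → κ) :
    (univ.filter fun c : α → κ ↦ recolor c T b = c').card ≤ Fintype.card κ ^ T.card := by
  have h : Fintype.card (T → κ) = Fintype.card κ ^ T.card := by simp
  rw [← h, ← card_univ]
  refine card_le_card_of_injOn (fun c x ↦ c x) (fun _ _ ↦ mem_coe.2 (mem_univ _)) ?_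
  intro c hc d hd hcd
  have hc := (mem_filter.1 (mem_coe.1 hc)).2
  have hd := (mem_filter.1 (mem_coe.1 hd)).2
  funext x
  by_cases hx : x ∈ T
  · exact congrFun hcd ⟨x, hx⟩
  · have h1 := congrFun (hc.trans hd.symm) x
    simpa [recolor, hx] using h1

theorem mem_colorUnion {α κ : Type*} [Fintype α] [DecidableEq κ] {γ : ℕ → κ} {c : α → κ} {i : ℕ}
    {x : α} : x ∈ colorUnion γ c i ↔ ∃ j < i, c x = γ j := by
  simp [colorUnion]

theorem colorUnion_mono {α κ : Type*} [Fintype α] [DecidableEq κ] (γ : ℕ → κ) (c : α → κ)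
    {i j : ℕ} (hij : i ≤ j) : colorUnion γ c i ⊆ colorUnion γ c j := by
  intro x hx
  obtain ⟨l, hl, h⟩ := mem_colorUnion.1 hx
  exact mem_colorUnion.2 ⟨l, hl.trans_le hij, h⟩

theorem colorUnion_recolor_of_le {α κ : Type*} [Fintype α] [DecidableEq α] [DecidableEq κ]
    {γ : ℕ → κ} {c : α → κ} {i j : ℕ} (hγ : Set.InjOn γ (Set.Iic j))
    (hij : i ≤ j) {T : Finset α} (hT : Disjoint T (colorUnion γ c j)) :
    colorUnion γ (recolor c T (γ j)) i = colorUnion γ c i := by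
  ext x
  rw [mem_colorUnion, mem_colorUnion]
  by_cases hx : x ∈ T
  · have h := disjoint_left.1 hT hx
    rw [mem_colorUnion] at h
    simp only [recolor, hx, if_true]
    constructor
    · rintro ⟨l, hl, h'⟩
      have := hγ (Set.mem_Iic.2 le_rfl) (Set.mem_Iic.2 (by omega)) h'
      omega
    · rintro ⟨l, hl, h'⟩
      exact absurd ⟨l, by omega, h'⟩ h
  · simp [recolor, hx]

theorem colorUnion_recolor_succ {α κ : Type*} [Fintype α] [DecidableEq α] [DecidableEq κ]
    (γ : ℕ → κ) (c : α → κ) (j : ℕ) (T : Finset α) :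
    colorUnion γ (recolor c T (γ j)) (j + 1) = colorUnion γ c (j + 1) ∪ T := by
  ext x
  rw [mem_union, mem_colorUnion, mem_colorUnion]
  by_cases hx : x ∈ T
  · simp only [recolor, hx, if_true, or_true, iff_true]
    exact ⟨j, by omega, rfl⟩
  · simp [recolor, hx]

/-- The remainders of `S` outside `colorUnion γ c j` have size at most `t / 2 ^ j` for `j ≤ i`. -/
def HalvesUpTo {α κ : Type*} [Fintype α] [DecidableEq α] [DecidableEq κ] (γ : ℕ → κ) (t : ℕ)
    (c : α → κ) (i : ℕ) (S : Finset α) : Prop :=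
  ∀ j ≤ i, (S \ colorUnion γ c j).card ≤ t / 2 ^ j

/-- `S` contains the remainder of some member of `H` that is halved by each of the first `i`
colours. -/
def IsAlive {α κ : Type*} [Fintype α] [DecidableEq α] [DecidableEq κ] (H : Finset (Finset α))
    (γ : ℕ → κ) (t : ℕ) (c : α → κ) (i : ℕ) (S : Finset α) : Prop :=
  ∃ S' ∈ H, HalvesUpTo γ t c i S' ∧ S' \ colorUnion γ c i ⊆ S

theorem HalvesUpTo.recolor {α κ : Type*} [Fintype α] [DecidableEq α] [DecidableEq κ]
    {γ : ℕ → κ} {t : ℕ} {c : α → κ} {i : ℕ} (hγ : Set.InjOn γ (Set.Iic i)) {T : Finset α}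
    (hT : Disjoint T (colorUnion γ c i)) (S : Finset α) :
    HalvesUpTo γ t (recolor c T (γ i)) i S ↔ HalvesUpTo γ t c i S := by
  refine forall₂_congr fun j hj ↦ ?_
  rw [colorUnion_recolor_of_le hγ hj hT]

/-- For each colouring there is a small set `R` such that a set dying in round `i` contains a large
set `T` that can be read off from `R` after recolouring. -/
theorem exists_subset_of_isAlive_of_not_isAlive {α κ : Type*} [Fintype α] [DecidableEq α]
    [DecidableEq κ] (H : Finset (Finset α)) {γ : ℕ → κ} (t : ℕ) {i : ℕ}
    (hγ : Set.InjOn γ (Set.Iic i)) :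
    ∃ R : (α → κ) → Finset α, (∀ c, (R c).card ≤ t / 2 ^ i) ∧
      ∀ c S, IsAlive H γ t c i S → ¬ IsAlive H γ t c (i + 1) S →
        ∃ T, T ⊆ S ∧ t / 2 ^ (i + 1) < T.card ∧ T ⊆ R (recolor c T (γ i)) := by
  have hex : ∀ c : α → κ, ∃ S₀ : Finset α, (S₀ \ colorUnion γ c i).card ≤ t / 2 ^ i ∧
      ((∃ S ∈ H, HalvesUpTo γ t c i S ∧ S ⊆ colorUnion γ c (i + 1)) →
        S₀ ∈ H ∧ HalvesUpTo γ t c i S₀ ∧ S₀ ⊆ colorUnion γ c (i + 1)) := by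
    intro c
    by_cases h : ∃ S ∈ H, HalvesUpTo γ t c i S ∧ S ⊆ colorUnion γ c (i + 1)
    · obtain ⟨S, h1, h2, h3⟩ := h
      exact ⟨S, h2 i le_rfl, fun _ ↦ ⟨h1, h2, h3⟩⟩
    · exact ⟨∅, by simp, fun h' ↦ absurd h' h⟩
  choose S₀ hS₀ hS₀' using hex
  refine ⟨fun c ↦ S₀ c \ colorUnion γ c i, hS₀, fun c S hal hnal ↦ ?_⟩
  classical
  have hne : (H.filter fun S' ↦ HalvesUpTo γ t c i S' ∧
      S' \ colorUnion γ c (i + 1) ⊆ S).Nonempty := by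
    obtain ⟨S', h1, h2, h3⟩ := hal
    exact ⟨S', mem_filter.2 ⟨h1, h2,
      (sdiff_subset_sdiff subset_rfl (colorUnion_mono γ c (by omega))).trans h3⟩⟩
  obtain ⟨S', hS', hmin⟩ := exists_min_image _
    (fun S' ↦ (S' \ colorUnion γ c (i + 1)).card) hne
  obtain ⟨hS'H, hS'h, hS'S⟩ := mem_filter.1 hS'
  set T := S' \ colorUnion γ c (i + 1) with hT
  have hTd' : Disjoint T (colorUnion γ c (i + 1)) := sdiff_disjoint
  have hTd : Disjoint T (colorUnion γ c i) := hTd'.mono_right (colorUnion_mono γ c (by omega))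
  have hlarge : t / 2 ^ (i + 1) < T.card := by
    by_contra! hsmall
    refine hnal ⟨S', hS'H, fun j hj ↦ ?_, hS'S⟩
    rcases Nat.lt_or_ge j (i + 1) with hj' | hj'
    · exact hS'h j (by omega)
    · obtain rfl : j = i + 1 := by omega
      exact hsmall
  have hcover : S' ⊆ colorUnion γ (recolor c T (γ i)) (i + 1) := by
    rw [colorUnion_recolor_succ, hT, union_sdiff_self_eq_union]
    exact subset_union_right
  obtain ⟨h1, h2, h3⟩ := hS₀' (recolor c T (γ i))
    ⟨S', hS'H, (HalvesUpTo.recolor hγ hTd S').2 hS'h, hcover⟩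
  set S₁ := S₀ (recolor c T (γ i))
  rw [HalvesUpTo.recolor hγ hTd] at h2
  rw [colorUnion_recolor_succ] at h3
  have hsub : S₁ \ colorUnion γ c (i + 1) ⊆ T := sdiff_le_iff.2 h3
  have heq := eq_of_subset_of_card_le hsub (hmin S₁ (mem_filter.2 ⟨h1, h2, hsub.trans hS'S⟩))
  refine ⟨T, hS'S, hlarge, ?_⟩
  simp only [colorUnion_recolor_of_le hγ le_rfl hTd]
  conv_lhs => rw [← heq]
  exact sdiff_subset_sdiff subset_rfl (colorUnion_mono γ c (by omega))

end

section

open Finset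

theorem card_isAlive_not_isAlive_succ_le {α κ : Type*} [Fintype α] [DecidableEq α] [Fintype κ]
    [DecidableEq κ] {H : Finset (Finset α)} {γ : ℕ → κ} (t : ℕ) {i q s : ℕ}
    (hγ : Set.InjOn γ (Set.Iic i)) (hs : 4 * Fintype.card κ * q ≤ s)
    (hH : ∀ T : Finset α, (H.filter (T ⊆ ·)).card * s ^ T.card ≤ H.card)
    [DecidablePred fun p : (α → κ) × Finset α ↦
      IsAlive H γ t p.1 i p.2 ∧ ¬ IsAlive H γ t p.1 (i + 1) p.2] :
    q * ((univ ×ˢ H).filter fun p : (α → κ) × Finset α ↦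
      IsAlive H γ t p.1 i p.2 ∧ ¬ IsAlive H γ t p.1 (i + 1) p.2).card ≤
      Fintype.card (α → κ) * H.card := by
  obtain ⟨R, hR, hRT⟩ := exists_subset_of_isAlive_of_not_isAlive H t hγ
  set U : (α → κ) → Finset (Finset α) := fun c ↦
    (R c).powerset.filter fun T ↦ t / 2 ^ (i + 1) < T.card with hU
  set P : (α → κ) → Finset α → Finset ((α → κ) × Finset α) := fun c' T ↦
    (univ.filter fun c ↦ recolor c T (γ i) = c') ×ˢ H.filter (T ⊆ ·) with hP
  have hsub : ((univ ×ˢ H).filter fun p : (α → κ) × Finset α ↦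
      IsAlive H γ t p.1 i p.2 ∧ ¬ IsAlive H γ t p.1 (i + 1) p.2) ⊆
      univ.biUnion fun c' ↦ (U c').biUnion (P c') := by
    rintro ⟨c, S⟩ h
    simp only [mem_filter, mem_product, mem_univ, true_and] at h
    obtain ⟨hS, h1, h2⟩ := h
    obtain ⟨T, hTS, hT, hTR⟩ := hRT c S h1 h2
    simp only [mem_biUnion, mem_univ, true_and, hU, hP, mem_filter, mem_powerset, mem_product]
    exact ⟨_, T, ⟨hTR, hT⟩, rfl, hS, hTS⟩
  have hterm : ∀ c', ∀ T ∈ U c', 2 ^ (R c').card * (q * (P c' T).card) ≤ H.card := by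
    intro c' T hT
    obtain ⟨-, hT⟩ := mem_filter.1 hT
    have hlen : (R c').card ≤ 2 * T.card := by
      have h1 := hR c'
      have h2 : t / 2 ^ (i + 1) = t / 2 ^ i / 2 := by rw [pow_succ, Nat.div_div_eq_div_mul]
      omega
    have hT0 : T.card ≠ 0 := ((Nat.zero_le _).trans_lt hT).ne'
    have h4 : 2 ^ (R c').card ≤ 4 ^ T.card :=
      calc 2 ^ (R c').card ≤ 2 ^ (2 * T.card) := Nat.pow_le_pow_right (by norm_num) hlen
        _ = 4 ^ T.card := by rw [pow_mul]; norm_num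
    rw [hP, card_product]
    calc 2 ^ (R c').card * (q * (_ * (H.filter (T ⊆ ·)).card))
        ≤ 4 ^ T.card * (q ^ T.card * (Fintype.card κ ^ T.card * (H.filter (T ⊆ ·)).card)) := by
          refine Nat.mul_le_mul h4 (Nat.mul_le_mul (Nat.le_self_pow hT0 q)
            (Nat.mul_le_mul_right _ (card_filter_recolor_eq_le T (γ i) c')))
      _ = (H.filter (T ⊆ ·)).card * (4 * Fintype.card κ * q) ^ T.card := by
          rw [mul_pow, mul_pow]; ring
      _ ≤ (H.filter (T ⊆ ·)).card * s ^ T.card := by gcongr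
      _ ≤ H.card := hH T
  have hsum : ∀ c', q * ((U c').biUnion (P c')).card ≤ H.card := by
    intro c'
    have h1 : (U c').card ≤ 2 ^ (R c').card := by
      rw [← card_powerset]; exact card_filter_le _ _
    have h2 : 2 ^ (R c').card * (q * ((U c').biUnion (P c')).card) ≤
        2 ^ (R c').card * H.card := by
      calc 2 ^ (R c').card * (q * ((U c').biUnion (P c')).card)
          ≤ 2 ^ (R c').card * (q * ∑ T ∈ U c', (P c' T).card) := by
            gcongr; exact card_biUnion_le
        _ = ∑ T ∈ U c', 2 ^ (R c').card * (q * (P c' T).card) := by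
            rw [mul_sum, mul_sum]
        _ ≤ (U c').card * H.card := by
            rw [← smul_eq_mul]; exact sum_le_card_nsmul _ _ _ (hterm c')
        _ ≤ 2 ^ (R c').card * H.card := by gcongr
    exact Nat.le_of_mul_le_mul_left h2 (by positivity)
  calc q * _ ≤ q * ∑ c', ((U c').biUnion (P c')).card := by
        gcongr; exact (card_le_card hsub).trans card_biUnion_le
    _ = ∑ c', q * ((U c').biUnion (P c')).card := by rw [mul_sum]
    _ ≤ Fintype.card (α → κ) * H.card := by
        rw [← smul_eq_mul, ← card_univ]
        exact sum_le_card_nsmul _ _ _ fun c' _ ↦ hsum c'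

/-- For at least half of the colourings, a spread family has a member using only `r` given
colours. -/
theorem card_colorings_le_two_mul_card_filter {α κ : Type*} [Fintype α] [DecidableEq α] [Fintype κ]
    [DecidableEq κ] {H : Finset (Finset α)} {γ : ℕ → κ} {t r s : ℕ} (hr : 1 ≤ r) (htr : t < 2 ^ r)
    (hγ : Set.InjOn γ (Set.Iio r)) (hs : 8 * Fintype.card κ * r ≤ s) (hne : H.Nonempty)
    (ht : ∀ S ∈ H, S.card ≤ t)
    (hH : ∀ T : Finset α, (H.filter (T ⊆ ·)).card * s ^ T.card ≤ H.card) :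
    Fintype.card (α → κ) ≤
      2 * (univ.filter fun c : α → κ ↦ ∃ S ∈ H, S ⊆ colorUnion γ c r).card := by
  set G := univ.filter fun c : α → κ ↦ ∃ S ∈ H, S ⊆ colorUnion γ c r with hG
  classical
  set Z := univ \ G with hZ
  set Y : ℕ → Finset ((α → κ) × Finset α) := fun i ↦
    (univ ×ˢ H).filter fun p : (α → κ) × Finset α ↦
      IsAlive H γ t p.1 i p.2 ∧ ¬ IsAlive H γ t p.1 (i + 1) p.2 with hY
  have hsub : Z ×ˢ H ⊆ (range r).biUnion Y := by
    rintro ⟨c, S⟩ h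
    obtain ⟨hc, hS⟩ := mem_product.1 h
    have hc : ¬ ∃ S ∈ H, S ⊆ colorUnion γ c r := fun h' ↦
      (mem_sdiff.1 hc).2 (mem_filter.2 ⟨mem_univ _, h'⟩)
    simp only [mem_biUnion, mem_range, hY, mem_filter, mem_product, mem_univ, true_and]
    by_contra! hcon
    have hall : ∀ i ≤ r, IsAlive H γ t c i S := by
      intro i
      induction i with
      | zero =>
        refine fun _ ↦ ⟨S, hS, fun j hj ↦ ?_, sdiff_subset⟩
        obtain rfl : j = 0 := by omega
        simpa using (card_le_card sdiff_subset).trans (ht S hS)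
      | succ i ih => exact fun hi ↦ hcon i (by omega) hS (ih (by omega))
    obtain ⟨S', hS', hh, -⟩ := hall r le_rfl
    have h0 := hh r le_rfl
    rw [Nat.div_eq_of_lt htr, Nat.le_zero, card_eq_zero, sdiff_eq_empty_iff_subset] at h0
    exact hc ⟨S', hS', h0⟩
  have hY' : ∀ i ∈ range r, 2 * r * (Y i).card ≤ Fintype.card (α → κ) * H.card := by
    intro i hi
    refine card_isAlive_not_isAlive_succ_le t (hγ.mono fun j hj ↦ ?_) ?_ hH
    · have := mem_range.1 hi
      simp only [Set.mem_Iic, Set.mem_Iio] at hj ⊢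
      omega
    · calc 4 * Fintype.card κ * (2 * r) = 8 * Fintype.card κ * r := by ring
        _ ≤ s := hs
  have h1 : 2 * r * (Z.card * H.card) ≤ r * (Fintype.card (α → κ) * H.card) := by
    calc 2 * r * (Z.card * H.card) ≤ 2 * r * ∑ i ∈ range r, (Y i).card := by
          gcongr
          rw [← card_product]
          exact (card_le_card hsub).trans card_biUnion_le
      _ = ∑ i ∈ range r, 2 * r * (Y i).card := by rw [mul_sum]
      _ ≤ (range r).card • (Fintype.card (α → κ) * H.card) := sum_le_card_nsmul _ _ _ hY'
      _ = r * (Fintype.card (α → κ) * H.card) := by rw [card_range, smul_eq_mul]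
  have h2 : 2 * Z.card ≤ Fintype.card (α → κ) := by
    refine le_of_mul_le_mul_left (a := r * H.card) ?_ (Nat.mul_pos hr hne.card_pos)
    calc r * H.card * (2 * Z.card) = 2 * r * (Z.card * H.card) := by ring
      _ ≤ _ := h1
      _ = r * H.card * Fintype.card (α → κ) := by ring
  have h3 := card_sdiff_add_card_eq_card (subset_univ G)
  rw [card_univ, ← hZ] at h3
  omega

end

section

open Finset

theorem exists_pairwiseDisjoint_of_spread {α : Type*} [Fintype α] [DecidableEq α]
    {H : Finset (Finset α)} {t r k s : ℕ} (hr : 1 ≤ r) (htr : t < 2 ^ r) (hk : 1 ≤ k)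
    (hs : 16 * k * r ^ 2 ≤ s) (hne : H.Nonempty) (ht : ∀ S ∈ H, S.card ≤ t)
    (hH : ∀ T : Finset α, (H.filter (T ⊆ ·)).card * s ^ T.card ≤ H.card) :
    ∃ J : Finset (Fin (2 * k)), k ≤ J.card ∧ ∃ f : Fin (2 * k) → Finset α,
      (∀ j ∈ J, f j ∈ H) ∧ (J : Set (Fin (2 * k))).PairwiseDisjoint f := by
  classical
  have : NeZero r := ⟨by omega⟩
  have : NeZero (2 * k) := ⟨by omega⟩
  set γ : Fin (2 * k) → ℕ → Fin (2 * k) × Fin r := fun j i ↦ (j, Fin.ofNat r i) with hγ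
  have hinj : ∀ j, Set.InjOn (γ j) (Set.Iio r) := by
    intro j a ha b hb hab
    have := congrArg (fun p : Fin (2 * k) × Fin r ↦ (p.2 : ℕ)) hab
    simpa [hγ, Nat.mod_eq_of_lt (Set.mem_Iio.1 ha), Nat.mod_eq_of_lt (Set.mem_Iio.1 hb)] using this
  have hhalf := fun j ↦ card_colorings_le_two_mul_card_filter (H := H) (t := t) (s := s)
    hr htr (hinj j) (by
      calc 8 * Fintype.card (Fin (2 * k) × Fin r) * r = 16 * k * r ^ 2 := by
            rw [Fintype.card_prod, Fintype.card_fin, Fintype.card_fin]; ring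
        _ ≤ s := hs) hne ht hH
  set c₀ := Fintype.card (α → Fin (2 * k) × Fin r) with hc₀
  set J : (α → Fin (2 * k) × Fin r) → Finset (Fin (2 * k)) := fun c ↦
    univ.filter fun j ↦ ∃ S ∈ H, S ⊆ colorUnion (γ j) c r with hJ
  obtain ⟨c, hc⟩ : ∃ c, k ≤ (J c).card := by
    have hsum : ∑ c, (J c).card = ∑ j, (univ.filter fun c ↦
        ∃ S ∈ H, S ⊆ colorUnion (γ j) c r).card := by
      simp only [hJ, card_filter]
      exact sum_comm
    by_contra! hcon
    have h1 : ∑ c, (J c).card < ∑ _c : α → Fin (2 * k) × Fin r, k :=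
      sum_lt_sum_of_nonempty univ_nonempty fun c _ ↦ hcon c
    rw [sum_const, card_univ, smul_eq_mul, ← hc₀, hsum] at h1
    have h2 : ∑ _j : Fin (2 * k), c₀ ≤ 2 * ∑ j, (univ.filter fun c ↦
        ∃ S ∈ H, S ⊆ colorUnion (γ j) c r).card := by
      rw [mul_sum]
      exact sum_le_sum fun j _ ↦ hhalf j
    rw [sum_const, card_univ, Fintype.card_fin, smul_eq_mul] at h2
    nlinarith
  have hmem : ∀ j, ∃ S, j ∈ J c → S ∈ H ∧ S ⊆ colorUnion (γ j) c r := by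
    intro j
    by_cases hj : j ∈ J c
    · obtain ⟨S, hS, hS'⟩ := (mem_filter.1 hj).2
      exact ⟨S, fun _ ↦ ⟨hS, hS'⟩⟩
    · exact ⟨∅, fun h ↦ absurd h hj⟩
  choose f hf using hmem
  refine ⟨J c, hc, f, fun j hj ↦ (hf j hj).1, fun i hi j hj hij ↦ ?_⟩
  refine disjoint_left.2 fun x hx hx' ↦ hij ?_
  obtain ⟨a, -, ha⟩ := mem_colorUnion.1 ((hf i hi).2 hx)
  obtain ⟨b, -, hb⟩ := mem_colorUnion.1 ((hf j hj).2 hx')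
  exact congrArg Prod.fst (ha.symm.trans hb)

/-- A sunflower lemma: more than `(16 * k * r ^ 2) ^ t` sets of size `t < 2 ^ r` contain a sunflower
with `k` petals. -/
theorem exists_sunflower {α : Type*} [Fintype α] [DecidableEq α]
    {H : Finset (Finset α)} {t r k s : ℕ} (hr : 1 ≤ r) (htr : t < 2 ^ r) (hk : 1 ≤ k)
    (hs : 16 * k * r ^ 2 ≤ s) (ht : ∀ S ∈ H, S.card = t) (hH : s ^ t < H.card) :
    ∃ U : Finset α, U.card < t ∧ ∃ J : Finset (Fin (2 * k)), k ≤ J.card ∧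
      ∃ f : Fin (2 * k) → Finset α, (∀ j ∈ J, f j ∈ H ∧ U ⊆ f j) ∧
        (J : Set (Fin (2 * k))).PairwiseDisjoint fun j ↦ f j \ U := by
  have hs0 : 0 < s := lt_of_lt_of_le (by positivity) hs
  obtain ⟨U, -, hU⟩ := exists_max_image (univ : Finset (Finset α))
    (fun U ↦ (H.filter (U ⊆ ·)).card * s ^ U.card) ⟨∅, mem_univ _⟩
  have hUH : s ^ t < (H.filter (U ⊆ ·)).card * s ^ U.card := by
    have := hU ∅ (mem_univ _)
    simp only [empty_subset, filter_true, card_empty, pow_zero, mul_one] at this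
    exact hH.trans_le this
  have hne : (H.filter (U ⊆ ·)).Nonempty := by
    rw [← card_pos]
    exact Nat.pos_of_mul_pos_right (Nat.zero_lt_of_lt hUH)
  have hUt : U.card < t := by
    obtain ⟨S, hS⟩ := hne
    obtain ⟨hSH, hUS⟩ := mem_filter.1 hS
    refine lt_of_le_of_ne ((card_le_card hUS).trans (ht S hSH).le) fun heq ↦ ?_
    have hone : (H.filter (U ⊆ ·)).card ≤ 1 := by
      refine card_le_one.2 fun A hA B hB ↦ ?_
      obtain ⟨hA, hUA⟩ := mem_filter.1 hA
      obtain ⟨hB, hUB⟩ := mem_filter.1 hB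
      rw [← eq_of_subset_of_card_le hUA (by rw [ht A hA, heq]),
        ← eq_of_subset_of_card_le hUB (by rw [ht B hB, heq])]
    rw [heq] at hUH
    exact absurd (hUH.trans_le (Nat.mul_le_mul_right _ hone)) (by simp)
  have hinj : Set.InjOn (· \ U) (H.filter (U ⊆ ·) : Set (Finset α)) := by
    intro A hA B hB hAB
    have hA := (mem_filter.1 (mem_coe.1 hA)).2
    have hB := (mem_filter.1 (mem_coe.1 hB)).2
    rw [← sdiff_union_of_subset hA, ← sdiff_union_of_subset hB]
    exact congrArg (· ∪ U) hAB
  obtain ⟨J, hJ, f, hf, hd⟩ := exists_pairwiseDisjoint_of_spread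
    (H := (H.filter (U ⊆ ·)).image (· \ U)) hr htr hk hs (hne.image _) (by
      intro S hS
      obtain ⟨S', hS', rfl⟩ := mem_image.1 hS
      exact (card_le_card sdiff_subset).trans (ht S' (mem_filter.1 hS').1).le) (by
      intro T
      rw [card_image_of_injOn hinj]
      by_cases hTU : Disjoint U T
      · refine Nat.le_of_mul_le_mul_right ?_ (pow_pos hs0 U.card)
        refine le_trans ?_ (hU (U ∪ T) (mem_univ _))
        rw [card_union_of_disjoint hTU, mul_assoc, ← pow_add, add_comm T.card]
        refine Nat.mul_le_mul_right _ ?_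
        refine (card_le_card (t := (H.filter (U ∪ T ⊆ ·)).image (· \ U)) ?_).trans card_image_le
        intro S hS
        obtain ⟨hS, hTS⟩ := mem_filter.1 hS
        obtain ⟨S', hS', rfl⟩ := mem_image.1 hS
        obtain ⟨hS'H, hUS'⟩ := mem_filter.1 hS'
        exact mem_image.2 ⟨S', mem_filter.2
          ⟨hS'H, union_subset hUS' (hTS.trans sdiff_subset)⟩, rfl⟩
      · have hempty : ((H.filter (U ⊆ ·)).image (· \ U)).filter (T ⊆ ·) = ∅ := by
          refine filter_eq_empty_iff.2 fun S hS hTS ↦ hTU ?_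
          obtain ⟨S', -, rfl⟩ := mem_image.1 hS
          exact (disjoint_sdiff (s := U)).mono_right hTS
        rw [hempty, card_empty, zero_mul]
        exact Nat.zero_le _)
  refine ⟨U, hUt, J, hJ, fun j ↦ f j ∪ U, fun j hj ↦ ?_, fun i hi j hj hij ↦ ?_⟩
  · obtain ⟨S, hS, hSf⟩ := mem_image.1 (hf j hj)
    obtain ⟨hSH, hUS⟩ := mem_filter.1 hS
    refine ⟨?_, subset_union_right⟩
    have hSeq : f j ∪ U = S := by rw [← hSf, sdiff_union_of_subset hUS]
    beta_reduce
    rwa [hSeq]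
  · have := hd hi hj hij
    refine this.mono ?_ ?_ <;> exact sdiff_le_iff.2 (union_comm _ _).subset

end

section

open Finset

theorem pow_le_choose_of_mul_le {n t D : ℕ} (h : t * (D + 1) ≤ n) : D ^ t ≤ n.choose t := by
  have h1 := Nat.pow_sub_le_descFactorial n t
  rw [Nat.descFactorial_eq_factorial_mul_choose] at h1
  refine Nat.le_of_mul_le_mul_left ?_ t.factorial_pos
  refine le_trans ?_ h1
  calc t.factorial * D ^ t ≤ t ^ t * D ^ t := Nat.mul_le_mul_right _ t.factorial_le_pow
    _ = (t * D) ^ t := (mul_pow _ _ _).symm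
    _ ≤ (n + 1 - t) ^ t := by
      refine Nat.pow_le_pow_left ?_ t
      rw [mul_add, mul_one] at h
      omega

/-- If a long list of positive integers has few subset sums, then the first `k`
multiples of some `m ≠ 0` occur among them. -/
theorem exists_forall_mul_eq_sum {ι : Type*} [Fintype ι] [DecidableEq ι] (a : ι → ℕ)
    (ha : ∀ i, 0 < a i) (I : Finset ι) (B : Finset ℕ)
    (hB : ∀ F ⊆ I, F.Nonempty → ∑ i ∈ F, a i ∈ B) {t r k : ℕ} (ht : 1 ≤ t) (hr : 1 ≤ r)
    (htr : t < 2 ^ r) (hk : 1 ≤ k) (hBt : B.card < 3 ^ t)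
    (hI : t * (48 * k * r ^ 2 + 1) ≤ I.card) :
    ∃ m, m ≠ 0 ∧ ∀ i, 1 ≤ i → i ≤ k → ∃ F ⊆ I, F.Nonempty ∧ i * m = ∑ j ∈ F, a j := by
  have hmaps : ∀ S ∈ I.powersetCard t, ∑ i ∈ S, a i ∈ B := by
    intro S hS
    obtain ⟨h1, h2⟩ := mem_powersetCard.1 hS
    exact hB S h1 (card_pos.1 (by omega))
  have hcard : B.card * (16 * k * r ^ 2) ^ t < (I.powersetCard t).card := by
    rw [card_powersetCard]
    calc B.card * (16 * k * r ^ 2) ^ t < 3 ^ t * (16 * k * r ^ 2) ^ t :=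
          Nat.mul_lt_mul_of_pos_right hBt (by positivity)
      _ = (48 * k * r ^ 2) ^ t := by rw [← mul_pow]; congr 1; ring
      _ ≤ I.card.choose t := pow_le_choose_of_mul_le hI
  obtain ⟨v, -, hv⟩ := exists_lt_card_fiber_of_mul_lt_card_of_maps_to hmaps hcard
  obtain ⟨U, hU, J, hJ, f, hf, hd⟩ := exists_sunflower hr htr hk le_rfl
    (fun S hS ↦ (mem_powersetCard.1 (mem_filter.1 hS).1).2) hv
  have hmem : ∀ j ∈ J, f j ⊆ I ∧ (f j).card = t ∧ ∑ i ∈ f j, a i = v ∧ U ⊆ f j := by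
    intro j hj
    obtain ⟨h1, h2⟩ := hf j hj
    obtain ⟨h3, h4⟩ := mem_filter.1 h1
    obtain ⟨h5, h6⟩ := mem_powersetCard.1 h3
    exact ⟨h5, h6, h4, h2⟩
  have hsum : ∀ j ∈ J, ∑ i ∈ f j \ U, a i = v - ∑ i ∈ U, a i := by
    intro j hj
    obtain ⟨-, -, h3, h4⟩ := hmem j hj
    have := sum_sdiff (f := a) h4
    omega
  have hnonempty : ∀ j ∈ J, (f j \ U).Nonempty := by
    intro j hj
    obtain ⟨-, h2, -, h4⟩ := hmem j hj
    rw [← card_pos, card_sdiff_of_subset h4]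
    omega
  refine ⟨v - ∑ i ∈ U, a i, ?_, fun i hi hik ↦ ?_⟩
  · obtain ⟨j, hj⟩ : J.Nonempty := card_pos.1 (by omega)
    rw [← hsum j hj]
    exact (sum_pos (fun i _ ↦ ha i) (hnonempty j hj)).ne'
  · obtain ⟨J', hJ', hcard'⟩ := exists_subset_card_eq (hik.trans hJ)
    refine ⟨J'.biUnion fun j ↦ f j \ U, ?_, ?_, ?_⟩
    · exact biUnion_subset.2 fun j hj ↦ sdiff_subset.trans (hmem j (hJ' hj)).1
    · obtain ⟨j, hj⟩ : J'.Nonempty := card_pos.1 (by omega)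
      exact (hnonempty j (hJ' hj)).mono (subset_biUnion_of_mem (fun j ↦ f j \ U) hj)
    · rw [sum_biUnion (hd.subset (coe_subset.2 hJ')),
        sum_congr rfl fun j hj ↦ hsum j (hJ' hj), sum_const, hcard', smul_eq_mul]

end

section

open Filter

theorem eventually_mul_lt_pow (C : ℝ) :
    ∀ᶠ y : ℝ in atTop, ∀ t k : ℕ, t ≠ 0 → (t : ℝ) ≤ C * y ^ 20 + 2 → (k : ℝ) ≤ y ^ 15 + 1 →
      (2 * (t * (48 * k * (Nat.log 2 t + 1) ^ 2 + 1)) : ℝ) ≤ y ^ 39 := by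
  filter_upwards [Real.isLittleO_log_id_atTop.bound (show (0 : ℝ) < 1 / 100 by norm_num),
    eventually_ge_atTop (C + 2), eventually_ge_atTop 194] with y hlog hC hy t k ht0 ht hk
  have hlog0 : 0 < Real.log y := Real.log_pos (by linarith)
  rw [Real.norm_of_nonneg hlog0.le, id, Real.norm_of_nonneg (by linarith)] at hlog
  have hy1 : 1 ≤ y := by linarith
  have ht' : (t : ℝ) ≤ y ^ 21 := by
    calc (t : ℝ) ≤ C * y ^ 20 + 2 := ht
      _ ≤ C * y ^ 20 + 2 * y ^ 20 := by gcongr; linarith [one_le_pow₀ (n := 20) hy1]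
      _ = (C + 2) * y ^ 20 := by ring
      _ ≤ y * y ^ 20 := by gcongr
      _ = y ^ 21 := by ring
  have hk' : (k : ℝ) ≤ 2 * y ^ 15 := by linarith [one_le_pow₀ (n := 15) hy1]
  have hr : (Nat.log 2 t + 1 : ℝ) ≤ y := by
    have h1 : (2 : ℝ) ^ Nat.log 2 t ≤ y ^ 21 := by
      refine le_trans ?_ ht'
      exact_mod_cast Nat.pow_log_le_self 2 ht0
    have h2 := Real.log_le_log (by positivity) h1
    rw [Real.log_pow, Real.log_pow] at h2
    push_cast at h2
    have h3 : (Nat.log 2 t : ℝ) * (1 / 2) ≤ Nat.log 2 t * Real.log 2 := by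
      gcongr
      linarith [Real.log_two_gt_d9]
    linarith
  calc (2 * (t * (48 * k * (Nat.log 2 t + 1) ^ 2 + 1)) : ℝ)
      ≤ 2 * (y ^ 21 * (48 * (2 * y ^ 15) * y ^ 2 + y ^ 17)) := by
        gcongr
        exact one_le_pow₀ hy1
    _ = 194 * y ^ 38 := by ring
    _ ≤ y * y ^ 38 := by gcongr
    _ = y ^ 39 := by ring

theorem exists_card_le_of_forall_isPurePower :
    ∃ w₂ : ℝ, ∀ w : ℕ, w₂ ≤ w → ∀ (d : ℕ) (a : Fin d → ℕ), (∀ i, 0 < a i) →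
      (∀ F : Finset (Fin d), F.Nonempty → IsPurePower (∑ i ∈ F, a i) ∧ ∑ i ∈ F, a i < 2 ^ w) →
        (d : ℝ) ≤ (Real.log w ^ (1 / 10 : ℝ)) ^ 39 := by
  obtain ⟨C, hC, w₀, hw₀⟩ := exists_card_lt_of_forall_add_isPurePower
  obtain ⟨w₁, hw₁⟩ := exists_not_forall_mul_isPurePower
  have hev := ((tendsto_rpow_atTop (show (0 : ℝ) < 1 / 10 by norm_num)).comp
    Real.tendsto_log_atTop).eventually (eventually_mul_lt_pow C)
  obtain ⟨w₂, hw₂⟩ := eventually_atTop.1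
    (((hev.and (eventually_ge_atTop w₀)).and (eventually_ge_atTop w₁)).and (eventually_gt_atTop 1))
  refine ⟨w₂, fun w hw d a ha hF ↦ ?_⟩
  obtain ⟨⟨⟨h1, h2⟩, h3⟩, h4⟩ := hw₂ w hw
  have hL : 0 < Real.log w := Real.log_pos h4
  set y := Real.log w ^ (1 / 10 : ℝ) with hy
  have hy10 : Real.log w = y ^ 10 := by
    rw [hy, ← Real.rpow_natCast, ← Real.rpow_mul hL.le]; norm_num
  have hy15 : Real.log w ^ (3 / 2 : ℝ) = y ^ 15 := by
    rw [hy, ← Real.rpow_natCast, ← Real.rpow_mul hL.le]; norm_num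
  set t := ⌈C * Real.log w ^ 2⌉₊ + 1 with ht
  set k := ⌈Real.log w ^ (3 / 2 : ℝ)⌉₊ with hk
  set r := Nat.log 2 t + 1 with hr
  have ht2 : (t : ℝ) ≤ C * y ^ 20 + 2 := by
    have := Nat.ceil_lt_add_one (show 0 ≤ C * Real.log w ^ 2 by positivity)
    rw [show y ^ 20 = (y ^ 10) ^ 2 by ring, ← hy10, ht]
    push_cast
    linarith
  have hk2 : (k : ℝ) ≤ y ^ 15 + 1 := by
    rw [← hy15]
    exact (Nat.ceil_lt_add_one (by positivity)).le
  have hmain := h1 t k (by omega) ht2 hk2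
  refine le_trans ?_ hmain
  by_contra! hd
  have hd' : 2 * (t * (48 * k * r ^ 2 + 1)) < d := by exact_mod_cast hd
  have hsmall : ∀ B : Finset ℕ, (B.card : ℝ) < Real.exp (C * Real.log w ^ 2) → B.card < 3 ^ t := by
    intro B hB
    have h5 : Real.exp (C * Real.log w ^ 2) ≤ 3 ^ t := by
      calc Real.exp (C * Real.log w ^ 2) ≤ Real.exp (t * 1) := by
            rw [Real.exp_le_exp, mul_one, ht]
            push_cast
            linarith [Nat.le_ceil (C * Real.log w ^ 2)]
        _ = Real.exp 1 ^ t := Real.exp_nat_mul 1 t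
        _ ≤ 3 ^ t := by gcongr; linarith [Real.exp_one_lt_d9]
    exact_mod_cast hB.trans_le h5
  have hkey : ∀ (I : Finset (Fin d)) (B : Finset ℕ), (∀ F ⊆ I, F.Nonempty → ∑ i ∈ F, a i ∈ B) →
      t * (48 * k * r ^ 2 + 1) ≤ I.card → ¬ (B.card : ℝ) < Real.exp (C * Real.log w ^ 2) := by
    intro I B hB hI hBc
    have hk1 : 1 ≤ k := Nat.one_le_ceil_iff.2 (by positivity)
    obtain ⟨m, hm, hmk⟩ := exists_forall_mul_eq_sum a ha I B hB (by omega) (by omega)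
      (Nat.lt_pow_succ_log_self one_lt_two t) hk1 (hsmall B hBc) hI
    refine hw₁ w h3 k m (Nat.le_ceil _) hm fun i hi hik ↦ ?_
    obtain ⟨F, -, hF0, hFm⟩ := hmk i hi hik
    rw [hFm]
    exact (hF F hF0).symm
  obtain ⟨I, -, hI⟩ := Finset.exists_subset_card_eq (s := (Finset.univ : Finset (Fin d)))
    (n := t * (48 * k * r ^ 2 + 1)) (by rw [Finset.card_univ, Fintype.card_fin]; omega)
  have hIc : t * (48 * k * r ^ 2 + 1) ≤ Iᶜ.card := by
    rw [Finset.card_compl, Fintype.card_fin, hI]; omega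
  set σ : Finset (Fin d) → Finset ℕ := fun I ↦
    (I.powerset.filter Finset.Nonempty).image fun F ↦ ∑ i ∈ F, a i with hσ
  have hσmem : ∀ I, ∀ F ⊆ I, F.Nonempty → ∑ i ∈ F, a i ∈ σ I := fun I F hFI hF0 ↦
    Finset.mem_image_of_mem _ (Finset.mem_filter.2 ⟨Finset.mem_powerset.2 hFI, hF0⟩)
  have hpos : ∀ F : Finset (Fin d), F.Nonempty → 1 ≤ ∑ i ∈ F, a i := fun F hF0 ↦
    Finset.sum_pos (fun i _ ↦ ha i) hF0
  rcases hw₀ w h2 (σ I) (σ Iᶜ) (by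
    intro x hx x' hx'
    obtain ⟨F, hFI, rfl⟩ := Finset.mem_image.1 hx
    obtain ⟨F', hFI', rfl⟩ := Finset.mem_image.1 hx'
    obtain ⟨hFI, hF0⟩ := Finset.mem_filter.1 hFI
    obtain ⟨hFI', hF0'⟩ := Finset.mem_filter.1 hFI'
    have hdisj : Disjoint F F' := Disjoint.mono
      (Finset.mem_powerset.1 hFI) (Finset.mem_powerset.1 hFI') disjoint_compl_right
    have hsum := hF (F ∪ F') (hF0.mono Finset.subset_union_left)
    rw [Finset.sum_union hdisj] at hsum
    exact ⟨add_le_add (hpos F hF0) (hpos F' hF0'), hsum.2, hsum.1⟩) with h | h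
  · exact hkey I _ (hσmem I) hI.ge h
  · exact hkey Iᶜ _ (hσmem Iᶜ) hIc h

end

/-- Subset sums in pure powers, general case:
`d ≪ (log log N)⁴ / (log log log N)²`. -/
theorem stmt_9 :
    ∃ C : ℝ, 0 < C ∧ ∃ N₀ : ℕ, ∀ N : ℕ, N₀ ≤ N →
      ∀ (d : ℕ) (a : Fin d → ℕ),
        (∀ i, 0 < a i) →
        (∀ F : Finset (Fin d), F.Nonempty →
          IsPurePower (∑ i ∈ F, a i) ∧ ∑ i ∈ F, a i ≤ N) →
        (d : ℝ) ≤ C * (Real.log (Real.log N)) ^ 4 /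
          (Real.log (Real.log (Real.log N))) ^ 2 := by
  obtain ⟨w₂, hw₂⟩ := exists_card_le_of_forall_isPurePower
  have hlog := (isLittleO_log_rpow_atTop (r := 1 / 20) (by norm_num)).bound one_pos
  have hlog1 : Filter.Tendsto (fun N : ℕ ↦ Real.log N) Filter.atTop Filter.atTop :=
    Real.tendsto_log_atTop.comp tendsto_natCast_atTop_atTop
  have hlog2 := Real.tendsto_log_atTop.comp hlog1
  obtain ⟨N₀, hN₀⟩ := Filter.eventually_atTop.1 (((hlog2.eventually hlog).and
    (hlog2.eventually_gt_atTop 1)).and ((hlog1.eventually_ge_atTop w₂).and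
      (hlog1.eventually_ge_atTop 1)))
  refine ⟨16, by norm_num, max N₀ 2, fun N hN d a ha hF ↦ ?_⟩
  obtain ⟨⟨h1, h2⟩, h3, h4⟩ := hN₀ N ((le_max_left _ _).trans hN)
  simp only [Function.comp_apply] at h1 h2
  have hN2 : 2 ≤ N := (le_max_right _ _).trans hN
  set w := Nat.log 2 N + 1 with hw
  have hNw : N < 2 ^ w := Nat.lt_pow_succ_log_self one_lt_two N
  have hlow : Real.log N ≤ w := by
    have h5 : Real.log N ≤ Real.log ((2 : ℝ) ^ w) :=
      Real.log_le_log (by positivity) (by exact_mod_cast hNw.le)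
    rw [Real.log_pow] at h5
    have h6 : (w : ℝ) * Real.log 2 ≤ w * 1 := by
      gcongr
      linarith [Real.log_two_lt_d9]
    linarith
  have hupp : (w : ℝ) ≤ Real.exp 1 * Real.log N := by
    have h5 : Real.log ((2 : ℝ) ^ Nat.log 2 N) ≤ Real.log N :=
      Real.log_le_log (by positivity) (by exact_mod_cast Nat.pow_log_le_self 2 (by omega))
    rw [Real.log_pow] at h5
    have h6 : (Nat.log 2 N : ℝ) * (2 / 3) ≤ Nat.log 2 N * Real.log 2 := by
      gcongr
      linarith [Real.log_two_gt_d9]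
    have h7 : (5 / 2) * Real.log N ≤ Real.exp 1 * Real.log N := by
      gcongr
      linarith [Real.exp_one_gt_d9]
    rw [hw]
    push_cast
    linarith
  have hlogw : Real.log w ≤ 2 * Real.log (Real.log N) := by
    have h5 := Real.log_le_log (by positivity) hupp
    rw [Real.log_mul (by positivity) (by positivity), Real.log_exp] at h5
    linarith
  have hlogw0 : 0 ≤ Real.log w := Real.log_nonneg (h4.trans hlow)
  have hd := hw₂ w (h3.trans hlow) d a ha fun F hF0 ↦
    ⟨(hF F hF0).1, (hF F hF0).2.trans_lt hNw⟩
  set l := Real.log (Real.log N) with hl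
  have hl0 : 0 < Real.log l := Real.log_pos h2
  have hl1 : 0 < l := by linarith
  rw [one_mul, Real.norm_of_nonneg hl0.le, Real.norm_of_nonneg (by positivity)] at h1
  rw [le_div_iff₀ (by positivity)]
  calc (d : ℝ) * Real.log l ^ 2
      ≤ ((2 * l) ^ (1 / 10 : ℝ)) ^ 39 * (l ^ (1 / 20 : ℝ)) ^ 2 := by
        gcongr
        exact hd.trans (by gcongr)
    _ = (2 : ℝ) ^ (39 / 10 : ℝ) * l ^ 4 := by
        rw [← Real.rpow_natCast, ← Real.rpow_natCast, ← Real.rpow_natCast,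
          ← Real.rpow_mul (by positivity), ← Real.rpow_mul hl1.le,
          Real.mul_rpow (by norm_num) hl1.le, mul_assoc, ← Real.rpow_add hl1]
        norm_num
    _ ≤ 16 * l ^ 4 := by
        gcongr
        calc (2 : ℝ) ^ (39 / 10 : ℝ) ≤ (2 : ℝ) ^ (4 : ℝ) :=
              Real.rpow_le_rpow_of_exponent_le (by norm_num) (by norm_num)
          _ = 16 := by norm_num
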